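/- arXiv:1909.04982 — 2 statements merged into one kernel-verified Lean document; each statement's English description precedes it below -/
import Mathlib

section
/- The set of positive integers n that are expressible as a sum of three squares of integers but are not expressible as a sum of three nonunit squares is finite. -/
section

open Quaternion

theorem exists_int_mul_near {N : ℤ} (hN : 0 < N) (p : ℤ) : ∃ g : ℤ, 2 * |p - N * g| ≤ N := by
  refine ⟨(2 * p + N) / (2 * N), ?_⟩
  have h1 := Int.emod_add_mul_ediv (2 * p + N) (2 * N)
  have h2 := Int.emod_nonneg (2 * p + N) (show 2 * N ≠ 0 by omega)
  have h3 := Int.emod_lt_of_pos (2 * p + N) (show 0 < 2 * N by omega)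
  set g := (2 * p + N) / (2 * N)
  have h4 : 2 * N * g = 2 * (N * g) := by ring
  rw [h4] at h1
  set u := N * g
  have : |p - u| = p - u ∨ |p - u| = -(p - u) := abs_choice _
  omega

/-- Rounding in the Lipschitz quaternions: an element of a left ideal is, up to a factor `2`,
a Hurwitz multiple of a nonzero element `α` of minimal norm. -/
theorem Quaternion.two_smul_mul_star_eq_of_minimal {I : ℍ[ℤ] → Prop}
    (hI_sub : ∀ β₁ β₂, I β₁ → I β₂ → I (β₁ - β₂)) (hI_mul : ∀ γ β, I β → I (γ * β))
    {α : ℍ[ℤ]} (hα : I α) (hpos : 0 < normSq α)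
    (hmin : ∀ β, I β → β ≠ 0 → normSq α ≤ normSq β) {δ : ℍ[ℤ]} (hδ : I δ) :
    ∃ ω : ℍ[ℤ], (2 : ℤ) • (δ * star α) = normSq α • ω ∧
      ((∃ ω' : ℍ[ℤ], ω = (2 : ℤ) • ω') ∨
        (Odd ω.re ∧ Odd ω.imI ∧ Odd ω.imJ ∧ Odd ω.imK)) := by
  set N := normSq α with hN
  set p := δ * star α with hp
  obtain ⟨g0, h0⟩ := exists_int_mul_near hpos p.re
  obtain ⟨g1, h1⟩ := exists_int_mul_near hpos p.imI
  obtain ⟨g2, h2⟩ := exists_int_mul_near hpos p.imJ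
  obtain ⟨g3, h3⟩ := exists_int_mul_near hpos p.imK
  obtain ⟨g, k0, k1, k2, k3⟩ :
      ∃ g : ℍ[ℤ], g.re = g0 ∧ g.imI = g1 ∧ g.imJ = g2 ∧ g.imK = g3 :=
    ⟨⟨g0, g1, g2, g3⟩, rfl, rfl, rfl, rfl⟩
  have hr : (δ - g * α) * star α = p - N • g := by
    rw [sub_mul, mul_assoc, self_mul_star, ← hN, ← hp]
    congr 1
    ext <;> simp [-zsmul_eq_mul, mul_comm]
  by_cases hz : δ - g * α = 0
  · refine ⟨(2 : ℤ) • g, ?_, Or.inl ⟨g, rfl⟩⟩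
    rw [hz, zero_mul] at hr
    rw [sub_eq_zero.mp hr.symm, smul_comm]
  · have hle := hmin _ (hI_sub _ _ hδ (hI_mul g _ hα)) hz
    have hnr : normSq (δ - g * α) * N = normSq (p - N • g) := by
      rw [← hr, map_mul, normSq_star]
    have hsum : normSq (p - N • g) = (p.re - N * g0) ^ 2 + (p.imI - N * g1) ^ 2
        + (p.imJ - N * g2) ^ 2 + (p.imK - N * g3) ^ 2 := by
      rw [normSq_def']
      simp [-zsmul_eq_mul, k0, k1, k2, k3]
    have hsq : ∀ x : ℤ, 2 * |x| ≤ N → 4 * x ^ 2 ≤ N ^ 2 := by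
      intro x hx
      have := abs_nonneg x
      rw [← sq_abs x]
      nlinarith
    have e0 := hsq _ h0
    have e1 := hsq _ h1
    have e2 := hsq _ h2
    have e3 := hsq _ h3
    have hge : N ^ 2 ≤ normSq (p - N • g) := by rw [← hnr]; nlinarith
    have hodd : ∀ q k : ℤ, 4 * (q - N * k) ^ 2 = N ^ 2 → ∃ s, 2 * q = N * s ∧ Odd s := by
      intro q k hq
      have : (2 * (q - N * k)) ^ 2 = N ^ 2 := by rw [← hq]; ring
      rcases sq_eq_sq_iff_eq_or_eq_neg.mp this with h | h
      · exact ⟨2 * k + 1, by linarith, ⟨k, rfl⟩⟩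
      · exact ⟨2 * k - 1, by linarith, ⟨k - 1, by ring⟩⟩
    obtain ⟨s0, hs0, o0⟩ := hodd p.re g0 (by linarith)
    obtain ⟨s1, hs1, o1⟩ := hodd p.imI g1 (by linarith)
    obtain ⟨s2, hs2, o2⟩ := hodd p.imJ g2 (by linarith)
    obtain ⟨s3, hs3, o3⟩ := hodd p.imK g3 (by linarith)
    obtain ⟨ω, rfl, rfl, rfl, rfl⟩ :
        ∃ ω : ℍ[ℤ], ω.re = s0 ∧ ω.imI = s1 ∧ ω.imJ = s2 ∧ ω.imK = s3 :=
      ⟨⟨s0, s1, s2, s3⟩, rfl, rfl, rfl, rfl⟩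
    refine ⟨ω, ?_, Or.inr ⟨o0, o1, o2, o3⟩⟩
    ext
    · simpa [-zsmul_eq_mul] using hs0
    · simpa [-zsmul_eq_mul] using hs1
    · simpa [-zsmul_eq_mul] using hs2
    · simpa [-zsmul_eq_mul] using hs3

theorem exists_quaternion_conj {n : ℕ} {v : ℍ[ℤ]} (hv0 : v.re = 0) (hv1 : v.imI = 1)
    (hvn : normSq v = n) {m : ℕ} (hm : Odd m) {B : ℤ} (hB : (m : ℤ) ∣ B ^ 2 + n) :
    ∃ α w : ℍ[ℤ], normSq α = m ∧ w.re = 0 ∧ normSq w = n ∧ α * v = w * α := by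
  have hm0 : (m : ℤ) ≠ 0 := by rcases hm with ⟨k, rfl⟩; push_cast; omega
  have hmpos : (0 : ℤ) < m := by positivity
  have hvn' : (n : ℤ) = 1 + v.imJ ^ 2 + v.imK ^ 2 := by
    rw [← hvn, normSq_def']; rw [hv0, hv1]; ring
  let I : ℍ[ℤ] → Prop := fun β => ∃ γ : ℍ[ℤ], β * (v - (B : ℍ[ℤ])) = (m : ℤ) • γ
  have hI_sub : ∀ β₁ β₂, I β₁ → I β₂ → I (β₁ - β₂) := by
    rintro _ _ ⟨g₁, h₁⟩ ⟨g₂, h₂⟩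
    exact ⟨g₁ - g₂, by rw [sub_mul, h₁, h₂, smul_sub]⟩
  have hI_mul : ∀ γ β, I β → I (γ * β) := by
    rintro γ _ ⟨g₁, h₁⟩
    exact ⟨γ * g₁, by rw [mul_assoc, h₁, mul_smul_comm]⟩
  have hI_m : I ((m : ℤ) : ℍ[ℤ]) := ⟨v - B, by rw [zsmul_eq_mul]⟩
  have hI_Bv : I ((B : ℍ[ℤ]) + v) := by
    obtain ⟨k, hk⟩ := hB
    refine ⟨((-k : ℤ) : ℍ[ℤ]), ?_⟩
    have : (m : ℤ) * k = B ^ 2 + 1 + v.imJ ^ 2 + v.imK ^ 2 := by rw [← hk, hvn']; ring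
    ext <;> simp [-zsmul_eq_mul, hv0, hv1] <;> linarith
  have hex : ∃ k : ℕ, ∃ β, I β ∧ β ≠ 0 ∧ (normSq β).natAbs = k :=
    ⟨_, ((m : ℤ) : ℍ[ℤ]), hI_m, by
      intro h
      have := congrArg QuaternionAlgebra.re h
      simp at this
      omega, rfl⟩
  classical
  obtain ⟨α, hαI, hα0, hαk⟩ := Nat.find_spec hex
  have hmin : ∀ β, I β → β ≠ 0 → normSq α ≤ normSq β := by
    intro β hβ hβ0
    have := Nat.find_min' hex ⟨β, hβ, hβ0, rfl⟩
    rw [← hαk] at this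
    have h1 : 0 ≤ normSq α := normSq_nonneg
    have h2 : 0 ≤ normSq β := normSq_nonneg
    omega
  have hdiv := fun δ hδ => two_smul_mul_star_eq_of_minimal hI_sub hI_mul hαI
    (lt_of_le_of_ne normSq_nonneg (normSq_ne_zero.mpr hα0).symm) hmin (δ := δ) hδ
  have hNpos : 0 < normSq α := lt_of_le_of_ne normSq_nonneg (normSq_ne_zero.mpr hα0).symm
  clear hmin hαk
  obtain ⟨γ, hγ⟩ := hαI
  obtain ⟨N, hN⟩ : ∃ N, N = normSq α := ⟨_, rfl⟩
  rw [← hN] at hNpos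
  simp only [← hN] at hdiv
  have hmN : (m : ℤ) ∣ N := by
    have h : star α * (α * (v - (B : ℍ[ℤ]))) = (m : ℤ) • (star α * γ) := by
      rw [hγ, mul_smul_comm]
    rw [← mul_assoc, star_mul_self, ← hN] at h
    have := congrArg QuaternionAlgebra.imI h
    rw [Quaternion.imI_smul] at this
    refine ⟨(star α * γ).imI, ?_⟩
    rw [smul_eq_mul] at this
    rw [← this]
    simp [hv1]
  obtain ⟨t, ht⟩ := hmN
  have htpos : 0 < t := by
    by_contra! h
    nlinarith
  have key : ∃ ω' : ℍ[ℤ], star α = t • ω' ∧ Odd t := by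
    obtain ⟨ω, hω, h⟩ := hdiv _ hI_m
    have hω2 : (2 : ℤ) • star α = t • ω := by
      have : (m : ℤ) • ((2 : ℤ) • star α) = (m : ℤ) • (t • ω) := by
        rw [smul_smul (m : ℤ) t, ← ht, ← hω, smul_comm, zsmul_eq_mul (star α) (m : ℤ)]
      exact smul_right_injective _ hm0 this
    have hnorm : 4 * m = t * normSq ω := by
      have h1 : normSq ((2 : ℤ) • star α) = 4 * N := by
        rw [normSq_smul, normSq_star]; norm_num [hN]
      rw [hω2, normSq_smul, ht] at h1
      have : t * (t * normSq ω) = t * (4 * m) := by linarith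
      exact (mul_left_cancel₀ htpos.ne' this).symm
    have hmo : Odd (m : ℤ) := by exact_mod_cast hm
    rcases h with ⟨ω', rfl⟩ | ⟨o0, o1, o2, o3⟩
    · refine ⟨ω', ?_, ?_⟩
      · rw [smul_comm] at hω2
        exact smul_right_injective _ two_ne_zero hω2
      · have : (m : ℤ) = t * normSq ω' := by
          rw [normSq_smul] at hnorm
          linarith
        rw [this] at hmo
        exact (Int.odd_mul.mp hmo).1
    · exfalso
      have h8 : ∀ s : ℤ, Odd s → ∃ k, s ^ 2 = 4 * k + 1 := by
        rintro s ⟨k, rfl⟩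
        exact ⟨k ^ 2 + k, by ring⟩
      obtain ⟨k0, q0⟩ := h8 _ o0
      obtain ⟨k1, q1⟩ := h8 _ o1
      obtain ⟨k2, q2⟩ := h8 _ o2
      obtain ⟨k3, q3⟩ := h8 _ o3
      have hm' : (m : ℤ) = t * (k0 + k1 + k2 + k3 + 1) := by
        rw [normSq_def', q0, q1, q2, q3] at hnorm
        linarith
      rw [hm'] at hmo
      have hto := (Int.odd_mul.mp hmo).1
      have := congrArg QuaternionAlgebra.re hω2
      rw [Quaternion.re_smul, Quaternion.re_smul, smul_eq_mul, smul_eq_mul] at this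
      have ho : Odd (t * ω.re) := hto.mul o0
      rw [← this] at ho
      exact (Int.not_odd_iff_even.mpr ⟨(star α).re, by ring⟩) ho
  obtain ⟨ω', hω', hto⟩ := key
  have ht1 : t = 1 := by
    obtain ⟨ω, hω, -⟩ := hdiv _ hI_Bv
    have h1 : (2 : ℤ) • ((B : ℍ[ℤ]) + v) = ω * α := by
      have : N • ((2 : ℤ) • ((B : ℍ[ℤ]) + v)) = N • (ω * α) := by
        rw [← smul_mul_assoc, ← hω, smul_mul_assoc, mul_assoc, star_mul_self, ← hN, smul_comm]
        congr 1
        ext <;> simp [-zsmul_eq_mul] <;> ring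
      exact smul_right_injective _ hNpos.ne' this
    have hα : α = t • star ω' := by
      rw [← star_star α, hω']
      ext <;> simp [-zsmul_eq_mul]
    rw [hα, mul_smul_comm] at h1
    have := congrArg QuaternionAlgebra.imI h1
    rw [Quaternion.imI_smul, Quaternion.imI_smul, smul_eq_mul, smul_eq_mul] at this
    have htd : t ∣ 2 := ⟨_, by simpa [hv1] using this⟩
    have := Int.le_of_dvd (by norm_num) htd
    have : t ≠ 2 := by rintro rfl; exact absurd hto (by decide)
    omega
  have hNm : N = m := by rw [ht, ht1, mul_one]
  have hαv : α * v = (γ * star α + (B : ℍ[ℤ])) * α := by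
    rw [add_mul, mul_assoc, star_mul_self, ← hN, hNm]
    have : α * v = (m : ℤ) • γ + α * (B : ℍ[ℤ]) := by rw [← hγ]; noncomm_ring
    rw [this]
    ext <;> simp [-zsmul_eq_mul, mul_comm]
  refine ⟨α, γ * star α + (B : ℍ[ℤ]), hN ▸ hNm, ?_, ?_, hαv⟩
  · have h1 : α * v * star α = N • (γ * star α + (B : ℍ[ℤ])) := by
      rw [hαv, mul_assoc, self_mul_star, ← hN]
      ext <;> simp [-zsmul_eq_mul] <;> ring
    have h2 : (α * v * star α).re = 0 := by
      simp [hv0]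
      ring
    rw [h1, Quaternion.re_smul, smul_eq_mul] at h2
    exact (mul_eq_zero.mp h2).resolve_left hNpos.ne'
  · have h1 := congrArg normSq hαv
    rw [map_mul, map_mul, ← hN, mul_comm] at h1
    have h2 := mul_right_cancel₀ hNpos.ne' h1
    rw [← h2, hvn]

end

section

open Quaternion

theorem card_norms_of_conj_le {n X : ℕ} (hn0 : 0 < n) {v w : ℍ[ℤ]} (hv0 : v.re = 0)
    (hv1 : v.imI = 1) (hvn : normSq v = n) (hw0 : w.re = 0) {M : Finset ℕ}
    (hM : ∀ m ∈ M, 0 < m ∧ m ≤ X ∧ ∃ α : ℍ[ℤ], normSq α = m ∧ α * v = w * α) :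
    (M.card : ℝ) ≤ 8 * X / √n + 4 * √X := by
  rcases M.eq_empty_or_nonempty with rfl | ⟨m₀, hm₀⟩
  · simp; positivity
  choose! h0 hX β hβ hβv using hM
  have hβne : ∀ m ∈ M, β m ≠ 0 := by
    intro m hm
    rw [← normSq_ne_zero, hβ m hm]
    exact_mod_cast (h0 m hm).ne'
  have hex : ∃ k : ℕ, ∃ α : ℍ[ℤ], α * v = w * α ∧ α ≠ 0 ∧ (normSq α).natAbs = k :=
    ⟨_, β m₀, hβv _ hm₀, hβne _ hm₀, rfl⟩
  classical
  obtain ⟨α, hαv, hα0, hαk⟩ := Nat.find_spec hex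
  obtain ⟨μ, hμ⟩ : ∃ μ, μ = Nat.find hex := ⟨_, rfl⟩
  rw [← hμ] at hαk
  have hμα : normSq α = μ := by
    have : 0 ≤ normSq α := normSq_nonneg
    omega
  have hμ0 : 0 < μ := by
    have : normSq α ≠ 0 := normSq_ne_zero.mpr hα0
    omega
  have hmin : ∀ γ : ℍ[ℤ], γ * v = w * γ → γ ≠ 0 → (μ : ℤ) ≤ normSq γ := by
    intro γ h1 h2
    have := Nat.find_min' hex ⟨γ, h1, h2, rfl⟩
    rw [← hμ] at this
    have : 0 ≤ normSq γ := normSq_nonneg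
    omega
  have hμX : μ ≤ X := by
    have := hmin _ (hβv _ hm₀) (hβne _ hm₀)
    rw [hβ _ hm₀] at this
    have := hX _ hm₀
    omega
  have hsv : star v = -v := by ext <;> simp [hv0]
  have hsw : star w = -w := by ext <;> simp [hw0]
  have hαw : star α * w = v * star α := by
    have := congrArg star hαv
    rw [star_mul, star_mul, hsv, hsw] at this
    simpa using this.symm
  have hcomm : ∀ γ : ℍ[ℤ], γ * v = w * γ → (star α * γ).imJ = (star α * γ).imI * v.imJ ∧
      (star α * γ).imK = (star α * γ).imI * v.imK := by
    intro γ hγ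
    have h : (star α * γ) * v = v * (star α * γ) := by
      rw [mul_assoc, hγ, ← mul_assoc, hαw, mul_assoc]
    generalize star α * γ = q at h
    have hJ := congrArg QuaternionAlgebra.imJ h
    have hK := congrArg QuaternionAlgebra.imK h
    rw [imJ_mul, imJ_mul, hv0, hv1] at hJ
    rw [imK_mul, imK_mul, hv0, hv1] at hK
    constructor <;> linarith
  have hnorm : ∀ γ : ℍ[ℤ], γ * v = w * γ →
      (star α * γ).re ^ 2 + n * (star α * γ).imI ^ 2 = μ * normSq γ := by
    intro γ hγ
    obtain ⟨h1, h2⟩ := hcomm γ hγ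
    rw [← hμα, ← normSq_star (a := α), ← map_mul, ← hvn, normSq_def' (a := v),
      normSq_def' (a := star α * γ), h1, h2, hv0, hv1]
    ring
  set E := Nat.sqrt (μ * X / n) with hE
  set A := Nat.sqrt (X / μ) with hA
  let f : ℕ → ℤ × ℤ := fun m => ((star α * β m).imI, (star α * β m).re / μ)
  have hmaps : ∀ m ∈ M, f m ∈ Finset.Icc (-E : ℤ) E ×ˢ Finset.Icc (-A - 1 : ℤ) A := by
    intro m hm
    have h := hnorm _ (hβv m hm)
    rw [hβ m hm] at h
    have hle : (μ : ℤ) * m ≤ μ * X := by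
      have := hX m hm
      gcongr
    simp only [f, Finset.mem_product, Finset.mem_Icc]
    generalize (star α * β m).imI = e at h
    generalize (star α * β m).re = a at h
    have he : e.natAbs ≤ E := by
      rw [hE, Nat.le_sqrt', Nat.le_div_iff_mul_le hn0]
      zify
      rw [sq_abs]
      nlinarith [sq_nonneg a]
    refine ⟨⟨by omega, by omega⟩, ?_⟩
    have key : ∀ d : ℕ, (μ * d : ℤ) ≤ |a| → d ≤ A := by
      intro d hd
      rw [hA, Nat.le_sqrt', Nat.le_div_iff_mul_le hμ0]
      have h1 : (μ * d : ℤ) ^ 2 ≤ μ * X := by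
        have : (μ * d : ℤ) ^ 2 ≤ |a| ^ 2 := by gcongr
        rw [sq_abs] at this
        nlinarith [sq_nonneg e]
      have h2 : (μ : ℤ) * (d ^ 2 * μ) ≤ μ * X := by linarith [h1]
      have := le_of_mul_le_mul_left h2 (by exact_mod_cast hμ0)
      exact_mod_cast this
    have hμz : (0 : ℤ) < μ := by exact_mod_cast hμ0
    have d1 := Int.emod_add_mul_ediv a μ
    have d2 := Int.emod_nonneg a hμz.ne'
    have d3 := Int.emod_lt_of_pos a hμz
    generalize a / (μ : ℤ) = q at *
    rcases le_or_gt 0 q with hq | hq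
    · have := key q.toNat (by
        rw [Int.toNat_of_nonneg hq]
        exact le_trans (by linarith) (le_abs_self a))
      omega
    · have := key (-(q + 1)).toNat (by
        rw [Int.toNat_of_nonneg (by omega)]
        exact le_trans (by linarith) (neg_le_abs a))
      omega
  have hinj : Set.InjOn f M := by
    intro m hm m' hm' hff
    simp only [f, Prod.mk.injEq] at hff
    by_contra hne
    have hd : β m - β m' ≠ 0 := by
      intro h
      have := congrArg normSq (sub_eq_zero.mp h)
      rw [hβ m hm, hβ m' hm'] at this
      exact hne (by exact_mod_cast this)
    have hdv : (β m - β m') * v = w * (β m - β m') := by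
      rw [sub_mul, mul_sub, hβv m hm, hβv m' hm']
    have h1 := hnorm _ hdv
    have h2 := hmin _ hdv hd
    rw [mul_sub, re_sub, imI_sub, hff.1, sub_self] at h1
    have hμz : (0 : ℤ) < μ := by exact_mod_cast hμ0
    have hge : (μ : ℤ) ^ 2 ≤ ((star α * β m).re - (star α * β m').re) ^ 2 := by nlinarith
    have hab := sq_le_sq.mp hge
    have d1 := Int.emod_add_mul_ediv (star α * β m).re μ
    have d2 := Int.emod_nonneg (star α * β m).re hμz.ne'
    have d3 := Int.emod_lt_of_pos (star α * β m).re hμz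
    have e1 := Int.emod_add_mul_ediv (star α * β m').re μ
    have e2 := Int.emod_nonneg (star α * β m').re hμz.ne'
    have e3 := Int.emod_lt_of_pos (star α * β m').re hμz
    rw [hff.2] at d1
    rw [abs_of_pos hμz] at hab
    have : |(star α * β m).re - (star α * β m').re| < μ := by
      rw [abs_lt]; constructor <;> linarith
    linarith
  have hcard := Finset.card_le_card_of_injOn f hmaps hinj
  rw [Finset.card_product, Int.card_Icc, Int.card_Icc] at hcard
  have hcard' : M.card ≤ (2 * E + 1) * (2 * A + 2) := by
    refine hcard.trans (le_of_eq ?_)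
    congr 1 <;> omega
  have hcR : (M.card : ℝ) ≤ (2 * E + 1) * (2 * A + 2) := by exact_mod_cast hcard'
  have hEs : (E : ℝ) ≤ √μ * √X / √n := by
    rw [← Real.sqrt_mul (by positivity), ← Real.sqrt_div (by positivity)]
    apply Real.le_sqrt_of_sq_le
    calc (E : ℝ) ^ 2 ≤ ((μ * X / n : ℕ) : ℝ) := by exact_mod_cast Nat.sqrt_le' _
      _ ≤ ((μ * X : ℕ) : ℝ) / n := Nat.cast_div_le
      _ = _ := by push_cast; rfl
  have hAs : (A : ℝ) ≤ √X / √μ := by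
    rw [← Real.sqrt_div (by positivity)]
    apply Real.le_sqrt_of_sq_le
    calc (A : ℝ) ^ 2 ≤ ((X / μ : ℕ) : ℝ) := by exact_mod_cast Nat.sqrt_le' _
      _ ≤ _ := Nat.cast_div_le
  have s1 : 1 ≤ √(μ : ℝ) := by rw [Real.one_le_sqrt]; exact_mod_cast hμ0
  have s2 : √(μ : ℝ) ≤ √X := by gcongr
  have s3 : 0 < √(n : ℝ) := by positivity
  have t1 : √(X : ℝ) / √μ ≤ √X := div_le_self (by positivity) s1
  calc (M.card : ℝ) ≤ (2 * E + 1) * (2 * A + 2) := hcR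
    _ ≤ (2 * (√μ * √X / √n) + 1) * (2 * (√X / √μ) + 2) := by gcongr
    _ = 4 * (√X * √X / √n) + 4 * (√μ * √X / √n) + 2 * (√X / √μ) + 2 := by
      field_simp; ring
    _ ≤ 4 * (√X * √X / √n) + 4 * (√X * √X / √n) + 2 * √X + 2 * √X := by
      gcongr
      linarith
    _ = 8 * X / √n + 4 * √X := by
      rw [Real.mul_self_sqrt (by positivity)]; ring

end

section

open Quaternion

/-- The representations of `n` as an ordered sum of three integer squares. -/
noncomputable def threeSqReps (n : ℕ) : Finset (ℤ × ℤ × ℤ) :=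
  {p ∈ Finset.Icc (-n : ℤ) n ×ˢ Finset.Icc (-n : ℤ) n ×ˢ Finset.Icc (-n : ℤ) n |
    p.1 ^ 2 + p.2.1 ^ 2 + p.2.2 ^ 2 = n}

theorem abs_le_of_sq_le_natCast {x : ℤ} {n : ℕ} (h : x ^ 2 ≤ n) : |x| ≤ n := by
  rw [← sq_abs] at h
  by_contra! hx
  have : (0 : ℤ) ≤ n := by positivity
  nlinarith

theorem mem_threeSqReps {n : ℕ} {p : ℤ × ℤ × ℤ} :
    p ∈ threeSqReps n ↔ p.1 ^ 2 + p.2.1 ^ 2 + p.2.2 ^ 2 = n := by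
  simp only [threeSqReps, Finset.mem_filter, Finset.mem_product, Finset.mem_Icc,
    and_iff_right_iff_imp]
  intro h
  have h1 := abs_le.mp (abs_le_of_sq_le_natCast (x := p.1) (n := n)
    (by nlinarith [sq_nonneg p.2.1, sq_nonneg p.2.2]))
  have h2 := abs_le.mp (abs_le_of_sq_le_natCast (x := p.2.1) (n := n)
    (by nlinarith [sq_nonneg p.1, sq_nonneg p.2.2]))
  have h3 := abs_le.mp (abs_le_of_sq_le_natCast (x := p.2.2) (n := n)
    (by nlinarith [sq_nonneg p.2.1, sq_nonneg p.1]))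
  exact ⟨h1, h2, h3⟩

open Classical in
/-- The odd moduli up to `X` modulo which `-n` is a square. -/
noncomputable def negSqModuli (n X : ℕ) : Finset ℕ :=
  {m ∈ Finset.Icc 1 X | Odd m ∧ ∃ B : ℤ, (m : ℤ) ∣ B ^ 2 + n}

theorem mem_negSqModuli {n X m : ℕ} :
    m ∈ negSqModuli n X ↔ (1 ≤ m ∧ m ≤ X) ∧ Odd m ∧ ∃ B : ℤ, (m : ℤ) ∣ B ^ 2 + n := by
  classical
  simp [negSqModuli]

theorem card_negSqModuli_le {n : ℕ} {b c : ℤ} (hn : (n : ℤ) = 1 + b ^ 2 + c ^ 2) (X : ℕ) :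
    ((negSqModuli n X).card : ℝ) ≤ (threeSqReps n).card * (8 * X / √n + 4 * √X) := by
  classical
  obtain ⟨v, hv0, hv1, hv2, hv3⟩ :
      ∃ v : ℍ[ℤ], v.re = 0 ∧ v.imI = 1 ∧ v.imJ = b ∧ v.imK = c :=
    ⟨⟨0, 1, b, c⟩, rfl, rfl, rfl, rfl⟩
  have hvn : normSq v = n := by rw [normSq_def', hv0, hv1, hv2, hv3, hn]; ring
  have hn0 : 0 < n := by
    have : (0 : ℤ) < n := by rw [hn]; positivity
    exact_mod_cast this
  let q : ℤ × ℤ × ℤ → ℍ[ℤ] := fun p => ⟨0, p.1, p.2.1, p.2.2⟩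
  let S : ℤ × ℤ × ℤ → Finset ℕ := fun p =>
    {m ∈ negSqModuli n X | ∃ α : ℍ[ℤ], normSq α = m ∧ α * v = q p * α}
  have hsub : negSqModuli n X ⊆ (threeSqReps n).biUnion S := by
    intro m hm
    obtain ⟨-, hodd, B, hB⟩ := mem_negSqModuli.mp hm
    obtain ⟨α, w, hα, hw0, hwn, hαv⟩ := exists_quaternion_conj hv0 hv1 hvn hodd hB
    refine Finset.mem_biUnion.mpr ⟨(w.imI, w.imJ, w.imK), ?_, ?_⟩
    · rw [mem_threeSqReps, ← hwn, normSq_def', hw0]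
      ring
    · refine Finset.mem_filter.mpr ⟨hm, α, hα, ?_⟩
      have : q (w.imI, w.imJ, w.imK) = w := by ext <;> simp [q, hw0]
      rw [this, hαv]
  have hS : ∀ p ∈ threeSqReps n, ((S p).card : ℝ) ≤ 8 * X / √n + 4 * √X := by
    intro p hp
    refine card_norms_of_conj_le (w := q p) hn0 hv0 hv1 hvn rfl fun m hm => ?_
    obtain ⟨hm, hα⟩ := Finset.mem_filter.mp hm
    obtain ⟨⟨h1, h2⟩, -⟩ := mem_negSqModuli.mp hm
    exact ⟨h1, h2, hα⟩
  calc ((negSqModuli n X).card : ℝ) ≤ ((threeSqReps n).biUnion S).card := by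
        exact_mod_cast Finset.card_le_card hsub
    _ ≤ ((∑ p ∈ threeSqReps n, (S p).card : ℕ) : ℝ) := by
        exact_mod_cast Finset.card_biUnion_le
    _ = ∑ p ∈ threeSqReps n, ((S p).card : ℝ) := by push_cast; rfl
    _ ≤ ∑ _p ∈ threeSqReps n, (8 * X / √n + 4 * √X) := Finset.sum_le_sum hS
    _ = _ := by rw [Finset.sum_const, nsmul_eq_mul]

end

theorem add_one_le_mul_rpow_two {ε : ℝ} (h0 : 0 < ε) (h1 : ε ≤ 1) (k : ℕ) :
    (k + 1 : ℝ) ≤ 2 / ε * (2 : ℝ) ^ (ε * k) := by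
  have hlog := Real.log_two_gt_d9
  have h : ε * k / 2 + 1 ≤ (2 : ℝ) ^ (ε * k) := by
    rw [Real.rpow_def_of_pos two_pos]
    refine le_trans ?_ (Real.add_one_le_exp _)
    have : 0 ≤ ε * k := by positivity
    nlinarith
  calc (k + 1 : ℝ) ≤ 2 / ε * (ε * k / 2 + 1) := by
        have : 1 ≤ 2 / ε := by rw [le_div_iff₀ h0]; linarith
        have e : 2 / ε * (ε * k / 2 + 1) = k + 2 / ε := by field_simp
        linarith
    _ ≤ _ := by gcongr

theorem exists_card_divisors_le {ε : ℝ} (h0 : 0 < ε) (h1 : ε ≤ 1) :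
    ∃ C : ℝ, 1 ≤ C ∧ ∀ n : ℕ, 0 < n → (n.divisors.card : ℝ) ≤ C * (n : ℝ) ^ ε := by
  obtain ⟨P, hP⟩ := exists_nat_ge ((2 : ℝ) ^ ε⁻¹)
  have hc : 1 ≤ 2 / ε := by rw [le_div_iff₀ h0]; linarith
  refine ⟨(2 / ε) ^ P, one_le_pow₀ hc, fun n hn => ?_⟩
  have hloc : ∀ p : ℕ, 2 ≤ p → ∀ k : ℕ,
      (k + 1 : ℝ) ≤ (if p < P then 2 / ε else 1) * ((p : ℝ) ^ k) ^ ε := by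
    intro p hp k
    have hp' : (2 : ℝ) ≤ p := by exact_mod_cast hp
    rw [← Real.rpow_natCast, ← Real.rpow_mul (by positivity), mul_comm (k : ℝ)]
    split_ifs with h
    · refine (add_one_le_mul_rpow_two h0 h1 k).trans ?_
      gcongr
    · push Not at h
      have h2 : (2 : ℝ) ≤ (p : ℝ) ^ ε := by
        have : ((2 : ℝ) ^ ε⁻¹) ^ ε ≤ (p : ℝ) ^ ε := by
          gcongr
          exact hP.trans (by exact_mod_cast h)
        rwa [← Real.rpow_mul two_pos.le, inv_mul_cancel₀ h0.ne', Real.rpow_one] at this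
      rw [one_mul, Real.rpow_mul (by positivity), Real.rpow_natCast]
      calc (k + 1 : ℝ) ≤ 2 ^ k := by exact_mod_cast Nat.lt_two_pow_self
        _ ≤ _ := by gcongr
  have hprod : (n : ℝ) = ∏ p ∈ n.primeFactors, (p : ℝ) ^ n.factorization p := by
    conv_lhs => rw [← Nat.prod_factorization_pow_eq_self hn.ne']
    rw [Nat.prod_factorization_eq_prod_primeFactors]
    push_cast
    rfl
  rw [Nat.card_divisors hn.ne']
  push_cast
  calc ∏ p ∈ n.primeFactors, ((n.factorization p : ℝ) + 1)
      ≤ ∏ p ∈ n.primeFactors,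
          (if p < P then 2 / ε else 1) * ((p : ℝ) ^ n.factorization p) ^ ε :=
        Finset.prod_le_prod (fun _ _ => by positivity)
          fun p hp => hloc p (Nat.prime_of_mem_primeFactors hp).two_le _
    _ = (∏ p ∈ n.primeFactors, if p < P then 2 / ε else 1) * (n : ℝ) ^ ε := by
        rw [Finset.prod_mul_distrib, Real.finsetProd_rpow _ _ fun _ _ => by positivity, ← hprod]
    _ ≤ (2 / ε) ^ P * (n : ℝ) ^ ε := by
        gcongr
        rw [Finset.prod_ite, Finset.prod_const, Finset.prod_const_one, mul_one]
        apply pow_le_pow_right₀ hc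
        calc _ ≤ (Finset.range P).card := Finset.card_le_card fun p hp => by
              simpa using (Finset.mem_filter.mp hp).2
          _ = P := Finset.card_range P

/-- Primitive representations as a sum of two squares are determined, up to ten choices, by
a divisor. -/
theorem card_primitive_two_sq_le {N : ℕ} (hN : 0 < N) {P : Finset (ℤ × ℤ)}
    (hP : ∀ p ∈ P, p.1 ^ 2 + p.2 ^ 2 = N ∧ IsCoprime p.1 p.2) :
    P.card ≤ 10 * N.divisors.card := by
  rcases P.eq_empty_or_nonempty with rfl | ⟨p₀, hp₀⟩
  · simp
  have hNz : (0 : ℤ) < N := by exact_mod_cast hN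
  let cr : ℤ × ℤ → ℤ × ℤ → ℤ := fun p q => p.1 * q.2 - q.1 * p.2
  let f : ℤ × ℤ → ℕ := fun p => Int.gcd N (cr p p₀)
  refine Finset.card_le_mul_card_image_of_maps_to (f := f) (t := N.divisors) ?_ 10 ?_
  · intro p _
    rw [Nat.mem_divisors]
    exact ⟨by exact_mod_cast Int.gcd_dvd_left (N : ℤ) (cr p p₀), hN.ne'⟩
  intro D hD
  rcases (P.filter fun p => f p = D).eq_empty_or_nonempty with h | ⟨q, hq⟩
  · rw [h]; simp
  obtain ⟨hqP, hqD⟩ := Finset.mem_filter.mp hq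
  have hcop : ∀ p ∈ P, IsCoprime p.2 (N : ℤ) ∧ IsCoprime p.1 (N : ℤ) := by
    intro p hp
    obtain ⟨h1, h2⟩ := hP p hp
    constructor
    · rw [← h1, sq p.2]
      exact (h2.symm.pow_right (n := 2)).add_mul_left_right p.2
    · rw [← h1, add_comm, sq p.1]
      exact (h2.pow_right (n := 2)).add_mul_left_right p.1
  obtain ⟨E, hE⟩ : D ∣ N := Nat.dvd_of_mem_divisors hD
  have hEz : (N : ℤ) = D * E := by exact_mod_cast hE
  have hD0 : (D : ℤ) ≠ 0 := by rintro h; rw [h] at hEz; simp at hEz; omega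
  have hdv : ∀ p ∈ P, f p = D → (D : ℤ) ∣ cr p p₀ ∧ (E : ℤ) ∣ p.1 * p₀.2 + p₀.1 * p.2 := by
    intro p hp hpD
    have hd : (D : ℤ) ∣ cr p p₀ := by rw [← hpD]; exact Int.gcd_dvd_right _ _
    refine ⟨hd, ?_⟩
    obtain ⟨k, hk⟩ := hd
    have hEk : IsCoprime (E : ℤ) k := by
      have h1 : Int.gcd (D * E) (D * k) = D := by rw [← hEz, ← hk]; exact hpD
      rw [Int.gcd_mul_left, Int.natAbs_natCast] at h1
      rw [Int.isCoprime_iff_gcd_eq_one]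
      have hDn : 0 < D := by omega
      exact Nat.eq_of_mul_eq_mul_left hDn (by rw [h1, mul_one])
    have hmul : (D : ℤ) * E * (p.1 ^ 2 - p₀.1 ^ 2) = D * (k * (p.1 * p₀.2 + p₀.1 * p.2)) := by
      rw [← mul_assoc, ← hk, ← hEz]
      have e1 := (hP p hp).1
      have e2 := (hP p₀ hp₀).1
      simp only [cr]
      linear_combination (p₀.1 ^ 2) * e1 - (p.1 ^ 2) * e2
    rw [mul_assoc] at hmul
    exact hEk.dvd_of_dvd_mul_left ⟨_, (mul_left_cancel₀ hD0 hmul).symm⟩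
  have hdvd2 : ∀ p ∈ P, f p = D → (N : ℤ) ∣ 2 * cr p q := by
    intro p hp hpD
    obtain ⟨a1, a2⟩ := hdv p hp hpD
    obtain ⟨b1, b2⟩ := hdv q hqP hqD
    obtain ⟨c2, c1⟩ := hcop p₀ hp₀
    obtain ⟨d2, d1⟩ := hcop p hp
    have hDc : (D : ℤ) ∣ cr p q := by
      have : (D : ℤ) ∣ p₀.2 * cr p q := by
        have e : p₀.2 * cr p q = q.2 * cr p p₀ - p.2 * cr q p₀ := by simp only [cr]; ring
        rw [e]
        exact dvd_sub (a1.mul_left _) (b1.mul_left _)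
      exact (c2.symm.of_isCoprime_of_dvd_left ⟨E, hEz⟩).dvd_of_dvd_mul_left this
    have hEc : (E : ℤ) ∣ cr p q := by
      have : (E : ℤ) ∣ p₀.2 * cr p q := by
        have e : p₀.2 * cr p q = q.2 * (p.1 * p₀.2 + p₀.1 * p.2)
            - p.2 * (q.1 * p₀.2 + p₀.1 * q.2) := by simp only [cr]; ring
        rw [e]
        exact dvd_sub (a2.mul_left _) (b2.mul_left _)
      exact (c2.symm.of_isCoprime_of_dvd_left ⟨D, by rw [hEz, mul_comm]⟩).dvd_of_dvd_mul_left this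
    have hG : ((Int.gcd D E : ℕ) : ℤ) ∣ 2 := by
      have g1 : ((Int.gcd D E : ℕ) : ℤ) ∣ D := Int.gcd_dvd_left _ _
      have g2 : ((Int.gcd D E : ℕ) : ℤ) ∣ E := Int.gcd_dvd_right _ _
      have g3 : ((Int.gcd D E : ℕ) : ℤ) ∣ (p.1 * p₀.2) * 2 := by
        have e : (p.1 * p₀.2) * 2 = cr p p₀ + (p.1 * p₀.2 + p₀.1 * p.2) := by
          simp only [cr]; ring
        rw [e]
        exact dvd_add (g1.trans a1) (g2.trans a2)
      have g4 : ((Int.gcd D E : ℕ) : ℤ) ∣ N := g1.trans ⟨E, hEz⟩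
      exact ((d1.mul_left c2).symm.of_isCoprime_of_dvd_left g4).dvd_of_dvd_mul_left g3
    have h1 : (N : ℤ) ∣ Int.gcd D E * cr p q := by
      have hb := Int.gcd_eq_gcd_ab (D : ℤ) E
      rw [hb, hEz, add_mul]
      obtain ⟨u, hu⟩ := hDc
      obtain ⟨w, hw⟩ := hEc
      refine dvd_add ?_ ?_
      · rw [hw]; exact ⟨Int.gcdA D E * w, by ring⟩
      · rw [hu]; exact ⟨Int.gcdB D E * u, by ring⟩
    exact h1.trans (mul_dvd_mul_right hG _)
  let F : ℤ × ℤ → ℤ × Bool := fun p => (2 * cr p q / N, decide (0 ≤ p.1 * q.1 + p.2 * q.2))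
  have hsum : ∀ p ∈ P, cr p q ^ 2 + (p.1 * q.1 + p.2 * q.2) ^ 2 = (N : ℤ) ^ 2 := by
    intro p hp
    simp only [cr]
    linear_combination (q.1 ^ 2 + q.2 ^ 2) * (hP p hp).1 + N * (hP q hqP).1
  refine (Finset.card_le_card_of_injOn F (t := Finset.Icc (-2 : ℤ) 2 ×ˢ Finset.univ) ?_ ?_).trans
    (by simp)
  · intro p hp
    obtain ⟨hp, hpD⟩ := Finset.mem_filter.mp hp
    obtain ⟨k, hk⟩ := hdvd2 p hp hpD
    simp only [F, hk, Finset.coe_product, Set.mem_prod, Finset.mem_coe, Finset.mem_Icc,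
      Finset.mem_univ, and_true]
    rw [Int.mul_ediv_cancel_left _ hNz.ne', ← abs_le]
    have h1 : cr p q ^ 2 ≤ (N : ℤ) ^ 2 := by
      nlinarith [hsum p hp, sq_nonneg (p.1 * q.1 + p.2 * q.2)]
    have h2 : ((N : ℤ) * k) ^ 2 ≤ (2 * N) ^ 2 := by rw [← hk]; nlinarith
    have h3 := sq_le_sq.mp h2
    rw [abs_of_pos (show (0 : ℤ) < 2 * N by linarith), abs_mul, abs_of_pos hNz, mul_comm 2] at h3
    exact le_of_mul_le_mul_left h3 hNz
  · intro p hp p' hp' hff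
    obtain ⟨hp, hpD⟩ := Finset.mem_filter.mp hp
    obtain ⟨hp', hpD'⟩ := Finset.mem_filter.mp hp'
    simp only [F, Prod.mk.injEq, decide_eq_decide] at hff
    obtain ⟨h1, h2⟩ := hff
    have hc : cr p q = cr p' q := by
      have := Int.ediv_mul_cancel (hdvd2 p hp hpD)
      have := Int.ediv_mul_cancel (hdvd2 p' hp' hpD')
      rw [h1] at *
      linarith
    have hdot : p.1 * q.1 + p.2 * q.2 = p'.1 * q.1 + p'.2 * q.2 := by
      have e1 := hsum p hp
      have e2 := hsum p' hp'
      rw [hc] at e1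
      have : (p.1 * q.1 + p.2 * q.2) ^ 2 = (p'.1 * q.1 + p'.2 * q.2) ^ 2 := by linarith
      rcases sq_eq_sq_iff_eq_or_eq_neg.mp this with h | h
      · exact h
      · by_cases h0 : 0 ≤ p.1 * q.1 + p.2 * q.2
        · have := h2.mp h0
          omega
        · have := mt h2.mpr h0
          omega
    have hq := (hP q hqP).1
    simp only [cr] at hc
    have x1 : (N : ℤ) * p.1 = N * p'.1 := by
      rw [← hq]; linear_combination q.1 * hdot + q.2 * hc
    have x2 : (N : ℤ) * p.2 = N * p'.2 := by
      rw [← hq]; linear_combination q.2 * hdot - q.1 * hc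
    exact Prod.ext (mul_left_cancel₀ hNz.ne' x1) (mul_left_cancel₀ hNz.ne' x2)

/-- The representations of `N` as an ordered sum of two integer squares. -/
noncomputable def twoSqReps (N : ℕ) : Finset (ℤ × ℤ) :=
  {p ∈ Finset.Icc (-N : ℤ) N ×ˢ Finset.Icc (-N : ℤ) N | p.1 ^ 2 + p.2 ^ 2 = N}

theorem mem_twoSqReps {N : ℕ} {p : ℤ × ℤ} :
    p ∈ twoSqReps N ↔ p.1 ^ 2 + p.2 ^ 2 = N := by
  simp only [twoSqReps, Finset.mem_filter, Finset.mem_product, Finset.mem_Icc,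
    and_iff_right_iff_imp]
  intro h
  exact ⟨abs_le.mp (abs_le_of_sq_le_natCast (by nlinarith [sq_nonneg p.2])),
    abs_le.mp (abs_le_of_sq_le_natCast (by nlinarith [sq_nonneg p.1]))⟩

theorem card_twoSqReps_le {N : ℕ} (hN : 0 < N) :
    (twoSqReps N).card ≤ 10 * N.divisors.card ^ 2 := by
  classical
  have hNz : (N : ℤ) ≠ 0 := by exact_mod_cast hN.ne'
  let Q : ℕ → Finset (ℤ × ℤ) := fun g => (twoSqReps N).filter fun p => Int.gcd p.1 p.2 = g
  have hsub : twoSqReps N ⊆ N.divisors.biUnion Q := by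
    intro p hp
    refine Finset.mem_biUnion.mpr ⟨Int.gcd p.1 p.2, ?_, Finset.mem_filter.mpr ⟨hp, rfl⟩⟩
    rw [Nat.mem_divisors]
    refine ⟨?_, hN.ne'⟩
    have := mem_twoSqReps.mp hp
    have h : ((Int.gcd p.1 p.2 : ℕ) : ℤ) ∣ N := by
      rw [← this]
      exact dvd_add (dvd_pow (Int.gcd_dvd_left _ _) two_ne_zero)
        (dvd_pow (Int.gcd_dvd_right _ _) two_ne_zero)
    exact_mod_cast h
  have hQ : ∀ g ∈ N.divisors, (Q g).card ≤ 10 * N.divisors.card := by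
    intro g hg
    have hg0 : 0 < g := Nat.pos_of_mem_divisors hg
    have hgz : (g : ℤ) ≠ 0 := by exact_mod_cast hg0.ne'
    rcases (Q g).eq_empty_or_nonempty with h | ⟨q, hq⟩
    · rw [h]; simp
    have hfac : ∀ p ∈ Q g, ∃ x y : ℤ, p.1 = g * x ∧ p.2 = g * y ∧ IsCoprime x y ∧
        (N : ℤ) = g ^ 2 * (x ^ 2 + y ^ 2) := by
      intro p hp
      obtain ⟨hp, hpg⟩ := Finset.mem_filter.mp hp
      obtain ⟨x, hx⟩ : (g : ℤ) ∣ p.1 := by rw [← hpg]; exact Int.gcd_dvd_left _ _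
      obtain ⟨y, hy⟩ : (g : ℤ) ∣ p.2 := by rw [← hpg]; exact Int.gcd_dvd_right _ _
      refine ⟨x, y, hx, hy, ?_, ?_⟩
      · rw [hx, hy, Int.gcd_mul_left, Int.natAbs_natCast] at hpg
        rw [Int.isCoprime_iff_gcd_eq_one]
        exact Nat.eq_of_mul_eq_mul_left hg0 (by rw [hpg, mul_one])
      · rw [← mem_twoSqReps.mp hp, hx, hy]; ring
    choose! x y hx hy hc hxy using hfac
    have hdvd : g ^ 2 ∣ N := by
      have : ((g ^ 2 : ℕ) : ℤ) ∣ N := ⟨_, by push_cast; exact hxy q hq⟩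
      exact_mod_cast this
    obtain ⟨M, hM⟩ := hdvd
    have hM0 : 0 < M := by
      rcases Nat.eq_zero_or_pos M with h | h
      · rw [h] at hM; omega
      · exact h
    have hcard := card_primitive_two_sq_le hM0 (P := (Q g).image fun p => (x p, y p)) (by
      intro p' hp'
      obtain ⟨p, hp, rfl⟩ := Finset.mem_image.mp hp'
      refine ⟨?_, hc p hp⟩
      have := hxy p hp
      rw [hM] at this
      push_cast at this
      exact (mul_left_cancel₀ (pow_ne_zero 2 hgz) this).symm)
    rw [Finset.card_image_of_injOn] at hcard
    · refine hcard.trans ?_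
      have : M ∣ N := ⟨g ^ 2, by rw [hM, mul_comm]⟩
      gcongr
    · intro p hp p' hp' h
      simp only [Prod.mk.injEq] at h
      exact Prod.ext (by rw [hx p hp, hx p' hp', h.1]) (by rw [hy p hp, hy p' hp', h.2])
  calc (twoSqReps N).card ≤ (N.divisors.biUnion Q).card := Finset.card_le_card hsub
    _ ≤ N.divisors.card * (10 * N.divisors.card) := Finset.card_biUnion_le_card_mul _ _ _ hQ
    _ = _ := by ring

/-- `n` is a sum of three squares, but every such representation uses a unit. -/
def NeedsUnitSquare (n : ℕ) : Prop :=
  0 < n ∧ (∃ a b c : ℤ, (n : ℤ) = a ^ 2 + b ^ 2 + c ^ 2) ∧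
    ¬∃ x y z : ℤ, (n : ℤ) = x ^ 2 + y ^ 2 + z ^ 2 ∧ x ^ 2 ≠ 1 ∧ y ^ 2 ≠ 1 ∧ z ^ 2 ≠ 1

theorem NeedsUnitSquare.one_of_rep {n : ℕ} (h : NeedsUnitSquare n) {x y z : ℤ}
    (hn : (n : ℤ) = x ^ 2 + y ^ 2 + z ^ 2) : x ^ 2 = 1 ∨ y ^ 2 = 1 ∨ z ^ 2 = 1 := by
  by_contra! hne
  exact h.2.2 ⟨x, y, z, hn, hne⟩

theorem NeedsUnitSquare.exists_eq {n : ℕ} (h : NeedsUnitSquare n) :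
    ∃ b c : ℤ, (n : ℤ) = 1 + b ^ 2 + c ^ 2 := by
  obtain ⟨a, b, c, habc⟩ := h.2.1
  rcases h.one_of_rep habc with e | e | e
  · exact ⟨b, c, by rw [habc, e]⟩
  · exact ⟨a, c, by rw [habc, e]; ring⟩
  · exact ⟨a, b, by rw [habc, e]; ring⟩

theorem NeedsUnitSquare.card_threeSqReps_le {n : ℕ} (h : NeedsUnitSquare n) :
    (threeSqReps n).card ≤ 6 * (twoSqReps (n - 1)).card := by
  classical
  have h0 := h.1
  let U : Finset ℤ := {1, -1}
  let f : Fin 3 × ℤ × ℤ × ℤ → ℤ × ℤ × ℤ := fun t =>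
    if t.1 = 0 then (t.2.1, t.2.2.1, t.2.2.2)
    else if t.1 = 1 then (t.2.2.1, t.2.1, t.2.2.2) else (t.2.2.1, t.2.2.2, t.2.1)
  have hsub : threeSqReps n ⊆
      ((Finset.univ : Finset (Fin 3)) ×ˢ U ×ˢ twoSqReps (n - 1)).image f := by
    rintro ⟨x, y, z⟩ hp
    have hp := mem_threeSqReps.mp hp
    simp only at hp
    have hU : ∀ u : ℤ, u ^ 2 = 1 → u ∈ U := by
      intro u hu
      rcases sq_eq_sq_iff_eq_or_eq_neg.mp (hu.trans (one_pow 2).symm) with e | e <;> simp [U, e]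
    have hcast : ((n - 1 : ℕ) : ℤ) = n - 1 := by push_cast [Nat.cast_sub h0]; ring
    rw [Finset.mem_image]
    rcases h.one_of_rep hp.symm with e | e | e
    · exact ⟨(0, x, y, z), by simp [mem_twoSqReps, hcast, hU _ e]; linarith, by simp [f]⟩
    · exact ⟨(1, y, x, z), by simp [mem_twoSqReps, hcast, hU _ e]; linarith, by simp [f]⟩
    · exact ⟨(2, z, x, y), by simp [mem_twoSqReps, hcast, hU _ e]; linarith, by simp [f]⟩
  calc _ ≤ _ := Finset.card_le_card hsub
    _ ≤ _ := Finset.card_image_le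
    _ = _ := by
      rw [Finset.card_product, Finset.card_product]
      simp [U]
      ring

theorem exists_card_threeSqReps_le {ε : ℝ} (h0 : 0 < ε) (h1 : ε ≤ 1) :
    ∃ C : ℝ, 1 ≤ C ∧ ∀ n : ℕ, 2 ≤ n → NeedsUnitSquare n →
      ((threeSqReps n).card : ℝ) ≤ C * (n : ℝ) ^ ε := by
  obtain ⟨C, hC, hd⟩ := exists_card_divisors_le (half_pos h0) (by linarith)
  refine ⟨60 * C ^ 2, by nlinarith, fun n hn h => ?_⟩
  have hN : 0 < n - 1 := by omega
  have hb : ((n - 1 : ℕ).divisors.card : ℝ) ≤ C * (n : ℝ) ^ (ε / 2) := by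
    refine (hd _ hN).trans ?_
    gcongr
    exact Nat.sub_le _ _
  have hnat : (threeSqReps n).card ≤ 60 * (n - 1 : ℕ).divisors.card ^ 2 := by
    have := h.card_threeSqReps_le
    have := card_twoSqReps_le hN
    omega
  calc ((threeSqReps n).card : ℝ) ≤ 60 * ((n - 1 : ℕ).divisors.card : ℝ) ^ 2 := by
        exact_mod_cast hnat
    _ ≤ 60 * (C * (n : ℝ) ^ (ε / 2)) ^ 2 := by gcongr
    _ = 60 * C ^ 2 * (n : ℝ) ^ ε := by
      rw [mul_pow, ← Real.rpow_natCast, ← Real.rpow_natCast, ← Real.rpow_mul (by positivity)]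
      norm_num
      ring

section

open NumberTheorySymbols

/-- The Kronecker-type character `m ↦ J(N | m)`, extended by zero to even `m`. -/
noncomputable def evenJacobi (N : ℤ) (m : ℕ) : ℤ := if Even m then 0 else jacobiSym N m

theorem evenJacobi_of_odd {N : ℤ} {m : ℕ} (h : Odd m) : evenJacobi N m = jacobiSym N m :=
  if_neg (Nat.not_even_iff_odd.mpr h)

theorem evenJacobi_of_even {N : ℤ} {m : ℕ} (h : Even m) : evenJacobi N m = 0 := if_pos h

theorem evenJacobi_zero (N : ℤ) : evenJacobi N 0 = 0 := evenJacobi_of_even Even.zero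

theorem evenJacobi_one (N : ℤ) : evenJacobi N 1 = 1 := by
  rw [evenJacobi_of_odd odd_one, jacobiSym.one_right]

theorem evenJacobi_mul (N : ℤ) (a b : ℕ) :
    evenJacobi N (a * b) = evenJacobi N a * evenJacobi N b := by
  rcases Nat.even_or_odd a with ha | ha
  · rw [evenJacobi_of_even (ha.mul_right b), evenJacobi_of_even ha, zero_mul]
  rcases Nat.even_or_odd b with hb | hb
  · rw [evenJacobi_of_even (hb.mul_left a), evenJacobi_of_even hb, mul_zero]
  rw [evenJacobi_of_odd (ha.mul hb), evenJacobi_of_odd ha, evenJacobi_of_odd hb,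
    jacobiSym.mul_right' _ ha.pos.ne' hb.pos.ne']

theorem evenJacobi_mul_left (N₁ N₂ : ℤ) (m : ℕ) :
    evenJacobi (N₁ * N₂) m = evenJacobi N₁ m * evenJacobi N₂ m := by
  rcases Nat.even_or_odd m with hm | hm
  · simp [evenJacobi_of_even hm]
  · simp [evenJacobi_of_odd hm, jacobiSym.mul_left]

theorem evenJacobi_trichotomy (N : ℤ) (m : ℕ) :
    evenJacobi N m = 0 ∨ evenJacobi N m = 1 ∨ evenJacobi N m = -1 := by
  rcases Nat.even_or_odd m with hm | hm
  · exact Or.inl (evenJacobi_of_even hm)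
  · rw [evenJacobi_of_odd hm]
    exact jacobiSym.trichotomy N m

theorem abs_evenJacobi_le_one (N : ℤ) (m : ℕ) : |evenJacobi N m| ≤ 1 := by
  rcases evenJacobi_trichotomy N m with h | h | h <;> rw [h] <;> norm_num

theorem evenJacobi_periodic (N : ℤ) : Function.Periodic (evenJacobi N) (4 * N.natAbs) := by
  intro m
  rcases Nat.even_or_odd m with hm | hm
  · rw [evenJacobi_of_even hm, evenJacobi_of_even]
    exact hm.add (Even.mul_right ⟨2, rfl⟩ _)
  · have hm' : Odd (m + 4 * N.natAbs) := hm.add_even (Even.mul_right ⟨2, rfl⟩ _)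
    rw [evenJacobi_of_odd hm, evenJacobi_of_odd hm', jacobiSym.mod_right _ hm',
      jacobiSym.mod_right _ hm, Nat.add_mod_right]

theorem sum_period_evenJacobi {N : ℤ} (hN : N ≠ 0) {r : ℕ} (hr : evenJacobi N r = -1) :
    ∑ a ∈ Finset.range (4 * N.natAbs), evenJacobi N a = 0 := by
  set q := 4 * N.natAbs with hq
  have hq0 : q ≠ 0 := by simp [hq, hN]
  have : NeZero q := ⟨hq0⟩
  have hodd : Odd r := by
    by_contra h
    rw [evenJacobi_of_even (Nat.not_odd_iff_even.mp h)] at hr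
    norm_num at hr
  have hcop : r.Coprime q := by
    have h1 : N.gcd r = 1 := by
      by_contra h
      rw [evenJacobi_of_odd hodd, jacobiSym.eq_zero_iff.mpr ⟨hodd.pos.ne', h⟩] at hr
      norm_num at hr
    refine Nat.Coprime.mul_right ?_ ?_
    · exact (Nat.coprime_two_right.mpr hodd).pow_right 2
    · rw [Nat.coprime_comm]; exact h1
  have hsum : ∑ a ∈ Finset.range q, evenJacobi N a = ∑ x : ZMod q, evenJacobi N x.val := by
    refine (Finset.sum_bij (fun x _ => x.val) ?_ ?_ ?_ ?_).symm
    · intro x _; exact Finset.mem_range.mpr (ZMod.val_lt x)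
    · intro x _ y _ h; exact ZMod.val_injective q h
    · intro a ha
      exact ⟨a, Finset.mem_univ _, ZMod.val_cast_of_lt (Finset.mem_range.mp ha)⟩
    · intro x _; rfl
  have hper := evenJacobi_periodic N
  have hmul : ∀ x : ZMod q, evenJacobi N ((ZMod.unitOfCoprime r hcop : ZMod q) * x).val
      = -evenJacobi N x.val := by
    intro x
    have h1 : (ZMod.unitOfCoprime r hcop : ZMod q) * x = ((r * x.val : ℕ) : ZMod q) := by
      simp
    rw [h1, ZMod.val_natCast, hper.map_mod_nat, evenJacobi_mul, hr]
    ring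
  have h2 : ∑ x : ZMod q, evenJacobi N x.val = -∑ x : ZMod q, evenJacobi N x.val := by
    conv_lhs => rw [← Equiv.sum_comp (Units.mulLeft (ZMod.unitOfCoprime r hcop))]
    rw [← Finset.sum_neg_distrib]
    exact Finset.sum_congr rfl fun x _ => hmul x
  rw [hsum]
  linarith

theorem abs_sum_evenJacobi_le {N : ℤ} (hN : N ≠ 0) {r : ℕ} (hr : evenJacobi N r = -1) (K : ℕ) :
    |∑ a ∈ Finset.range K, evenJacobi N a| ≤ 4 * |N| := by
  induction K using Nat.strong_induction_on with
  | _ K ih =>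
    have hcast : ((4 * N.natAbs : ℕ) : ℤ) = 4 * |N| := by push_cast; ring
    rcases lt_or_ge K (4 * N.natAbs) with h | h
    · calc |∑ a ∈ Finset.range K, evenJacobi N a|
          ≤ ∑ a ∈ Finset.range K, |evenJacobi N a| := Finset.abs_sum_le_sum_abs _ _
        _ ≤ ∑ _a ∈ Finset.range K, 1 := Finset.sum_le_sum fun a _ => abs_evenJacobi_le_one N a
        _ ≤ _ := by simp; omega
    · obtain ⟨k, rfl⟩ := Nat.exists_eq_add_of_le h
      have hpos : 0 < 4 * N.natAbs := by omega
      rw [Finset.sum_range_add, sum_period_evenJacobi hN hr, zero_add]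
      have : ∀ x, evenJacobi N (4 * N.natAbs + x) = evenJacobi N x := fun x => by
        rw [add_comm]; exact evenJacobi_periodic N x
      simp only [this]
      exact ih k (by omega)

theorem exists_evenJacobi_neg_eq_neg_one {n : ℕ} (hn : 0 < n) :
    ∃ r, evenJacobi (-n) r = -1 := by
  have hodd : Odd (4 * n - 1) := ⟨2 * n - 1, by omega⟩
  refine ⟨4 * n - 1, ?_⟩
  have h1 : jacobiSym n (4 * n - 1) = 1 := by
    have h4 : jacobiSym (4 * n) (4 * n - 1) = 1 := by
      have : (4 * n : ℤ) % ((4 * n - 1 : ℕ) : ℤ) = 1 % ((4 * n - 1 : ℕ) : ℤ) := by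
        have e : (4 * n : ℤ) = 1 + ((4 * n - 1 : ℕ) : ℤ) := by omega
        rw [e, Int.add_emod_right]
      rw [jacobiSym.mod_left' this, jacobiSym.one_left]
    rwa [jacobiSym.mul_left, jacobiSym.at_four hodd, one_mul] at h4
  rw [evenJacobi_of_odd hodd, jacobiSym.neg _ hodd, h1, mul_one,
    ZMod.χ₄_nat_three_mod_four (by omega)]

theorem exists_odd_factorization {N : ℕ} (hN : N ≠ 0) (hsq : ¬IsSquare N) :
    ∃ p, p.Prime ∧ Odd (N.factorization p) := by
  obtain ⟨a, b, rfl, ha⟩ := Nat.sq_mul_squarefree N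
  have ha1 : a ≠ 1 := by
    rintro rfl
    exact hsq ⟨b, by ring⟩
  obtain ⟨p, hp, hpa⟩ := Nat.exists_prime_and_dvd ha1
  have ha0 : a ≠ 0 := ha.ne_zero
  have hb0 : b ^ 2 ≠ 0 := left_ne_zero_of_mul hN
  refine ⟨p, hp, ?_⟩
  have h1 : a.factorization p = 1 :=
    le_antisymm (ha.natFactorization_le_one p) ((hp.dvd_iff_one_le_factorization ha0).mp hpa)
  rw [Nat.factorization_mul hb0 ha0, Nat.factorization_pow]
  simp [h1]

theorem exists_evenJacobi_eq_neg_one {N : ℕ} (hN : N ≠ 0) (hsq : ¬IsSquare N) :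
    ∃ r, evenJacobi N r = -1 := by
  obtain ⟨p, hp, k, hk⟩ := exists_odd_factorization hN hsq
  set M := N / p ^ N.factorization p with hM
  have hNM : N = p ^ N.factorization p * M := (Nat.ordProj_mul_ordCompl_eq_self N p).symm
  have hM0 : M ≠ 0 := (Nat.ordCompl_pos p hN).ne'
  have hpM : p.Coprime M := Nat.coprime_ordCompl hp hN
  have key : ∀ r : ℕ, jacobiSym p r = -1 → jacobiSym M r = 1 → jacobiSym N r = -1 := by
    intro r h1 h2
    rw [hNM, hk]
    push_cast
    rw [jacobiSym.mul_left, jacobiSym.pow_left, h1, h2, mul_one]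
    exact Odd.neg_one_pow ⟨k, rfl⟩
  rcases hp.eq_two_or_odd' with rfl | hp2
  · have hMo : Odd M := Nat.coprime_two_left.mp hpM
    obtain ⟨r, hr1, hr2⟩ := Nat.chineseRemainder
      (show Nat.Coprime 8 M from (Nat.coprime_two_left.mpr hMo).pow_left 3) 5 1
    have hr8 : r % 8 = 5 := hr1
    have hro : Odd r := by rw [Nat.odd_iff]; omega
    refine ⟨r, ?_⟩
    rw [evenJacobi_of_odd hro]
    refine key r ?_ ?_
    · rw [show ((2 : ℕ) : ℤ) = 2 from rfl, jacobiSym.at_two hro, ZMod.χ₈_nat_eq_if_mod_eight,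
        if_neg (by omega), if_neg (by omega)]
    · rw [← jacobiSym.quadratic_reciprocity_one_mod_four (by omega) hMo]
      have : (r : ℤ) % M = 1 % M := by exact_mod_cast hr2
      rw [jacobiSym.mod_left' this, jacobiSym.one_left]
  · have : Fact p.Prime := ⟨hp⟩
    obtain ⟨x, hx⟩ := FiniteField.exists_nonsquare (F := ZMod p) (by
      rw [ZMod.ringChar_zmod_n]; rintro rfl; exact absurd hp2 (by decide))
    have hcop : Nat.Coprime p (4 * M) :=
      Nat.Coprime.mul_right ((Nat.coprime_two_right.mpr hp2).pow_right 2) hpM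
    obtain ⟨r, hr1, hr2⟩ := Nat.chineseRemainder hcop x.val 1
    have hr4 : r % 4 = 1 := by
      have : r ≡ 1 [MOD 4] := hr2.of_mul_right M
      exact this
    have hro : Odd r := by rw [Nat.odd_iff]; omega
    refine ⟨r, ?_⟩
    rw [evenJacobi_of_odd hro]
    refine key r ?_ ?_
    · rw [← jacobiSym.quadratic_reciprocity_one_mod_four hr4 hp2,
        ← jacobiSym.legendreSym.to_jacobiSym, legendreSym.eq_neg_one_iff]
      have : ((r : ℤ) : ZMod p) = x := by
        have := (ZMod.natCast_eq_natCast_iff _ _ _).mpr hr1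
        push_cast
        rw [this, ZMod.natCast_val, ZMod.cast_id]
      rwa [this]
    · rw [jacobiSym.mod_right _ hro, Int.natAbs_natCast]
      have : r % (4 * M) = 1 := by
        have h : r % (4 * M) = 1 % (4 * M) := hr2
        rwa [Nat.mod_eq_of_lt (show 1 < 4 * M by omega)] at h
      rw [this, jacobiSym.one_right]

end

section

open ArithmeticFunction

open scoped ArithmeticFunction.zeta

/-- `evenJacobi N` as a real arithmetic function. -/
noncomputable def jacobiArith (N : ℤ) : ArithmeticFunction ℝ :=
  ⟨fun m => (evenJacobi N m : ℝ), by simp [evenJacobi_zero]⟩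

theorem jacobiArith_apply (N : ℤ) (m : ℕ) : jacobiArith N m = evenJacobi N m := rfl

theorem jacobiArith_mul (N : ℤ) (a b : ℕ) :
    jacobiArith N (a * b) = jacobiArith N a * jacobiArith N b := by
  simp only [jacobiArith_apply, evenJacobi_mul]
  push_cast
  rfl

theorem jacobiArith_one (N : ℤ) : jacobiArith N 1 = 1 := by
  simp [jacobiArith_apply, evenJacobi_one]

theorem isMultiplicative_jacobiArith (N : ℤ) : (jacobiArith N).IsMultiplicative :=
  ⟨jacobiArith_one N, fun _ => jacobiArith_mul N _ _⟩

theorem jacobiArith_pow (N : ℤ) (a k : ℕ) : jacobiArith N (a ^ k) = jacobiArith N a ^ k := by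
  induction k with
  | zero => simp [jacobiArith_one]
  | succ k ih => rw [pow_succ, jacobiArith_mul, ih, pow_succ]

theorem jacobiArith_trichotomy (N : ℤ) (m : ℕ) :
    jacobiArith N m = 0 ∨ jacobiArith N m = 1 ∨ jacobiArith N m = -1 := by
  rw [jacobiArith_apply]
  exact_mod_cast evenJacobi_trichotomy N m

theorem abs_jacobiArith_le_one (N : ℤ) (m : ℕ) : |jacobiArith N m| ≤ 1 := by
  rcases jacobiArith_trichotomy N m with h | h | h <;> rw [h] <;> norm_num

theorem jacobiArith_mul_left (N₁ N₂ : ℤ) (m : ℕ) :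
    jacobiArith (N₁ * N₂) m = jacobiArith N₁ m * jacobiArith N₂ m := by
  simp only [jacobiArith_apply, evenJacobi_mul_left]
  push_cast
  rfl

theorem abs_sum_jacobiArith_le {N : ℤ} (hN : N ≠ 0) {r : ℕ} (hr : evenJacobi N r = -1) (K : ℕ) :
    |∑ a ∈ Finset.range K, jacobiArith N a| ≤ 4 * |(N : ℝ)| := by
  simp only [jacobiArith_apply]
  exact_mod_cast abs_sum_evenJacobi_le hN hr K

/-- The convolution `1 * χ`. -/
noncomputable def jacobiDivSum (N : ℤ) : ArithmeticFunction ℝ :=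
  (ζ : ArithmeticFunction ℝ) * jacobiArith N

theorem jacobiDivSum_apply (N : ℤ) (m : ℕ) :
    jacobiDivSum N m = ∑ d ∈ m.divisors, jacobiArith N d := coe_zeta_mul_apply

theorem isMultiplicative_jacobiDivSum (N : ℤ) : (jacobiDivSum N).IsMultiplicative :=
  isMultiplicative_zeta.natCast.mul (isMultiplicative_jacobiArith N)

theorem jacobiDivSum_prime_pow (N : ℤ) {p : ℕ} (hp : p.Prime) (k : ℕ) :
    jacobiDivSum N (p ^ k) = ∑ i ∈ Finset.range (k + 1), jacobiArith N p ^ i := by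
  rw [jacobiDivSum_apply, Nat.sum_divisors_prime_pow hp]
  simp only [jacobiArith_pow]

theorem jacobiDivSum_prime_pow_of_neg {N : ℤ} {p : ℕ} (hp : p.Prime)
    (h : jacobiArith N p = -1) (k : ℕ) :
    jacobiDivSum N (p ^ k) = if Even k then 1 else 0 := by
  rw [jacobiDivSum_prime_pow N hp, h, neg_one_geom_sum]
  simp only [Nat.even_add_one]
  split_ifs <;> simp_all

theorem jacobiDivSum_prime_pow_nonneg (N : ℤ) {p : ℕ} (hp : p.Prime) (k : ℕ) :
    0 ≤ jacobiDivSum N (p ^ k) := by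
  rcases jacobiArith_trichotomy N p with h | h | h
  · rw [jacobiDivSum_prime_pow N hp, h]
    exact Finset.sum_nonneg fun i _ => by positivity
  · rw [jacobiDivSum_prime_pow N hp, h]
    exact Finset.sum_nonneg fun i _ => by positivity
  · rw [jacobiDivSum_prime_pow_of_neg hp h]
    split_ifs <;> norm_num

theorem ArithmeticFunction.IsMultiplicative.nonneg {f : ArithmeticFunction ℝ}
    (hf : f.IsMultiplicative) (h : ∀ p k : ℕ, p.Prime → 0 ≤ f (p ^ k)) (m : ℕ) : 0 ≤ f m := by
  rcases eq_or_ne m 0 with rfl | hm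
  · simp
  · rw [hf.multiplicative_factorization f hm]
    exact Finset.prod_nonneg fun p hp => h p _ (Nat.prime_of_mem_primeFactors hp)

theorem jacobiDivSum_nonneg (N : ℤ) (m : ℕ) : 0 ≤ jacobiDivSum N m :=
  (isMultiplicative_jacobiDivSum N).nonneg (fun _ k hp => jacobiDivSum_prime_pow_nonneg N hp k) m

theorem jacobiDivSum_le (N : ℤ) (m : ℕ) : jacobiDivSum N m ≤ m.divisors.card := by
  rw [jacobiDivSum_apply]
  calc ∑ d ∈ m.divisors, jacobiArith N d ≤ ∑ _d ∈ m.divisors, (1 : ℝ) :=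
        Finset.sum_le_sum fun d _ => (le_abs_self _).trans (abs_jacobiArith_le_one N d)
    _ = _ := by simp

theorem jacobiArith_ne_neg_one_of_odd {N : ℤ} {m : ℕ} (h : jacobiDivSum N m ≠ 0) {p : ℕ}
    (hp : p.Prime) (hodd : Odd (m.factorization p)) : jacobiArith N p ≠ -1 := by
  intro hneg
  have hm : m ≠ 0 := by rintro rfl; simp at h
  apply h
  rw [(isMultiplicative_jacobiDivSum N).multiplicative_factorization _ hm, Finsupp.prod,
    Finset.prod_eq_zero_iff]
  refine ⟨p, ?_, ?_⟩
  · rw [Finsupp.mem_support_iff]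
    rintro h0
    rw [h0] at hodd
    exact absurd hodd (by decide)
  · rw [jacobiDivSum_prime_pow_of_neg hp hneg, if_neg (Nat.not_even_iff_odd.mpr hodd)]

theorem exists_dvd_sq_add_of_prime {n m : ℕ} (hm : Squarefree m)
    (h : ∀ p, p.Prime → p ∣ m → ∃ B : ℤ, (p : ℤ) ∣ B ^ 2 + n) :
    ∃ B : ℤ, (m : ℤ) ∣ B ^ 2 + n := by
  induction m using Nat.strong_induction_on with
  | _ m ih =>
    rcases eq_or_ne m 1 with rfl | h1
    · exact ⟨0, by simp⟩
    obtain ⟨p, hp, k, rfl⟩ := Nat.exists_prime_and_dvd h1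
    have hcop := Nat.coprime_of_squarefree_mul hm
    have hk0 : 0 < k := Nat.pos_of_ne_zero (right_ne_zero_of_mul hm.ne_zero)
    obtain ⟨B₁, hB₁⟩ := h p hp ⟨k, rfl⟩
    obtain ⟨B₂, hB₂⟩ := ih k (by nlinarith [hp.two_le]) (hm.of_mul_right)
      fun q hq hqk => h q hq (hqk.mul_left p)
    have hcz : IsCoprime (p : ℤ) k := Nat.isCoprime_iff_coprime.mpr hcop
    obtain ⟨u, v, huv⟩ := hcz
    refine ⟨B₁ * (v * k) + B₂ * (u * p), ?_⟩
    push_cast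
    have hcz : IsCoprime (p : ℤ) k := Nat.isCoprime_iff_coprime.mpr hcop
    refine hcz.mul_dvd ?_ ?_
    · obtain ⟨x, hx⟩ := hB₁
      have e : v * (k : ℤ) = 1 - u * p := by linarith
      rw [e]
      exact ⟨x + u * (-2 * B₁ ^ 2 + u * p * B₁ ^ 2 + 2 * B₁ * B₂ - 2 * B₁ * B₂ * u * p
        + B₂ ^ 2 * u * p), by linear_combination hx⟩
    · obtain ⟨x, hx⟩ := hB₂
      have e : u * (p : ℤ) = 1 - v * k := by linarith
      rw [e]
      exact ⟨x + v * (-2 * B₂ ^ 2 + v * k * B₂ ^ 2 + 2 * B₁ * B₂ - 2 * B₁ * B₂ * v * k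
        + B₁ ^ 2 * v * k), by linear_combination hx⟩

theorem exists_eq_of_jacobiDivSum_ne_zero {n m X : ℕ} (hmX : m ≤ X)
    (h : jacobiDivSum (-n) m ≠ 0) :
    ∃ e i m' : ℕ, 1 ≤ e ∧ e ≤ X ∧ i < 2 ∧ m' ∈ negSqModuli n (X / e ^ 2) ∧
      m = 2 ^ i * e ^ 2 * m' := by
  have hm : m ≠ 0 := by rintro rfl; simp at h
  obtain ⟨a, e, hae, ha⟩ := Nat.sq_mul_squarefree m
  have he0 : 0 < e := by
    rcases Nat.eq_zero_or_pos e with h | h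
    · rw [h] at hae; simp at hae; omega
    · exact h
  have ha0 : a ≠ 0 := ha.ne_zero
  have hprime : ∀ p, p.Prime → p ∣ a → jacobiArith (-n) p ≠ -1 := by
    intro p hp hpa
    refine jacobiArith_ne_neg_one_of_odd h hp ?_
    have h1 : a.factorization p = 1 :=
      le_antisymm (ha.natFactorization_le_one p) ((hp.dvd_iff_one_le_factorization ha0).mp hpa)
    rw [← hae, Nat.factorization_mul (by positivity) ha0, Nat.factorization_pow]
    simp [h1]
  obtain ⟨i, m', hi, hodd, ham⟩ : ∃ i m' : ℕ, i < 2 ∧ Odd m' ∧ a = 2 ^ i * m' := by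
    rcases Nat.even_or_odd' a with ⟨k, hk | hk⟩
    · refine ⟨1, k, by norm_num, ?_, by simpa using hk⟩
      by_contra hk2
      obtain ⟨j, rfl⟩ := Nat.not_odd_iff_even.mp hk2
      have : IsUnit 2 := ha 2 ⟨j, by rw [hk]; ring⟩
      simp at this
    · exact ⟨0, a, by norm_num, ⟨k, hk⟩, by simp⟩
  have hm'a : m' ∣ a := ⟨2 ^ i, by rw [ham, mul_comm]⟩
  have hm'le : m' * e ^ 2 ≤ m := by
    rw [← hae, ham]
    nlinarith [Nat.one_le_two_pow (n := i), Nat.zero_le (m' * e ^ 2)]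
  refine ⟨e, i, m', he0, ?_, hi, ?_, by rw [← hae, ham]; ring⟩
  · have := hodd.pos
    nlinarith
  · rw [mem_negSqModuli]
    refine ⟨⟨hodd.pos, ?_⟩, hodd, ?_⟩
    · rw [Nat.le_div_iff_mul_le (by positivity)]
      exact hm'le.trans hmX
    · refine exists_dvd_sq_add_of_prime (ha.squarefree_of_dvd hm'a) fun p hp hpm => ?_
      have : Fact p.Prime := ⟨hp⟩
      have hne := hprime p hp (hpm.trans hm'a)
      have hpo : Odd p := hodd.of_dvd_nat hpm
      rw [jacobiArith_apply, evenJacobi_of_odd hpo] at hne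
      have hne' : jacobiSym (-n) p ≠ -1 := by exact_mod_cast hne
      have hsq : IsSquare (((-n : ℤ)) : ZMod p) := by
        by_contra hns
        exact hne' (ZMod.nonsquare_iff_jacobiSym_eq_neg_one.mpr hns)
      obtain ⟨r, hr⟩ := hsq
      refine ⟨r.val, ?_⟩
      rw [← ZMod.intCast_zmod_eq_zero_iff_dvd]
      push_cast at hr ⊢
      rw [ZMod.natCast_val, ZMod.cast_id, sq, ← hr]
      ring

end

section

open ArithmeticFunction

theorem exists_sum_rpow_neg_le : ∃ K : ℝ, 0 < K ∧ ∀ U : ℕ,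
    ∑ e ∈ Finset.Icc 1 U, ((e : ℝ) ^ (15 / 8 : ℝ))⁻¹ ≤ K := by
  have hs : Summable fun e : ℕ => ((e : ℝ) ^ (15 / 8 : ℝ))⁻¹ :=
    Real.summable_nat_rpow_inv.mpr (by norm_num)
  refine ⟨(∑' e : ℕ, ((e : ℝ) ^ (15 / 8 : ℝ))⁻¹) + 1, ?_, fun U => ?_⟩
  · have : 0 ≤ ∑' e : ℕ, ((e : ℝ) ^ (15 / 8 : ℝ))⁻¹ := tsum_nonneg fun e => by positivity
    linarith
  · have := hs.sum_le_tsum (Finset.Icc 1 U) fun e _ => by positivity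
    linarith

theorem card_negSqModuli_le_rpow {n : ℕ} (hn : NeedsUnitSquare n) {w : ℕ} (hw : w ≤ n ^ 8) :
    ((negSqModuli n w).card : ℝ) ≤ 12 * (threeSqReps n).card * (w : ℝ) ^ (15 / 16 : ℝ) := by
  obtain ⟨b, c, hbc⟩ := hn.exists_eq
  refine (card_negSqModuli_le hbc w).trans ?_
  have hn0 : (0 : ℝ) < n := by exact_mod_cast hn.1
  rcases Nat.eq_zero_or_pos w with rfl | hw0
  · simp
  have hw1 : (1 : ℝ) ≤ w := by exact_mod_cast hw0
  have hw' : (w : ℝ) ≤ (n : ℝ) ^ 8 := by exact_mod_cast hw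
  have h1 : √(w : ℝ) ≤ (w : ℝ) ^ (15 / 16 : ℝ) := by
    rw [Real.sqrt_eq_rpow]
    exact Real.rpow_le_rpow_of_exponent_le hw1 (by norm_num)
  have h2 : (w : ℝ) / √n ≤ (w : ℝ) ^ (15 / 16 : ℝ) := by
    rw [div_le_iff₀ (by positivity)]
    have e : (w : ℝ) = (w : ℝ) ^ (15 / 16 : ℝ) * (w : ℝ) ^ (1 / 16 : ℝ) := by
      rw [← Real.rpow_add (by positivity)]; norm_num
    have h3 : (w : ℝ) ^ (1 / 16 : ℝ) ≤ √n := by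
      calc (w : ℝ) ^ (1 / 16 : ℝ) ≤ ((n : ℝ) ^ 8) ^ (1 / 16 : ℝ) := by gcongr
        _ = √n := by
          rw [← Real.rpow_natCast, ← Real.rpow_mul hn0.le, Real.sqrt_eq_rpow]; norm_num
    calc (w : ℝ) = (w : ℝ) ^ (15 / 16 : ℝ) * (w : ℝ) ^ (1 / 16 : ℝ) := e
      _ ≤ _ := by gcongr
  have h4 : 8 * (w : ℝ) / √n + 4 * √w ≤ 12 * (w : ℝ) ^ (15 / 16 : ℝ) := by
    rw [mul_div_assoc]; linarith
  calc ((threeSqReps n).card : ℝ) * (8 * w / √n + 4 * √w)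
      ≤ (threeSqReps n).card * (12 * (w : ℝ) ^ (15 / 16 : ℝ)) := by gcongr
    _ = _ := by ring

/-- A power saving in short sums of `1 * χ` for the exceptional `n`. -/
theorem exists_sum_jacobiDivSum_le : ∃ K : ℝ, 1 ≤ K ∧ ∀ n : ℕ, 2 ≤ n → NeedsUnitSquare n →
    ∀ u : ℕ, u ≤ n ^ 8 → ∑ m ∈ Finset.Ioc 0 u, jacobiDivSum (-n) m ≤
      K * (n : ℝ) ^ (1 / 32 : ℝ) * (u : ℝ) ^ (15 / 16 : ℝ) := by
  classical
  obtain ⟨C, hC, hd⟩ := exists_card_divisors_le (ε := 1 / 512) (by norm_num) (by norm_num)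
  obtain ⟨S, hS, hSn⟩ := exists_card_threeSqReps_le (ε := 1 / 64) (by norm_num) (by norm_num)
  obtain ⟨T, hT, hTU⟩ := exists_sum_rpow_neg_le
  refine ⟨max 1 (24 * C * S * T), le_max_left _ _, fun n hn2 hn u hu => ?_⟩
  have hn0 : (0 : ℝ) < n := by exact_mod_cast hn.1
  set P := (Finset.Ioc 0 u).filter fun m => jacobiDivSum (-n) m ≠ 0 with hP
  have hval : ∀ m ∈ P, jacobiDivSum (-n) m ≤ C * (n : ℝ) ^ (1 / 64 : ℝ) := by
    intro m hm
    obtain ⟨hm, -⟩ := Finset.mem_filter.mp hm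
    obtain ⟨hm0, hmu⟩ := Finset.mem_Ioc.mp hm
    have hmn : (m : ℝ) ≤ (n : ℝ) ^ 8 := by exact_mod_cast hmu.trans hu
    refine (jacobiDivSum_le _ m).trans ((hd m hm0).trans ?_)
    gcongr
    calc (m : ℝ) ^ (1 / 512 : ℝ) ≤ ((n : ℝ) ^ 8) ^ (1 / 512 : ℝ) := by gcongr
      _ = _ := by rw [← Real.rpow_natCast, ← Real.rpow_mul hn0.le]; norm_num
  have hsub : P ⊆ (Finset.Icc 1 u ×ˢ Finset.range 2).biUnion fun t =>
      (negSqModuli n (u / t.1 ^ 2)).image fun m' => 2 ^ t.2 * t.1 ^ 2 * m' := by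
    intro m hm
    obtain ⟨hm, hg⟩ := Finset.mem_filter.mp hm
    obtain ⟨e, i, m', he, heu, hi, hm', rfl⟩ :=
      exists_eq_of_jacobiDivSum_ne_zero (Finset.mem_Ioc.mp hm).2 hg
    refine Finset.mem_biUnion.mpr ⟨(e, i), ?_, Finset.mem_image.mpr ⟨m', hm', rfl⟩⟩
    simp [he, heu, hi]
  have hcard : (P.card : ℝ) ≤
      24 * (threeSqReps n).card * (u : ℝ) ^ (15 / 16 : ℝ) * T := by
    calc (P.card : ℝ) ≤ ((∑ t ∈ Finset.Icc 1 u ×ˢ Finset.range 2,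
          (negSqModuli n (u / t.1 ^ 2)).card : ℕ) : ℝ) := by
          refine Nat.cast_le.mpr ((Finset.card_le_card hsub).trans
            (Finset.card_biUnion_le.trans ?_))
          exact Finset.sum_le_sum fun t _ => Finset.card_image_le
      _ = 2 * ∑ e ∈ Finset.Icc 1 u, ((negSqModuli n (u / e ^ 2)).card : ℝ) := by
          rw [Finset.sum_product]
          simp only [Finset.sum_const, Finset.card_range]
          push_cast
          rw [Finset.mul_sum]
          simp
      _ ≤ 2 * ∑ e ∈ Finset.Icc 1 u, 12 * (threeSqReps n).card *
            ((u : ℝ) ^ (15 / 16 : ℝ) * ((e : ℝ) ^ (15 / 8 : ℝ))⁻¹) := by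
          gcongr with e he
          have he0 : (0 : ℝ) < e := by exact_mod_cast (Finset.mem_Icc.mp he).1
          refine (card_negSqModuli_le_rpow hn ((Nat.div_le_self _ _).trans hu)).trans ?_
          gcongr
          calc ((u / e ^ 2 : ℕ) : ℝ) ^ (15 / 16 : ℝ) ≤ ((u : ℝ) / (e : ℝ) ^ 2) ^ (15 / 16 : ℝ) := by
                gcongr
                exact_mod_cast Nat.cast_div_le
            _ = _ := by
                rw [Real.div_rpow (by positivity) (by positivity), ← Real.rpow_natCast (e : ℝ),
                  ← Real.rpow_mul he0.le, div_eq_mul_inv]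
                norm_num
      _ = 24 * (threeSqReps n).card * (u : ℝ) ^ (15 / 16 : ℝ) *
            ∑ e ∈ Finset.Icc 1 u, ((e : ℝ) ^ (15 / 8 : ℝ))⁻¹ := by
          rw [Finset.mul_sum, Finset.mul_sum]
          exact Finset.sum_congr rfl fun e _ => by ring
      _ ≤ _ := by gcongr; exact hTU u
  calc ∑ m ∈ Finset.Ioc 0 u, jacobiDivSum (-n) m = ∑ m ∈ P, jacobiDivSum (-n) m :=
        (Finset.sum_filter_ne_zero _).symm
    _ ≤ ∑ _m ∈ P, C * (n : ℝ) ^ (1 / 64 : ℝ) := Finset.sum_le_sum hval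
    _ = P.card * (C * (n : ℝ) ^ (1 / 64 : ℝ)) := by rw [Finset.sum_const, nsmul_eq_mul]
    _ ≤ 24 * (S * (n : ℝ) ^ (1 / 64 : ℝ)) * (u : ℝ) ^ (15 / 16 : ℝ) * T *
          (C * (n : ℝ) ^ (1 / 64 : ℝ)) := by
        gcongr
        refine hcard.trans ?_
        gcongr
        exact hSn n hn2 hn
    _ = 24 * C * S * T * (n : ℝ) ^ (1 / 32 : ℝ) * (u : ℝ) ^ (15 / 16 : ℝ) := by
        have : (n : ℝ) ^ (1 / 32 : ℝ) = (n : ℝ) ^ (1 / 64 : ℝ) * (n : ℝ) ^ (1 / 64 : ℝ) := by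
          rw [← Real.rpow_add hn0]; norm_num
        rw [this]; ring
    _ ≤ _ := by
        gcongr
        exact le_max_right _ _

end

theorem sum_inv_Icc_le (J : ℕ) : ∑ g ∈ Finset.Icc 1 J, ((g : ℝ))⁻¹ ≤ 2 * √J := by
  induction J with
  | zero => simp
  | succ J ih =>
    rw [Finset.sum_Icc_succ_top (by omega)]
    have h1 : 1 ≤ √((J + 1 : ℕ) : ℝ) := by
      rw [Real.one_le_sqrt]; push_cast; linarith [Nat.cast_nonneg (α := ℝ) J]
    have h2 : √(J : ℝ) ≤ √((J + 1 : ℕ) : ℝ) := by gcongr; simp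
    have e1 := Real.sq_sqrt (Nat.cast_nonneg (α := ℝ) (J + 1))
    have e2 := Real.sq_sqrt (Nat.cast_nonneg (α := ℝ) J)
    have h0 := Real.sqrt_nonneg (J : ℝ)
    set x := √((J + 1 : ℕ) : ℝ)
    set y := √(J : ℝ)
    have e3 : x ^ 2 - y ^ 2 = 1 := by rw [e1, e2]; push_cast; ring
    have h3 : ((J + 1 : ℕ) : ℝ)⁻¹ ≤ 2 * (x - y) := by
      rw [← e1, inv_le_iff_one_le_mul₀ (by positivity)]
      have : 0 ≤ x - y := by linarith
      nlinarith [mul_nonneg this (by linarith : (0:ℝ) ≤ x - 1),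
        mul_nonneg this (mul_nonneg (by linarith : (0:ℝ) ≤ x - 1) (by linarith : (0:ℝ) ≤ x))]
    linarith

theorem card_negSqModuli_le_sqrt {n : ℕ} (hn : NeedsUnitSquare n) {w : ℕ} (hw : w ≤ n) :
    ((negSqModuli n w).card : ℝ) ≤ 12 * (threeSqReps n).card * √w := by
  obtain ⟨b, c, hbc⟩ := hn.exists_eq
  refine (card_negSqModuli_le hbc w).trans ?_
  have hn0 : (0 : ℝ) < n := by exact_mod_cast hn.1
  have h1 : (w : ℝ) / √n ≤ √w := by
    rw [div_le_iff₀ (by positivity)]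
    calc (w : ℝ) = √w * √w := (Real.mul_self_sqrt (by positivity)).symm
      _ ≤ √w * √n := by gcongr
  have h2 : 8 * (w : ℝ) / √n + 4 * √w ≤ 12 * √w := by rw [mul_div_assoc]; linarith
  calc ((threeSqReps n).card : ℝ) * (8 * w / √n + 4 * √w)
      ≤ (threeSqReps n).card * (12 * √w) := by gcongr
    _ = _ := by ring

theorem exists_dvd_sq_add_of_mul_eq_sq {n₁ n₂ k a b : ℤ} (h : n₁ * n₂ = k ^ 2)
    (hab : IsCoprime a b) (ha : IsCoprime a (4 * n₁)) :
    ∃ B : ℤ, a ^ 2 + 4 * n₁ * b ^ 2 ∣ B ^ 2 + n₂ := by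
  have hc : IsCoprime a (a ^ 2 + 4 * n₁ * b ^ 2) := by
    rw [sq a, add_comm]
    exact (ha.mul_right (hab.pow_right (n := 2))).add_mul_left_right a
  obtain ⟨u, v, huv⟩ := hc
  refine ⟨k * 2 * b * u, ?_⟩
  have : (a ^ 2 + 4 * n₁ * b ^ 2) ∣ a ^ 2 * ((k * 2 * b * u) ^ 2 + n₂) := by
    refine ⟨n₂ - 4 * k ^ 2 * b ^ 2 * v * (1 + u * a), ?_⟩
    linear_combination (4 * k ^ 2 * b ^ 2 * (u * a + 1)) * huv - 4 * b ^ 2 * h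
  exact (IsCoprime.pow_left (m := 2) ⟨u, v, huv⟩).symm.dvd_of_dvd_mul_left this

theorem pairs_le_of_mul_eq_sq {n₁ n₂ k J T X : ℕ} (hn₁ : 0 < n₁) (h : n₁ * n₂ = k ^ 2)
    (hT : J ^ 2 ≤ T) (hX : 20 * n₁ ^ 2 * T ^ 2 ≤ X) :
    T * J ≤ ∑ g ∈ Finset.Icc 1 J, (negSqModuli n₂ (X / g ^ 2)).card := by
  classical
  let f : ℕ × ℕ → ℕ := fun p => (2 * n₁ * p.1 + 1) ^ 2 + 4 * n₁ * p.2 ^ 2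
  have hinj : Set.InjOn f (Finset.Ico T (2 * T) ×ˢ Finset.Icc 1 J : Finset (ℕ × ℕ)) := by
    have key : ∀ t b t' b' : ℕ, T ≤ t → b ≤ J → b' ≤ J → f (t, b) = f (t', b') → t' ≤ t := by
      intro t b t' b' ht hb hb' hf
      by_contra! hlt
      simp only [f] at hf
      have h1 : 2 * n₁ * t + 1 + 2 * n₁ ≤ 2 * n₁ * t' + 1 := by nlinarith
      have h2 : (2 * n₁ * t + 1 + 2 * n₁) ^ 2 ≤ (2 * n₁ * t' + 1) ^ 2 := by gcongr
      have h3 : b ^ 2 ≤ t := le_trans (by gcongr) (hT.trans ht)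
      have h4 : n₁ * b ^ 2 ≤ n₁ * t := by gcongr
      have h5 : n₁ * t ≤ n₁ ^ 2 * t := by nlinarith [Nat.zero_le (n₁ * t)]
      nlinarith [Nat.zero_le (n₁ * b' ^ 2)]
    rintro ⟨t, b⟩ hp ⟨t', b'⟩ hp' hf
    simp only [Finset.coe_product, Set.mem_prod, Finset.mem_coe, Finset.mem_Ico,
      Finset.mem_Icc] at hp hp'
    have htt : t = t' := le_antisymm
      (key t' b' t b hp'.1.1 hp'.2.2 hp.2.2 hf.symm) (key t b t' b' hp.1.1 hp.2.2 hp'.2.2 hf)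
    subst htt
    simp only [f] at hf
    have : b ^ 2 = b' ^ 2 := Nat.eq_of_mul_eq_mul_left (by omega : 0 < 4 * n₁) (by omega)
    rw [Nat.pow_left_injective two_ne_zero this]
  have hsub : (Finset.Ico T (2 * T) ×ˢ Finset.Icc 1 J).image f ⊆
      (Finset.Icc 1 J).biUnion fun g => (negSqModuli n₂ (X / g ^ 2)).image (g ^ 2 * ·) := by
    intro m hm
    obtain ⟨⟨t, b⟩, hp, rfl⟩ := Finset.mem_image.mp hm
    simp only [Finset.mem_product, Finset.mem_Ico, Finset.mem_Icc] at hp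
    obtain ⟨⟨ht, ht2⟩, hb1, hbJ⟩ := hp
    have hg0 : 0 < Nat.gcd (2 * n₁ * t + 1) b := Nat.gcd_pos_of_pos_right _ hb1
    have hgJ : Nat.gcd (2 * n₁ * t + 1) b ≤ J := (Nat.gcd_le_right _ hb1).trans hbJ
    obtain ⟨a', b', hcop, ha', hb'⟩ := Nat.exists_coprime (2 * n₁ * t + 1) b
    set g := Nat.gcd (2 * n₁ * t + 1) b
    have hm : f (t, b) = g ^ 2 * (a' ^ 2 + 4 * n₁ * b' ^ 2) := by
      simp only [f]
      rw [ha', hb']; ring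
    have hfX : f (t, b) ≤ X := by
      refine le_trans ?_ hX
      have h1 : 2 * n₁ * t + 1 ≤ 4 * n₁ * T := by nlinarith
      have h2 : (2 * n₁ * t + 1) ^ 2 ≤ (4 * n₁ * T) ^ 2 := by gcongr
      have h3 : b ^ 2 ≤ T := le_trans (by gcongr) hT
      have h4 : n₁ * b ^ 2 ≤ n₁ ^ 2 * T ^ 2 := by
        gcongr
        · exact Nat.le_self_pow two_ne_zero _
        · exact (Nat.le_self_pow two_ne_zero _).trans h3
      simp only [f]
      nlinarith
    have ha0 : Odd a' := by
      have : Odd (a' * g) := by rw [← ha']; exact ⟨n₁ * t, by ring⟩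
      exact (Nat.odd_mul.mp this).1
    have hpos : 0 < a' ^ 2 := pow_pos ha0.pos 2
    have ha1 : IsCoprime (a' : ℤ) (4 * n₁) := by
      have h1 : IsCoprime (2 * n₁ * t + 1 : ℤ) (4 * n₁) := by
        have h2 : IsCoprime (2 * n₁ * t + 1 : ℤ) n₁ := ⟨1, -(2 * t), by ring⟩
        have h3 : IsCoprime (2 * n₁ * t + 1 : ℤ) 2 := ⟨1, -(n₁ * t), by ring⟩
        have := (h3.mul_right h3).mul_right h2
        norm_num at this
        exact this
      exact h1.of_isCoprime_of_dvd_left ⟨g, by exact_mod_cast ha'⟩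
    obtain ⟨B, hB⟩ := exists_dvd_sq_add_of_mul_eq_sq (n₁ := n₁) (n₂ := n₂) (k := k)
      (by exact_mod_cast h) (Nat.isCoprime_iff_coprime.mpr hcop) ha1
    refine Finset.mem_biUnion.mpr ⟨g, Finset.mem_Icc.mpr ⟨hg0, hgJ⟩, Finset.mem_image.mpr
      ⟨_, ?_, hm.symm⟩⟩
    refine mem_negSqModuli.mpr ⟨⟨by omega, ?_⟩, ?_, B, by push_cast; exact hB⟩
    · rw [Nat.le_div_iff_mul_le (by positivity), mul_comm, ← hm]
      exact hfX
    · exact ha0.pow.add_even ⟨2 * n₁ * b' ^ 2, by ring⟩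
  calc T * J = ((Finset.Ico T (2 * T) ×ˢ Finset.Icc 1 J).image f).card := by
        rw [Finset.card_image_of_injOn hinj, Finset.card_product]
        simp
        left; omega
    _ ≤ _ := Finset.card_le_card hsub
    _ ≤ _ := Finset.card_biUnion_le
    _ ≤ _ := Finset.sum_le_sum fun g _ => Finset.card_image_le

theorem rpow_le_of_le_pow {x y : ℝ} (hx : 0 ≤ x) (hy : 0 ≤ y) (h : x ≤ (2 * y) ^ 32) :
    x ^ (1 / 128 : ℝ) ≤ 2 * y ^ (1 / 4 : ℝ) := by
  calc x ^ (1 / 128 : ℝ) ≤ ((2 * y) ^ 32) ^ (1 / 128 : ℝ) :=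
        Real.rpow_le_rpow hx h (by norm_num)
    _ = (2 : ℝ) ^ (1 / 4 : ℝ) * y ^ (1 / 4 : ℝ) := by
        rw [← Real.rpow_natCast, ← Real.rpow_mul (mul_nonneg zero_le_two hy),
          ← Real.mul_rpow zero_le_two hy]
        norm_num
    _ ≤ 2 * y ^ (1 / 4 : ℝ) := by
        refine mul_le_mul_of_nonneg_right ?_ (Real.rpow_nonneg hy _)
        calc (2 : ℝ) ^ (1 / 4 : ℝ) ≤ 2 ^ (1 : ℝ) := by
              apply Real.rpow_le_rpow_of_exponent_le <;> norm_num
          _ = 2 := by norm_num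

theorem NeedsUnitSquare.exists_not_isSquare_mul {n₁ : ℕ} (hn₁ : 0 < n₁) :
    ∃ N₀, ∀ n₂, N₀ ≤ n₂ → NeedsUnitSquare n₂ → ¬ IsSquare (n₁ * n₂) := by
  obtain ⟨C, hC1, hC⟩ := exists_card_threeSqReps_le (ε := 1 / 128) (by norm_num) (by norm_num)
  obtain ⟨M, hM⟩ := exists_nat_gt ((120 * C * n₁ * 2 ) ^ 4 : ℝ)
  obtain ⟨J₀, hJ₀⟩ : ∃ J₀ : ℕ, M + 20 * n₁ ^ 2 + 1 ≤ J₀ := ⟨_, le_rfl⟩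
  refine ⟨J₀ ^ 32 + 2, fun n₂ hn₂ hbad ⟨k, hk⟩ => ?_⟩
  obtain ⟨J, hJ1, hJ2⟩ : ∃ J : ℕ, J ^ 32 ≤ n₂ ∧ n₂ < (J + 1) ^ 32 :=
    ⟨Nat.nthRoot 32 n₂, Nat.pow_nthRoot_le (by norm_num),
      Nat.lt_pow_nthRoot_add_one (by norm_num) _⟩
  have hJJ : J₀ ≤ J := by
    have : J₀ ^ 32 < (J + 1) ^ 32 := by omega
    have := lt_of_pow_lt_pow_left₀ 32 (by omega) this
    omega
  have hJpos : 1 ≤ J := by omega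
  have hXn : 20 * n₁ ^ 2 * (J ^ 3) ^ 2 ≤ n₂ := by
    calc 20 * n₁ ^ 2 * (J ^ 3) ^ 2 ≤ J * (J ^ 3) ^ 2 := by gcongr; omega
      _ = J ^ 7 := by ring
      _ ≤ J ^ 32 := Nat.pow_le_pow_right hJpos (by norm_num)
      _ ≤ n₂ := hJ1
  have hroot : (n₂ : ℝ) ^ (1 / 128 : ℝ) ≤ 2 * (J : ℝ) ^ (1 / 4 : ℝ) := by
    refine rpow_le_of_le_pow n₂.cast_nonneg J.cast_nonneg ?_
    have : n₂ ≤ (2 * J) ^ 32 := hJ2.le.trans (Nat.pow_le_pow_left (by omega) 32)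
    exact_mod_cast this
  have hn2 : 2 ≤ n₂ := by omega
  clear hJ1 hJ2 hn₂
  obtain ⟨X, hX⟩ : ∃ X, X = 20 * n₁ ^ 2 * (J ^ 3) ^ 2 := ⟨_, rfl⟩
  rw [← hX] at hXn
  have h1 := pairs_le_of_mul_eq_sq (J := J) (T := J ^ 3) (X := X) hn₁ (hk.trans (sq k).symm)
    (Nat.pow_le_pow_right hJpos (by norm_num)) hX.ge
  set S := ((threeSqReps n₂).card : ℝ)
  have hJR : (1 : ℝ) ≤ J := by exact_mod_cast hJpos
  have hsX : √(X : ℝ) ≤ 5 * n₁ * J ^ 3 := by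
    refine Real.sqrt_le_iff.mpr ⟨by positivity, ?_⟩
    rw [hX]
    push_cast
    nlinarith [sq_nonneg ((n₁ : ℝ) * J ^ 3)]
  have h2 : (J : ℝ) ^ 3 * J ≤ 12 * S * (5 * n₁ * J ^ 3) * (2 * √J) := by
    calc (J : ℝ) ^ 3 * J ≤ ∑ g ∈ Finset.Icc 1 J, ((negSqModuli n₂ (X / g ^ 2)).card : ℝ) := by
          exact_mod_cast h1
      _ ≤ ∑ g ∈ Finset.Icc 1 J, 12 * S * (5 * n₁ * J ^ 3) * (g : ℝ)⁻¹ := by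
          refine Finset.sum_le_sum fun g hg => ?_
          have hg1 : (0 : ℝ) < g := by exact_mod_cast (Finset.mem_Icc.mp hg).1
          refine (card_negSqModuli_le_sqrt hbad ((Nat.div_le_self _ _).trans hXn)).trans ?_
          rw [mul_assoc (12 * S)]
          gcongr
          calc √((X / g ^ 2 : ℕ) : ℝ) ≤ √((X : ℝ) / (g : ℝ) ^ 2) := by
                gcongr; exact_mod_cast Nat.cast_div_le
            _ = √(X : ℝ) * (g : ℝ)⁻¹ := by
                rw [Real.sqrt_div (by positivity), Real.sqrt_sq hg1.le, div_eq_mul_inv]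
            _ ≤ _ := by gcongr
      _ ≤ _ := by
          rw [← Finset.mul_sum]
          gcongr
          exact sum_inv_Icc_le J
  have hS : S ≤ C * (2 * (J : ℝ) ^ (1 / 4 : ℝ)) := by
    refine (hC n₂ hn2 hbad).trans ?_
    gcongr
  set q := (J : ℝ) ^ (1 / 4 : ℝ) with hq
  have hq0 : 0 < q := by positivity
  have hq4 : q ^ 4 = J := by
    rw [hq, ← Real.rpow_natCast, ← Real.rpow_mul (by positivity)]; norm_num
  have hsq : √(J : ℝ) = q ^ 2 := by
    rw [← hq4, show q ^ 4 = (q ^ 2) ^ 2 by ring, Real.sqrt_sq (by positivity)]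
  have h3 : (J : ℝ) ^ 3 * q ^ 3 * q ≤ (J : ℝ) ^ 3 * q ^ 3 * (120 * C * n₁ * 2) := by
    calc (J : ℝ) ^ 3 * q ^ 3 * q = J ^ 3 * J := by rw [← hq4]; ring
      _ ≤ _ := h2
      _ ≤ 12 * (C * (2 * q)) * (5 * n₁ * J ^ 3) * (2 * √J) := by gcongr
      _ = _ := by rw [hsq]; ring
  have h4 : q ≤ 120 * C * n₁ * 2 := le_of_mul_le_mul_left h3 (by positivity)
  have h5 : (J : ℝ) ≤ M := by
    rw [← hq4]
    exact (pow_le_pow_left₀ hq0.le h4 4).trans hM.le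
  have : J ≤ M := by exact_mod_cast h5
  omega

section

open Finset

theorem abs_sum_mul_le_of_antitone {c w : ℕ → ℝ} {B : ℝ} {M : ℕ}
    (hc : ∀ K, |∑ a ∈ Ioc M K, c a| ≤ B) (hw : AntitoneOn w (Set.Ioi M))
    (hw0 : ∀ a, 0 ≤ w a) (K : ℕ) :
    |∑ a ∈ Ioc M K, c a * w a| ≤ B * w (M + 1) := by
  have hB : 0 ≤ B := (abs_nonneg _).trans (hc 0)
  rcases le_or_gt K M with h | h
  · rw [Ioc_eq_empty (by omega)]
    simpa using mul_nonneg hB (hw0 _)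
  have key : |∑ a ∈ Ioc M K, c a * w a - (∑ a ∈ Ioc M K, c a) * w K| ≤
      B * (w (M + 1) - w K) := by
    induction K, h using Nat.le_induction with
    | base => simp
    | succ K hK ih =>
      have hK' : M ≤ K := by omega
      rw [sum_Ioc_succ_top hK', sum_Ioc_succ_top hK']
      have e : ∑ a ∈ Ioc M K, c a * w a + c (K + 1) * w (K + 1) -
          (∑ a ∈ Ioc M K, c a + c (K + 1)) * w (K + 1) =
          (∑ a ∈ Ioc M K, c a * w a - (∑ a ∈ Ioc M K, c a) * w K) +
            (∑ a ∈ Ioc M K, c a) * (w K - w (K + 1)) := by ring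
      have hd : 0 ≤ w K - w (K + 1) :=
        sub_nonneg.mpr (hw (Set.mem_Ioi.mpr (by omega)) (Set.mem_Ioi.mpr (by omega)) (by omega))
      rw [e]
      refine (abs_add_le _ _).trans ?_
      rw [abs_mul, abs_of_nonneg hd]
      have := mul_le_mul_of_nonneg_right (hc K) hd
      linarith
  have h2 : |(∑ a ∈ Ioc M K, c a) * w K| ≤ B * w K := by
    rw [abs_mul, abs_of_nonneg (hw0 K)]
    exact mul_le_mul_of_nonneg_right (hc K) (hw0 K)
  have h3 := abs_add_le (∑ a ∈ Ioc M K, c a * w a - (∑ a ∈ Ioc M K, c a) * w K)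
    ((∑ a ∈ Ioc M K, c a) * w K)
  rw [sub_add_cancel] at h3
  linarith

theorem antitoneOn_natCast_rpow_neg {s : ℝ} (hs : 0 ≤ s) (M : ℕ) :
    AntitoneOn (fun a : ℕ => (a : ℝ) ^ (-s)) (Set.Ioi M) := by
  intro a ha b _ hab
  have : (0 : ℝ) < a := by exact_mod_cast (Nat.zero_le M).trans_lt ha
  exact Real.rpow_le_rpow_of_nonpos this (by exact_mod_cast hab) (by linarith)

theorem abs_sum_mul_rpow_neg_le {c : ℕ → ℝ} {B : ℝ}
    (hc : ∀ M K, |∑ a ∈ Ioc M K, c a| ≤ B) {s : ℝ} (hs : 0 ≤ s) {M : ℕ} (hM : 1 ≤ M) (K : ℕ) :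
    |∑ a ∈ Ioc M K, c a * (a : ℝ) ^ (-s)| ≤ B * (M : ℝ) ^ (-s) := by
  refine (abs_sum_mul_le_of_antitone (hc M) (antitoneOn_natCast_rpow_neg hs M)
    (fun a => by positivity) K).trans ?_
  have hB : 0 ≤ B := (abs_nonneg _).trans (hc 0 0)
  refine mul_le_mul_of_nonneg_left ?_ hB
  exact Real.rpow_le_rpow_of_nonpos (by exact_mod_cast hM) (by simp) (by linarith)

theorem abs_sum_sub_sum_mul_rpow_neg_le {c : ℕ → ℝ} {B : ℝ}
    (hc : ∀ M K, |∑ a ∈ Ioc M K, c a| ≤ B) {s : ℝ} (hs : 0 ≤ s) {M K : ℕ} (hM : 1 ≤ M)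
    (hMK : M ≤ K) :
    |∑ a ∈ Ioc 0 K, c a * (a : ℝ) ^ (-s) - ∑ a ∈ Ioc 0 M, c a * (a : ℝ) ^ (-s)| ≤
      B * (M : ℝ) ^ (-s) := by
  rw [← sum_Ioc_consecutive _ (Nat.zero_le M) hMK, add_sub_cancel_left]
  exact abs_sum_mul_rpow_neg_le hc hs hM K

/-- The conditionally convergent Dirichlet series of a sequence with bounded partial sums. -/
theorem exists_continuousOn_dirichlet_limit {c : ℕ → ℝ} {B : ℝ}
    (hc : ∀ M K, |∑ a ∈ Ioc M K, c a| ≤ B) :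
    ∃ L : ℝ → ℝ, ContinuousOn L (Set.Ici (1 / 2)) ∧ ∀ s, 1 / 2 ≤ s → ∀ M : ℕ, 1 ≤ M →
      |∑ a ∈ Ioc 0 M, c a * (a : ℝ) ^ (-s) - L s| ≤ B * (M : ℝ) ^ (-s) := by
  have hB : 0 ≤ B := (abs_nonneg _).trans (hc 0 0)
  let S : ℕ → ℝ → ℝ := fun M s => ∑ a ∈ Ioc 0 M, c a * (a : ℝ) ^ (-s)
  have hz : ∀ s : ℝ, 1 / 2 ≤ s →
      Filter.Tendsto (fun M : ℕ => B * (M : ℝ) ^ (-s)) Filter.atTop (nhds 0) := by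
    intro s hs
    have := ((tendsto_rpow_neg_atTop (show 0 < s by linarith)).comp
      tendsto_natCast_atTop_atTop).const_mul B
    simpa using this
  have hlim : ∀ s : ℝ, 1 / 2 ≤ s → ∃ l, Filter.Tendsto (fun M => S M s) Filter.atTop (nhds l) := by
    intro s hs
    refine cauchySeq_tendsto_of_complete (Metric.cauchySeq_iff'.mpr fun ε hε => ?_)
    obtain ⟨M, hM, hM1⟩ := (((hz s hs).eventually (gt_mem_nhds hε)).and
      (Filter.eventually_ge_atTop 1)).exists
    refine ⟨M, fun K hK => ?_⟩
    rw [Real.dist_eq]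
    exact (abs_sum_sub_sum_mul_rpow_neg_le hc (by linarith) hM1 hK).trans_lt hM
  choose! L hL using hlim
  have hbd : ∀ s, 1 / 2 ≤ s → ∀ M : ℕ, 1 ≤ M → |S M s - L s| ≤ B * (M : ℝ) ^ (-s) := by
    intro s hs M hM
    have h1 : Filter.Tendsto (fun K => |S M s - S K s|) Filter.atTop (nhds |S M s - L s|) :=
      ((tendsto_const_nhds).sub (hL s hs)).abs
    refine le_of_tendsto h1 ?_
    filter_upwards [Filter.eventually_ge_atTop M] with K hK
    rw [abs_sub_comm]
    exact abs_sum_sub_sum_mul_rpow_neg_le hc (by linarith) hM hK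
  refine ⟨L, ?_, hbd⟩
  have hu : TendstoUniformlyOn S L Filter.atTop (Set.Ici (1 / 2)) := by
    rw [Metric.tendstoUniformlyOn_iff]
    intro ε hε
    filter_upwards [(hz (1 / 2) le_rfl).eventually (gt_mem_nhds hε),
      Filter.eventually_ge_atTop 1] with M hM hM1 s hs
    rw [dist_comm, Real.dist_eq]
    refine (hbd s hs M hM1).trans_lt (lt_of_le_of_lt ?_ hM)
    refine mul_le_mul_of_nonneg_left ?_ hB
    exact Real.rpow_le_rpow_of_exponent_le (by exact_mod_cast hM1) (neg_le_neg hs)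
  refine hu.continuousOn (Filter.Eventually.frequently (Filter.Eventually.of_forall fun M => ?_))
  refine Continuous.continuousOn (continuous_finsetSum _ fun a ha => ?_)
  have : (a : ℝ) ≠ 0 := by
    have := (mem_Ioc.mp ha).1
    positivity
  exact continuous_const.mul (Real.continuous_const_rpow this |>.comp continuous_neg)

end

section

open Finset

theorem mul_pow_le_pow_sub_pow {a b : ℝ} (hb : 0 ≤ b) (hab : b ≤ a) (n : ℕ) :
    n * b ^ (n - 1) * (a - b) ≤ a ^ n - b ^ n := by
  rw [← (Commute.all a b).geom_sum₂_mul]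
  refine mul_le_mul_of_nonneg_right ?_ (sub_nonneg.mpr hab)
  rw [← nsmul_eq_mul]
  nth_rw 1 [← card_range n]
  refine card_nsmul_le_sum _ _ _ fun i hi => ?_
  have := mem_range.mp hi
  calc b ^ (n - 1) = b ^ i * b ^ (n - 1 - i) := by rw [← pow_add]; congr 1; omega
    _ ≤ _ := by gcongr

theorem pow_sub_pow_le_mul_pow {a b : ℝ} (hb : 0 ≤ b) (hab : b ≤ a) (n : ℕ) :
    a ^ n - b ^ n ≤ n * a ^ (n - 1) * (a - b) := by
  rw [← (Commute.all a b).geom_sum₂_mul]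
  refine mul_le_mul_of_nonneg_right ?_ (sub_nonneg.mpr hab)
  rw [← nsmul_eq_mul]
  refine (sum_le_card_nsmul (range n) _ (a ^ (n - 1)) fun i hi => ?_).trans
    (by rw [card_range])
  have := mem_range.mp hi
  have ha : 0 ≤ a := hb.trans hab
  calc a ^ i * b ^ (n - 1 - i) ≤ a ^ i * a ^ (n - 1 - i) := by gcongr
    _ = _ := by rw [← pow_add]; congr 1; omega

theorem rpow_one_div_sub_le {u v : ℝ} (hu : 0 < u) (huv : u ≤ v) :
    32 * (v ^ (1 / 32 : ℝ) - u ^ (1 / 32 : ℝ)) ≤ (v - u) * u ^ (-(31 / 32 : ℝ)) := by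
  have h := mul_pow_le_pow_sub_pow (a := v ^ (1 / 32 : ℝ)) (b := u ^ (1 / 32 : ℝ))
    (by positivity) (Real.rpow_le_rpow hu.le huv (by norm_num)) 32
  have hv : 0 < v := hu.trans_le huv
  rw [← Real.rpow_natCast, ← Real.rpow_natCast, ← Real.rpow_natCast, ← Real.rpow_mul hu.le,
    ← Real.rpow_mul hu.le, ← Real.rpow_mul hv.le] at h
  norm_num at h
  rw [Real.rpow_neg hu.le, ← div_eq_mul_inv, le_div_iff₀ (by positivity)]
  linarith

theorem le_rpow_one_div_sub {u v : ℝ} (hu : 0 < u) (huv : u ≤ v) :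
    (v - u) * v ^ (-(31 / 32 : ℝ)) ≤ 32 * (v ^ (1 / 32 : ℝ) - u ^ (1 / 32 : ℝ)) := by
  have h := pow_sub_pow_le_mul_pow (a := v ^ (1 / 32 : ℝ)) (b := u ^ (1 / 32 : ℝ))
    (by positivity) (Real.rpow_le_rpow hu.le huv (by norm_num)) 32
  have hv : 0 < v := hu.trans_le huv
  rw [← Real.rpow_natCast, ← Real.rpow_natCast, ← Real.rpow_natCast, ← Real.rpow_mul hu.le,
    ← Real.rpow_mul hv.le, ← Real.rpow_mul hv.le] at h
  norm_num at h
  rw [Real.rpow_neg hv.le, ← div_eq_mul_inv, div_le_iff₀ (by positivity)]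
  linarith

/-- The partial sums of `ζ(31/32)`. -/
noncomputable def zetaPartial (N : ℕ) : ℝ := ∑ b ∈ Ioc 0 N, (b : ℝ) ^ (-(31 / 32 : ℝ))

theorem zetaPartial_le (N : ℕ) : zetaPartial N ≤ 32 * (N : ℝ) ^ (1 / 32 : ℝ) := by
  induction N with
  | zero => simp [zetaPartial]
  | succ N ih =>
    rw [zetaPartial, sum_Ioc_succ_top (Nat.zero_le N)]
    rcases Nat.eq_zero_or_pos N with rfl | hN
    · norm_num
    have := le_rpow_one_div_sub (u := N) (v := (N + 1 : ℕ)) (by exact_mod_cast hN) (by simp)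
    rw [zetaPartial] at ih
    push_cast at this ⊢
    linarith

theorem exists_zetaPartial_approx : ∃ c : ℝ, -32 ≤ c ∧ c < 0 ∧ ∀ (N : ℕ) (u : ℝ), 1 ≤ N →
    (N : ℝ) ≤ u → u < N + 1 →
    |zetaPartial N - 32 * u ^ (1 / 32 : ℝ) - c| ≤ 2 * u ^ (-(31 / 32 : ℝ)) := by
  let F : ℕ → ℝ := fun N => zetaPartial (N + 1) - 32 * ((N + 1 : ℕ) : ℝ) ^ (1 / 32 : ℝ)
  have hF : Antitone F := by
    refine antitone_nat_of_succ_le fun N => ?_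
    have := le_rpow_one_div_sub (u := (N + 1 : ℕ)) (v := (N + 1 + 1 : ℕ)) (by positivity) (by simp)
    simp only [F]
    rw [zetaPartial, sum_Ioc_succ_top (Nat.zero_le _), ← zetaPartial]
    push_cast at this ⊢
    linarith
  have hG : Monotone fun N => F N - ((N + 1 : ℕ) : ℝ) ^ (-(31 / 32 : ℝ)) := by
    refine monotone_nat_of_le_succ fun N => ?_
    have := rpow_one_div_sub_le (u := (N + 1 : ℕ)) (v := (N + 1 + 1 : ℕ)) (by positivity) (by simp)
    simp only [F]
    rw [zetaPartial, zetaPartial, sum_Ioc_succ_top (Nat.zero_le (N + 1))]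
    push_cast at this ⊢
    linarith
  have hlow : ∀ N M, F N - ((N + 1 : ℕ) : ℝ) ^ (-(31 / 32 : ℝ)) ≤ F M := by
    intro N M
    have h1 := hG (le_max_left N M)
    have h2 := hF (le_max_right N M)
    have h3 : 0 ≤ ((max N M + 1 : ℕ) : ℝ) ^ (-(31 / 32 : ℝ)) := by positivity
    simp only at h1
    linarith
  have hF0 : F 0 = -31 := by
    simp [F, zetaPartial]; norm_num
  have hbdd : BddBelow (Set.range F) := ⟨F 0 - ((0 + 1 : ℕ) : ℝ) ^ (-(31 / 32 : ℝ)), by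
    rintro _ ⟨M, rfl⟩; exact hlow 0 M⟩
  have hle : ∀ N, ⨅ M, F M ≤ F N := fun N => ciInf_le hbdd N
  have hge : ∀ N, F N - ((N + 1 : ℕ) : ℝ) ^ (-(31 / 32 : ℝ)) ≤ ⨅ M, F M :=
    fun N => le_ciInf (hlow N)
  refine ⟨⨅ M, F M, ?_, ?_, fun N u hN hNu huN => ?_⟩
  · have := hge 0
    rw [hF0] at this
    norm_num at this
    exact this
  · have := hle 0
    linarith
  · have hN0 : (0 : ℝ) < N := by exact_mod_cast hN
    have hu0 : 0 < u := hN0.trans_le hNu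
    obtain ⟨K, rfl⟩ := Nat.exists_eq_add_of_le' hN
    have h1 := hle K
    have h2 := hge K
    have h3 := rpow_one_div_sub_le hN0 hNu
    have h4 : ((K + 1 : ℕ) : ℝ) ^ (1 / 32 : ℝ) ≤ u ^ (1 / 32 : ℝ) :=
      Real.rpow_le_rpow hN0.le hNu (by norm_num)
    have h5 : (u - (K + 1 : ℕ)) * ((K + 1 : ℕ) : ℝ) ^ (-(31 / 32 : ℝ)) ≤
        1 * ((K + 1 : ℕ) : ℝ) ^ (-(31 / 32 : ℝ)) := by
      gcongr
      linarith
    have h6 : ((K + 1 : ℕ) : ℝ) ^ (-(31 / 32 : ℝ)) ≤ 2 * u ^ (-(31 / 32 : ℝ)) := by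
      have h7 : u ≤ 2 * (K + 1 : ℕ) := by push_cast at *; linarith
      calc ((K + 1 : ℕ) : ℝ) ^ (-(31 / 32 : ℝ)) ≤ (u / 2) ^ (-(31 / 32 : ℝ)) :=
            Real.rpow_le_rpow_of_nonpos (by positivity) (by linarith) (by norm_num)
        _ = 2 ^ (31 / 32 : ℝ) * u ^ (-(31 / 32 : ℝ)) := by
            rw [Real.div_rpow hu0.le (by norm_num), Real.rpow_neg (by norm_num : (0:ℝ) ≤ 2)]
            field_simp
        _ ≤ 2 ^ (1 : ℝ) * u ^ (-(31 / 32 : ℝ)) := by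
            gcongr <;> norm_num
        _ = _ := by norm_num
    simp only [F] at h1 h2
    rw [abs_le]
    constructor <;> linarith

end

section

open Finset

theorem sum_Ioc_mul_rpow_neg_le {g : ℕ → ℝ} {A : ℝ} {Z : ℕ} (hg : ∀ m, 0 ≤ g m)
    (hG : ∀ u : ℕ, u ≤ Z → ∑ m ∈ Ioc 0 u, g m ≤ A * (u : ℝ) ^ (15 / 16 : ℝ))
    {y K : ℕ} (hy : 1 ≤ y) (hyK : y ≤ K) (hK : K ≤ Z) :
    ∑ b ∈ Ioc y K, g b * (b : ℝ) ^ (-(61 / 64 : ℝ)) ≤ 61 * A * (y : ℝ) ^ (-(1 / 64 : ℝ)) := by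
  have hA : 0 ≤ A := by
    have h1 := hG 1 (hy.trans (hyK.trans hK))
    simp only [Nat.cast_one, Real.one_rpow, mul_one] at h1
    exact (sum_nonneg fun _ _ => hg _).trans h1
  have key : ∑ b ∈ Ioc y K, g b * (b : ℝ) ^ (-(61 / 64 : ℝ)) ≤
      (∑ m ∈ Ioc 0 K, g m) * (K : ℝ) ^ (-(61 / 64 : ℝ)) +
        61 * A * ((y : ℝ) ^ (-(1 / 64 : ℝ)) - (K : ℝ) ^ (-(1 / 64 : ℝ))) := by
    induction K, hyK using Nat.le_induction with
    | base =>
      simp only [Ioc_self, sum_empty, sub_self, mul_zero, add_zero]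
      exact mul_nonneg (sum_nonneg fun _ _ => hg _) (by positivity)
    | succ K hyK ih =>
      have ih := ih (by omega)
      rw [sum_Ioc_succ_top hyK, sum_Ioc_succ_top (Nat.zero_le K)]
      have hK0 : (0 : ℝ) < K := by exact_mod_cast hy.trans hyK
      have hba : ((K + 1 : ℕ) : ℝ) ^ (-(1 / 64 : ℝ)) ≤ (K : ℝ) ^ (-(1 / 64 : ℝ)) :=
        Real.rpow_le_rpow_of_nonpos hK0 (by simp) (by norm_num)
      have h := pow_sub_pow_le_mul_pow (by positivity) hba 61
      rw [← Real.rpow_natCast, ← Real.rpow_natCast, ← Real.rpow_natCast, ← Real.rpow_mul hK0.le,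
        ← Real.rpow_mul hK0.le, ← Real.rpow_mul (by positivity)] at h
      norm_num at h
      have hw0 : 0 ≤ 61 * (K : ℝ) ^ (-(15 / 16 : ℝ)) *
          ((K : ℝ) ^ (-(1 / 64 : ℝ)) - ((K + 1 : ℕ) : ℝ) ^ (-(1 / 64 : ℝ))) :=
        mul_nonneg (by positivity) (sub_nonneg.mpr hba)
      have h2 := mul_le_mul_of_nonneg_left h (sum_nonneg fun m (_ : m ∈ Ioc 0 K) => hg m)
      have h3 := mul_le_mul_of_nonneg_right (hG K (by omega)) hw0
      have h4 : (K : ℝ) ^ (15 / 16 : ℝ) * (K : ℝ) ^ (-(15 / 16 : ℝ)) = 1 := by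
        rw [← Real.rpow_add hK0]; norm_num
      have h5 : A * (K : ℝ) ^ (15 / 16 : ℝ) * (61 * (K : ℝ) ^ (-(15 / 16 : ℝ)) *
          ((K : ℝ) ^ (-(1 / 64 : ℝ)) - ((K + 1 : ℕ) : ℝ) ^ (-(1 / 64 : ℝ)))) =
          61 * A * ((K : ℝ) ^ (-(1 / 64 : ℝ)) - ((K + 1 : ℕ) : ℝ) ^ (-(1 / 64 : ℝ))) := by
        linear_combination (61 * A *
          ((K : ℝ) ^ (-(1 / 64 : ℝ)) - ((K + 1 : ℕ) : ℝ) ^ (-(1 / 64 : ℝ)))) * h4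
      push_cast at *
      linarith
  have hK0 : (0 : ℝ) < K := by exact_mod_cast hy.trans hyK
  have h1 : (∑ m ∈ Ioc 0 K, g m) * (K : ℝ) ^ (-(61 / 64 : ℝ)) ≤ A * (K : ℝ) ^ (-(1 / 64 : ℝ)) := by
    calc _ ≤ A * (K : ℝ) ^ (15 / 16 : ℝ) * (K : ℝ) ^ (-(61 / 64 : ℝ)) := by
          gcongr
          exact hG K hK
      _ = _ := by
          rw [mul_assoc, ← Real.rpow_add hK0]; norm_num
  have h2 : 0 ≤ A * (K : ℝ) ^ (-(1 / 64 : ℝ)) := by positivity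
  linarith

theorem sum_Ioc_zero_mul_rpow_neg_le {g : ℕ → ℝ} {A : ℝ} {Z : ℕ} (hg : ∀ m, 0 ≤ g m)
    (hG : ∀ u : ℕ, u ≤ Z → ∑ m ∈ Ioc 0 u, g m ≤ A * (u : ℝ) ^ (15 / 16 : ℝ)) (hZ : 1 ≤ Z) :
    ∑ b ∈ Ioc 0 Z, g b * (b : ℝ) ^ (-(61 / 64 : ℝ)) ≤ 62 * A := by
  have h1 := sum_Ioc_mul_rpow_neg_le hg hG le_rfl hZ le_rfl
  have h2 := hG 1 hZ
  rw [← sum_Ioc_consecutive _ zero_le_one hZ, show Ioc 0 1 = {1} from rfl]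
  simp at h1 h2 ⊢
  linarith

/-- The arithmetic function `n ↦ f n * n ^ (-s)`. -/
noncomputable def rpowTwist (f : ArithmeticFunction ℝ) (s : ℝ) : ArithmeticFunction ℝ :=
  ⟨fun n => f n * (n : ℝ) ^ (-s), by simp⟩

theorem rpowTwist_apply (f : ArithmeticFunction ℝ) (s : ℝ) (n : ℕ) :
    rpowTwist f s n = f n * (n : ℝ) ^ (-s) := rfl

theorem rpowTwist_mul (f g : ArithmeticFunction ℝ) (s : ℝ) :
    rpowTwist (f * g) s = rpowTwist f s * rpowTwist g s := by
  ext n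
  rw [rpowTwist_apply, ArithmeticFunction.mul_apply, ArithmeticFunction.mul_apply, sum_mul]
  refine sum_congr rfl fun p hp => ?_
  rw [← (Nat.mem_divisorsAntidiagonal.mp hp).1, rpowTwist_apply, rpowTwist_apply, Nat.cast_mul,
    Real.mul_rpow (by positivity) (by positivity)]
  ring

/-- The Dirichlet hyperbola method. -/
theorem sum_Ioc_mul_hyperbola {R : Type*} [CommRing R] (f g : ArithmeticFunction R) (y : ℕ) :
    ∑ n ∈ Ioc 0 (y ^ 2), (f * g) n = ∑ a ∈ Ioc 0 y, f a * ∑ b ∈ Ioc 0 (y ^ 2 / a), g b +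
      ∑ b ∈ Ioc 0 y, g b * (∑ a ∈ Ioc 0 (y ^ 2 / b), f a - ∑ a ∈ Ioc 0 y, f a) := by
  have hy : y ≤ y ^ 2 := Nat.le_self_pow two_ne_zero y
  rw [ArithmeticFunction.sum_Ioc_mul_eq_sum_sum, ← sum_Ioc_consecutive _ (Nat.zero_le y) hy]
  congr 1
  have h1 : ∀ b ∈ Ioc 0 y, ∑ a ∈ Ioc 0 (y ^ 2 / b), f a - ∑ a ∈ Ioc 0 y, f a =
      ∑ a ∈ Ioc y (y ^ 2 / b), f a := by
    intro b hb
    have hb := mem_Ioc.mp hb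
    rw [← sum_Ioc_consecutive _ (Nat.zero_le y), add_sub_cancel_left]
    rw [Nat.le_div_iff_mul_le hb.1, sq]
    exact Nat.mul_le_mul_left y hb.2
  have h2 : ∑ b ∈ Ioc 0 y, g b * (∑ a ∈ Ioc 0 (y ^ 2 / b), f a - ∑ a ∈ Ioc 0 y, f a) =
      ∑ b ∈ Ioc 0 y, g b * ∑ a ∈ Ioc y (y ^ 2 / b), f a :=
    sum_congr rfl fun b hb => by rw [h1 b hb]
  rw [h2]
  simp_rw [mul_sum]
  rw [sum_sigma', sum_sigma']
  refine sum_bij' (fun p _ => ⟨p.2, p.1⟩) (fun p _ => ⟨p.2, p.1⟩) ?_ ?_ ?_ ?_ ?_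
  · rintro ⟨a, b⟩ h
    simp only [mem_sigma, mem_Ioc] at h ⊢
    obtain ⟨⟨ha, ha'⟩, hb, hb'⟩ := h
    rw [Nat.le_div_iff_mul_le (by omega)] at hb'
    refine ⟨⟨hb, ?_⟩, ha, ?_⟩
    · by_contra! h
      nlinarith
    · rw [Nat.le_div_iff_mul_le hb]; linarith
  · rintro ⟨b, a⟩ h
    simp only [mem_sigma, mem_Ioc] at h ⊢
    obtain ⟨⟨hb, hb'⟩, ha, ha'⟩ := h
    rw [Nat.le_div_iff_mul_le hb] at ha'
    refine ⟨⟨ha, ?_⟩, hb, ?_⟩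
    · nlinarith
    · rw [Nat.le_div_iff_mul_le (by omega)]; linarith
  · simp
  · simp
  · simp [mul_comm]

end

section

open Finset
open scoped ArithmeticFunction.zeta

theorem abs_sum_Ioc_mul_div_sub_le {c e : ArithmeticFunction ℝ} {B s : ℝ}
    (hc : ∀ M K, |∑ a ∈ Ioc M K, c a| ≤ B) (hs : 31 / 32 ≤ s) (he : ∀ b, |e b| ≤ 1) {y : ℕ}
    (hy : 1 ≤ y) :
    |∑ b ∈ Ioc 0 y, rpowTwist e s b *
      (∑ a ∈ Ioc 0 (y ^ 2 / b), rpowTwist c s a - ∑ a ∈ Ioc 0 y, rpowTwist c s a)| ≤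
      32 * B * (y : ℝ) ^ (-(15 / 16 : ℝ)) := by
  have hB : 0 ≤ B := (abs_nonneg _).trans (hc 0 0)
  have hy0 : (1 : ℝ) ≤ y := by exact_mod_cast hy
  calc _ ≤ ∑ b ∈ Ioc 0 y, (b : ℝ) ^ (-(31 / 32 : ℝ)) * (B * (y : ℝ) ^ (-(31 / 32 : ℝ))) := by
        refine (abs_sum_le_sum_abs _ _).trans (sum_le_sum fun b hb => ?_)
        have hb := mem_Ioc.mp hb
        have hb1 : (1 : ℝ) ≤ b := by exact_mod_cast hb.1
        rw [abs_mul]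
        refine mul_le_mul ?_ ?_ (abs_nonneg _) (by positivity)
        · rw [rpowTwist_apply, abs_mul, abs_of_nonneg (by positivity : 0 ≤ (b : ℝ) ^ (-s))]
          refine (mul_le_of_le_one_left (by positivity) (he b)).trans ?_
          exact Real.rpow_le_rpow_of_exponent_le hb1 (neg_le_neg hs)
        · refine (abs_sum_sub_sum_mul_rpow_neg_le hc (by linarith) hy ?_).trans ?_
          · rw [Nat.le_div_iff_mul_le hb.1, sq]
            exact Nat.mul_le_mul_left y hb.2
          · refine mul_le_mul_of_nonneg_left ?_ hB
            exact Real.rpow_le_rpow_of_exponent_le hy0 (neg_le_neg hs)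
    _ = zetaPartial y * (B * (y : ℝ) ^ (-(31 / 32 : ℝ))) := by rw [← sum_mul, zetaPartial]
    _ ≤ 32 * (y : ℝ) ^ (1 / 32 : ℝ) * (B * (y : ℝ) ^ (-(31 / 32 : ℝ))) := by
        gcongr
        exact zetaPartial_le y
    _ = 32 * B * ((y : ℝ) ^ (1 / 32 : ℝ) * (y : ℝ) ^ (-(31 / 32 : ℝ))) := by ring
    _ = _ := by
        rw [← Real.rpow_add (by linarith)]
        norm_num

theorem abs_sum_mul_zetaPartial_sub_le {c : ArithmeticFunction ℝ} {κ : ℝ}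
    (hκ : ∀ (N : ℕ) (u : ℝ), 1 ≤ N → (N : ℝ) ≤ u → u < N + 1 →
      |zetaPartial N - 32 * u ^ (1 / 32 : ℝ) - κ| ≤ 2 * u ^ (-(31 / 32 : ℝ)))
    (hc1 : ∀ a, |c a| ≤ 1) {y : ℕ} (hy : 1 ≤ y) :
    |∑ a ∈ Ioc 0 y, rpowTwist c (31 / 32) a * zetaPartial (y ^ 2 / a) -
      (32 * (y : ℝ) ^ (1 / 16 : ℝ) * ∑ a ∈ Ioc 0 y, c a * (a : ℝ) ^ (-1 : ℝ) +
        κ * ∑ a ∈ Ioc 0 y, c a * (a : ℝ) ^ (-(31 / 32 : ℝ)))| ≤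
      2 * (y : ℝ) ^ (-(15 / 16 : ℝ)) := by
  have hy0 : (0 : ℝ) < y := by exact_mod_cast hy
  rw [mul_sum, mul_sum, ← sum_add_distrib, ← sum_sub_distrib]
  calc _ ≤ ∑ a ∈ Ioc 0 y, 2 * (y : ℝ) ^ (-(31 / 16 : ℝ)) := by
        refine (abs_sum_le_sum_abs _ _).trans (sum_le_sum fun a ha => ?_)
        have ha := mem_Ioc.mp ha
        have ha0 : (0 : ℝ) < a := by exact_mod_cast ha.1
        have hN : 1 ≤ y ^ 2 / a := by
          rw [Nat.le_div_iff_mul_le ha.1]; nlinarith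
        have h1 := hκ (y ^ 2 / a) ((y : ℝ) ^ 2 / a) hN
          (by exact_mod_cast Nat.cast_div_le (α := ℝ) (m := y ^ 2) (n := a))
          (by
            rw [div_lt_iff₀ ha0]
            have := Nat.lt_mul_div_succ (y ^ 2) ha.1
            rw [mul_comm]
            exact_mod_cast this)
        have e1 : ((y : ℝ) ^ 2 / a) ^ (1 / 32 : ℝ) =
            (y : ℝ) ^ (1 / 16 : ℝ) * (a : ℝ) ^ (-(1 / 32 : ℝ)) := by
          rw [Real.div_rpow (by positivity) ha0.le, ← Real.rpow_natCast, ← Real.rpow_mul hy0.le,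
            Real.rpow_neg ha0.le, div_eq_mul_inv]
          norm_num
        have e2 : ((y : ℝ) ^ 2 / a) ^ (-(31 / 32 : ℝ)) * (a : ℝ) ^ (-(31 / 32 : ℝ)) =
            (y : ℝ) ^ (-(31 / 16 : ℝ)) := by
          rw [← Real.mul_rpow (by positivity) ha0.le, div_mul_cancel₀ _ ha0.ne',
            ← Real.rpow_natCast, ← Real.rpow_mul hy0.le]
          norm_num
        have e3 : (a : ℝ) ^ (-1 : ℝ) = (a : ℝ) ^ (-(31 / 32 : ℝ)) * (a : ℝ) ^ (-(1 / 32 : ℝ)) := by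
          rw [← Real.rpow_add ha0]; norm_num
        rw [rpowTwist_apply, e3]
        have e4 : c a * (a : ℝ) ^ (-(31 / 32 : ℝ)) * zetaPartial (y ^ 2 / a) -
            (32 * (y : ℝ) ^ (1 / 16 : ℝ) *
              (c a * ((a : ℝ) ^ (-(31 / 32 : ℝ)) * (a : ℝ) ^ (-(1 / 32 : ℝ)))) +
              κ * (c a * (a : ℝ) ^ (-(31 / 32 : ℝ)))) =
            c a * ((zetaPartial (y ^ 2 / a) - 32 * ((y : ℝ) ^ 2 / a) ^ (1 / 32 : ℝ) - κ) *
              (a : ℝ) ^ (-(31 / 32 : ℝ))) := by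
          rw [e1]; ring
        rw [e4, abs_mul]
        refine (mul_le_of_le_one_left (abs_nonneg _) (hc1 a)).trans ?_
        rw [abs_mul, abs_of_nonneg (by positivity : 0 ≤ (a : ℝ) ^ (-(31 / 32 : ℝ))), ← e2,
          ← mul_assoc]
        exact mul_le_mul_of_nonneg_right h1 (by positivity)
    _ = 2 * ((y : ℝ) ^ (1 : ℝ) * (y : ℝ) ^ (-(31 / 16 : ℝ))) := by
        rw [sum_const, Nat.card_Ioc, nsmul_eq_mul, Real.rpow_one]; simp; ring
    _ = _ := by
        rw [← Real.rpow_add hy0]; norm_num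

theorem abs_sum_rpowTwist_zeta_mul_sub_le {c : ArithmeticFunction ℝ} {B κ : ℝ} {L : ℝ → ℝ}
    (hκ : ∀ (N : ℕ) (u : ℝ), 1 ≤ N → (N : ℝ) ≤ u → u < N + 1 →
      |zetaPartial N - 32 * u ^ (1 / 32 : ℝ) - κ| ≤ 2 * u ^ (-(31 / 32 : ℝ)))
    (hκ1 : |κ| ≤ 32) (hc : ∀ M K, |∑ a ∈ Ioc M K, c a| ≤ B) (hB : 1 ≤ B)
    (hc1 : ∀ a, |c a| ≤ 1)
    (hL : ∀ s, 1 / 2 ≤ s → ∀ M : ℕ, 1 ≤ M →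
      |∑ a ∈ Ioc 0 M, c a * (a : ℝ) ^ (-s) - L s| ≤ B * (M : ℝ) ^ (-s))
    {y : ℕ} (hy : 1 ≤ y) :
    |∑ n ∈ Ioc 0 (y ^ 2), rpowTwist ((ζ : ArithmeticFunction ℝ) * c) (31 / 32) n -
      (32 * (y : ℝ) ^ (1 / 16 : ℝ) * L 1 + κ * L (31 / 32))| ≤
      98 * B * (y : ℝ) ^ (-(15 / 16 : ℝ)) := by
  have hy0 : (1 : ℝ) ≤ y := by exact_mod_cast hy
  have hz : ∀ N : ℕ, ∑ b ∈ Ioc 0 N, rpowTwist (ζ : ArithmeticFunction ℝ) (31 / 32) b =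
      zetaPartial N := by
    intro N
    refine sum_congr rfl fun b hb => ?_
    have : b ≠ 0 := (mem_Ioc.mp hb).1.ne'
    rw [rpowTwist_apply]
    simp [ArithmeticFunction.zeta_apply, this]
  have hζ : ∀ b, |(ζ : ArithmeticFunction ℝ) b| ≤ 1 := by
    intro b
    simp only [ArithmeticFunction.natCoe_apply, ArithmeticFunction.zeta_apply]
    split_ifs <;> simp
  have h1 := abs_sum_mul_zetaPartial_sub_le hκ hc1 hy
  have h2 := abs_sum_Ioc_mul_div_sub_le hc le_rfl hζ hy
  have h3 := hL 1 (by norm_num) y hy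
  have h4 := hL (31 / 32) (by norm_num) y hy
  rw [mul_comm, rpowTwist_mul, sum_Ioc_mul_hyperbola]
  simp_rw [hz]
  set P := ∑ a ∈ Ioc 0 y, rpowTwist c (31 / 32) a * zetaPartial (y ^ 2 / a)
  set Q := ∑ b ∈ Ioc 0 y, rpowTwist (ζ : ArithmeticFunction ℝ) (31 / 32) b *
    (∑ a ∈ Ioc 0 (y ^ 2 / b), rpowTwist c (31 / 32) a - ∑ a ∈ Ioc 0 y, rpowTwist c (31 / 32) a)
  set S₁ := ∑ a ∈ Ioc 0 y, c a * (a : ℝ) ^ (-1 : ℝ)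
  set S₂ := ∑ a ∈ Ioc 0 y, c a * (a : ℝ) ^ (-(31 / 32 : ℝ))
  set w := (y : ℝ) ^ (-(15 / 16 : ℝ)) with hw
  have hw0 : 0 ≤ w := by positivity
  have h5 : |32 * (y : ℝ) ^ (1 / 16 : ℝ) * (S₁ - L 1)| ≤ 32 * B * w := by
    rw [abs_mul, abs_of_nonneg (by positivity : 0 ≤ 32 * (y : ℝ) ^ (1 / 16 : ℝ))]
    calc _ ≤ 32 * (y : ℝ) ^ (1 / 16 : ℝ) * (B * (y : ℝ) ^ (-1 : ℝ)) := by gcongr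
      _ = 32 * B * ((y : ℝ) ^ (1 / 16 : ℝ) * (y : ℝ) ^ (-1 : ℝ)) := by ring
      _ = _ := by rw [← Real.rpow_add (by linarith), hw]; norm_num
  have h6 : |κ * (S₂ - L (31 / 32))| ≤ 32 * B * w := by
    rw [abs_mul]
    calc _ ≤ 32 * (B * w) := by
          refine mul_le_mul hκ1 (h4.trans ?_) (abs_nonneg _) (by norm_num)
          exact mul_le_mul_of_nonneg_left
            (Real.rpow_le_rpow_of_exponent_le hy0 (by norm_num)) (by linarith)
      _ = _ := by ring
  have e : P + Q - (32 * (y : ℝ) ^ (1 / 16 : ℝ) * L 1 + κ * L (31 / 32)) =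
      (P - (32 * (y : ℝ) ^ (1 / 16 : ℝ) * S₁ + κ * S₂)) + Q +
        (32 * (y : ℝ) ^ (1 / 16 : ℝ) * (S₁ - L 1)) + κ * (S₂ - L (31 / 32)) := by ring
  rw [e]
  have h7 := abs_add_le (P - (32 * (y : ℝ) ^ (1 / 16 : ℝ) * S₁ + κ * S₂)) Q
  have h8 := abs_add_le ((P - (32 * (y : ℝ) ^ (1 / 16 : ℝ) * S₁ + κ * S₂)) + Q)
    (32 * (y : ℝ) ^ (1 / 16 : ℝ) * (S₁ - L 1))
  refine (abs_add_le _ _).trans ?_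
  nlinarith

end

section

open Finset
open scoped ArithmeticFunction.zeta

theorem abs_sum_Ioc_jacobiArith_le {N : ℤ} (hN : N ≠ 0) {r : ℕ} (hr : evenJacobi N r = -1)
    (M K : ℕ) : |∑ a ∈ Ioc M K, jacobiArith N a| ≤ 8 * |(N : ℝ)| := by
  rcases le_or_gt K M with h | h
  · rw [Ioc_eq_empty (by omega)]; simp
  have h1 := abs_sum_jacobiArith_le hN hr (K + 1)
  have h2 := abs_sum_jacobiArith_le hN hr (M + 1)
  have e : ∑ a ∈ Ioc M K, jacobiArith N a =
      ∑ a ∈ range (K + 1), jacobiArith N a - ∑ a ∈ range (M + 1), jacobiArith N a := by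
    rw [← sum_Ico_eq_sub _ (by omega)]
    congr 1
    ext a
    simp only [mem_Ioc, mem_Ico]
    omega
  rw [e]
  refine (abs_sub _ _).trans ?_
  linarith

theorem nonneg_of_sum_approx {D : ℕ → ℝ} {l E C : ℝ} (hD : ∀ y, 0 ≤ D y)
    (h : ∀ y : ℕ, 1 ≤ y → |D y - (32 * (y : ℝ) ^ (1 / 16 : ℝ) * l + E)| ≤ C) : 0 ≤ l := by
  by_contra! hl
  have ht : Filter.Tendsto (fun y : ℕ => (y : ℝ) ^ (1 / 16 : ℝ)) Filter.atTop Filter.atTop :=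
    (tendsto_rpow_atTop (by norm_num)).comp tendsto_natCast_atTop_atTop
  obtain ⟨y, hy, hy1⟩ := ((ht.eventually_gt_atTop ((E + C) / (-32 * l))).and
    (Filter.eventually_ge_atTop 1)).exists
  have h1 := (abs_le.mp (h y hy1)).2
  rw [div_lt_iff₀ (by linarith)] at hy
  have := hD y
  linarith

theorem NeedsUnitSquare.exists_zero : ∃ N₀ : ℕ, ∀ n, N₀ ≤ n → NeedsUnitSquare n →
    ∃ β : ℝ, 31 / 32 ≤ β ∧ β ≤ 1 ∧ ∀ M : ℕ, 1 ≤ M →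
      |∑ a ∈ Ioc 0 M, jacobiArith (-n) a * (a : ℝ) ^ (-β)| ≤ 8 * n * (M : ℝ) ^ (-β) := by
  obtain ⟨K, hK1, hK⟩ := exists_sum_jacobiDivSum_le
  obtain ⟨κ, hκ0, hκ1, hκ⟩ := exists_zetaPartial_approx
  have ht : Filter.Tendsto (fun n : ℕ => (2352 + 61 * K) * (n : ℝ) ^ (-(1 / 16 : ℝ)))
      Filter.atTop (nhds 0) := by
    have := ((tendsto_rpow_neg_atTop (show (0 : ℝ) < 1 / 16 by norm_num)).comp
      tendsto_natCast_atTop_atTop).const_mul (2352 + 61 * K)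
    simpa using this
  obtain ⟨N₁, hN₁⟩ := Filter.eventually_atTop.mp (ht.eventually (gt_mem_nhds one_pos))
  refine ⟨N₁ + 2 ^ 16, fun n hn hbad => ?_⟩
  have hn1 := hN₁ n (by omega)
  have hn2 : 2 ^ 16 ≤ n := by omega
  have hn0 : 0 < n := by omega
  have hnR : (1 : ℝ) ≤ n := by exact_mod_cast hn0
  obtain ⟨r, hr⟩ := exists_evenJacobi_neg_eq_neg_one hn0
  have hc : ∀ M K, |∑ a ∈ Ioc M K, jacobiArith (-n) a| ≤ 8 * n := by
    intro M K
    refine (abs_sum_Ioc_jacobiArith_le (by omega) hr M K).trans_eq ?_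
    push_cast
    rw [abs_neg, Nat.abs_cast]
  obtain ⟨L, hLc, hL⟩ := exists_continuousOn_dirichlet_limit hc
  have hapx := fun (y : ℕ) (hy : 1 ≤ y) => abs_sum_rpowTwist_zeta_mul_sub_le hκ
    (abs_le.mpr ⟨hκ0, by linarith⟩) hc (by linarith) (abs_jacobiArith_le_one _) hL hy
  change ∀ (y : ℕ), 1 ≤ y → |∑ m ∈ Ioc 0 (y ^ 2), rpowTwist (jacobiDivSum (-n)) (31 / 32) m -
    (32 * (y : ℝ) ^ (1 / 16 : ℝ) * L 1 + κ * L (31 / 32))| ≤ _ at hapx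
  have hterm : ∀ m, 0 ≤ rpowTwist (jacobiDivSum (-n)) (31 / 32) m := fun m =>
    mul_nonneg (jacobiDivSum_nonneg _ _) (by positivity)
  have hL1 : 0 ≤ L 1 := by
    refine nonneg_of_sum_approx (E := κ * L (31 / 32)) (C := 98 * (8 * n))
      (D := fun y => ∑ m ∈ Ioc 0 (y ^ 2), rpowTwist (jacobiDivSum (-n)) (31 / 32) m)
      (fun y => sum_nonneg fun m _ => hterm m) fun y hy => ?_
    refine (hapx y hy).trans (mul_le_of_le_one_right (by positivity) ?_)
    exact Real.rpow_le_one_of_one_le_of_nonpos (by exact_mod_cast hy) (by norm_num)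
  have hL2 : L (31 / 32) < 0 := by
    have hy : 1 ≤ n ^ 3 := Nat.one_le_pow _ _ hn0
    have h1 := hapx (n ^ 3) hy
    have h2 := hapx (2 ^ 16 * n ^ 3) (by omega)
    have hp : (1 / 16 : ℝ) ≠ 0 := by norm_num
    have e1 : (((2 ^ 16 * n ^ 3 : ℕ) : ℝ)) ^ (1 / 16 : ℝ) =
        2 * ((n ^ 3 : ℕ) : ℝ) ^ (1 / 16 : ℝ) := by
      rw [Nat.cast_mul, Real.mul_rpow (by positivity) (by positivity), Nat.cast_pow 2,
        ← Real.rpow_natCast, ← Real.rpow_mul (by positivity)]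
      norm_num
    have e2 : (((2 ^ 16 * n ^ 3 : ℕ) : ℝ)) ^ (-(15 / 16 : ℝ)) ≤
        ((n ^ 3 : ℕ) : ℝ) ^ (-(15 / 16 : ℝ)) :=
      Real.rpow_le_rpow_of_nonpos (by positivity) (by exact_mod_cast (by omega)) (by norm_num)
    have e3 : (n : ℝ) * ((n ^ 3 : ℕ) : ℝ) ^ (-(15 / 16 : ℝ)) ≤ (n : ℝ) ^ (-(1 / 16 : ℝ)) := by
      rw [Nat.cast_pow, ← Real.rpow_natCast, ← Real.rpow_mul (by positivity)]
      nth_rw 1 [← Real.rpow_one (n : ℝ)]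
      rw [← Real.rpow_add (by positivity)]
      exact Real.rpow_le_rpow_of_exponent_le hnR (by norm_num)
    rw [e1] at h2
    have hle : (n ^ 3) ^ 2 ≤ (2 ^ 16 * n ^ 3) ^ 2 := Nat.pow_le_pow_left (by omega) 2
    have h3 : ∑ m ∈ Ioc ((n ^ 3) ^ 2) ((2 ^ 16 * n ^ 3) ^ 2),
        rpowTwist (jacobiDivSum (-n)) (31 / 32) m ≤ 61 * K * (n : ℝ) ^ (-(1 / 16 : ℝ)) := by
      have hX : (2 ^ 16 * n ^ 3) ^ 2 ≤ n ^ 8 := by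
        calc (2 ^ 16 * n ^ 3) ^ 2 ≤ (n * n ^ 3) ^ 2 := by gcongr
          _ = n ^ 8 := by ring
      have := sum_Ioc_mul_rpow_neg_le (jacobiDivSum_nonneg (-n)) (hK n (by omega) hbad)
        (y := (n ^ 3) ^ 2) (Nat.one_le_pow _ _ hy) hle hX
      calc _ ≤ ∑ b ∈ Ioc ((n ^ 3) ^ 2) ((2 ^ 16 * n ^ 3) ^ 2),
            jacobiDivSum (-n) b * (b : ℝ) ^ (-(61 / 64 : ℝ)) := by
            refine sum_le_sum fun b hb => ?_
            rw [rpowTwist_apply]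
            refine mul_le_mul_of_nonneg_left ?_ (jacobiDivSum_nonneg _ _)
            refine Real.rpow_le_rpow_of_exponent_le ?_ (by norm_num)
            exact_mod_cast (Nat.zero_le _).trans_lt (mem_Ioc.mp hb).1
        _ ≤ _ := this
        _ = 61 * K * ((n : ℝ) ^ (1 / 32 : ℝ) * (n : ℝ) ^ (-(6 / 64 : ℝ))) := by
            rw [Nat.cast_pow, Nat.cast_pow, ← pow_mul, ← Real.rpow_natCast,
              ← Real.rpow_mul (by positivity)]
            norm_num
            ring
        _ = _ := by
            rw [← Real.rpow_add (by positivity)]; norm_num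
    have h4 : 1 ≤ ∑ m ∈ Ioc 0 ((n ^ 3) ^ 2), rpowTwist (jacobiDivSum (-n)) (31 / 32) m := by
      refine le_trans (le_of_eq ?_) (single_le_sum (fun m _ => hterm m)
        (mem_Ioc.mpr ⟨one_pos, Nat.one_le_pow _ _ hy⟩))
      rw [rpowTwist_apply, (isMultiplicative_jacobiDivSum _).map_one]
      simp
    rw [← sum_Ioc_consecutive _ (Nat.zero_le _) hle] at h2
    have h5 := (abs_le.mp h1).2
    have h6 := (abs_le.mp h2).1
    have h7 : 98 * (8 * (n : ℝ)) * (((2 ^ 16 * n ^ 3 : ℕ) : ℝ)) ^ (-(15 / 16 : ℝ)) ≤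
        98 * (8 * (n : ℝ)) * ((n ^ 3 : ℕ) : ℝ) ^ (-(15 / 16 : ℝ)) := by gcongr
    by_contra! hneg
    have h8 : κ * L (31 / 32) ≤ 0 := mul_nonpos_of_nonpos_of_nonneg hκ1.le hneg
    linarith
  obtain ⟨β, ⟨hβ1, hβ2⟩, hβ⟩ := intermediate_value_Icc (by norm_num : (31 / 32 : ℝ) ≤ 1)
    (hLc.mono fun s hs => Set.mem_Ici.mpr (by linarith [hs.1])) ⟨hL2.le, hL1⟩
  refine ⟨β, hβ1, hβ2, fun M hM => ?_⟩
  have := hL β (by linarith) M hM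
  rwa [hβ, sub_zero] at this

end

section

open Finset
open scoped ArithmeticFunction.zeta

theorem pmul_jacobiDivSum (N₁ N₂ : ℤ) : (jacobiArith N₁).pmul (jacobiDivSum N₂) =
    jacobiArith N₁ * jacobiArith (N₁ * N₂) := by
  ext n
  rw [ArithmeticFunction.pmul_apply, jacobiDivSum, ArithmeticFunction.mul_apply,
    ArithmeticFunction.mul_apply, mul_sum]
  refine sum_congr rfl fun p hp => ?_
  obtain ⟨hp, hn⟩ := Nat.mem_divisorsAntidiagonal.mp hp
  have : p.1 ≠ 0 := by
    rintro h
    rw [h, zero_mul] at hp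
    exact hn hp.symm
  rw [← hp, jacobiArith_mul, jacobiArith_mul_left, ArithmeticFunction.natCoe_apply,
    ArithmeticFunction.zeta_apply_ne this]
  push_cast
  ring

/-- The Dirichlet coefficients of `ζ(s) L(s, χ₁) L(s, χ₂) L(s, χ₁χ₂)`. -/
noncomputable def biquadraticArith (N₁ N₂ : ℤ) : ArithmeticFunction ℝ :=
  jacobiDivSum N₂ * (jacobiArith N₁).pmul (jacobiDivSum N₂)

theorem biquadraticArith_comm (N₁ N₂ : ℤ) : biquadraticArith N₁ N₂ = biquadraticArith N₂ N₁ := by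
  rw [biquadraticArith, biquadraticArith, pmul_jacobiDivSum, pmul_jacobiDivSum, mul_comm N₂ N₁,
    jacobiDivSum, jacobiDivSum]
  ring

theorem isMultiplicative_biquadraticArith (N₁ N₂ : ℤ) :
    (biquadraticArith N₁ N₂).IsMultiplicative :=
  (isMultiplicative_jacobiDivSum _).mul
    ((isMultiplicative_jacobiArith _).pmul (isMultiplicative_jacobiDivSum _))

theorem biquadraticArith_prime_pow_nonneg_of_nonneg {N₁ N₂ : ℤ} {p : ℕ}
    (hp : p.Prime) (h : 0 ≤ jacobiArith N₁ p) (k : ℕ) : 0 ≤ biquadraticArith N₁ N₂ (p ^ k) := by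
  rw [biquadraticArith, ArithmeticFunction.mul_apply]
  refine sum_nonneg fun q hq => mul_nonneg (jacobiDivSum_nonneg _ _) ?_
  refine mul_nonneg ?_ (jacobiDivSum_nonneg _ _)
  obtain ⟨j, -, hj⟩ := (Nat.dvd_prime_pow hp).mp
    ⟨q.1, by rw [mul_comm]; exact (Nat.mem_divisorsAntidiagonal.mp hq).1.symm⟩
  rw [hj, jacobiArith_pow]
  exact pow_nonneg h j

theorem biquadraticArith_nonneg (N₁ N₂ : ℤ) (m : ℕ) : 0 ≤ biquadraticArith N₁ N₂ m := by
  refine (isMultiplicative_biquadraticArith N₁ N₂).nonneg (fun p k hp => ?_) m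
  rcases le_or_gt 0 (jacobiArith N₁ p) with h | h
  · exact biquadraticArith_prime_pow_nonneg_of_nonneg hp h k
  rcases le_or_gt 0 (jacobiArith N₂ p) with h2 | h2
  · rw [biquadraticArith_comm]
    exact biquadraticArith_prime_pow_nonneg_of_nonneg hp h2 k
  have e1 : jacobiArith N₁ p = -1 := 
    ((jacobiArith_trichotomy N₁ p).resolve_left h.ne).resolve_left fun h' => by linarith
  have e2 : jacobiArith N₂ p = -1 := 
    ((jacobiArith_trichotomy N₂ p).resolve_left h2.ne).resolve_left fun h' => by linarith
  rw [biquadraticArith, ArithmeticFunction.mul_apply]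
  refine sum_nonneg fun q hq => mul_nonneg (jacobiDivSum_nonneg _ _) ?_
  obtain ⟨j, -, hj⟩ := (Nat.dvd_prime_pow hp).mp
    ⟨q.1, by rw [mul_comm]; exact (Nat.mem_divisorsAntidiagonal.mp hq).1.symm⟩
  rw [ArithmeticFunction.pmul_apply, hj, jacobiDivSum_prime_pow_of_neg hp e2, jacobiArith_pow, e1]
  split_ifs with hev
  · simp [hev.neg_one_pow]
  · simp

end

section

open Finset

theorem abs_sum_rpowTwist_mul_le {c e : ArithmeticFunction ℝ} {B₁ B₂ β : ℝ} (hβ : 31 / 32 ≤ β)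
    (hc : ∀ M K, |∑ a ∈ Ioc M K, c a| ≤ B₂) (hc1 : ∀ a, |c a| ≤ 1) (he1 : ∀ a, |e a| ≤ 1)
    (he : ∀ M : ℕ, 1 ≤ M → |∑ a ∈ Ioc 0 M, e a * (a : ℝ) ^ (-β)| ≤ B₁ * (M : ℝ) ^ (-β))
    {y : ℕ} (hy : 1 ≤ y) :
    |∑ n ∈ Ioc 0 (y ^ 2), rpowTwist (e * c) β n| ≤
      32 * (B₁ + B₂) * (y : ℝ) ^ (-(15 / 16 : ℝ)) := by
  have hB₁ : 0 ≤ B₁ := by simpa using (abs_nonneg _).trans (he 1 le_rfl)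
  have hy0 : (1 : ℝ) ≤ y := by exact_mod_cast hy
  rw [mul_comm, rpowTwist_mul, sum_Ioc_mul_hyperbola]
  refine (abs_add_le _ _).trans ?_
  have h2 := abs_sum_Ioc_mul_div_sub_le hc hβ he1 hy
  have h1 : |∑ a ∈ Ioc 0 y, rpowTwist c β a * ∑ b ∈ Ioc 0 (y ^ 2 / a), rpowTwist e β b| ≤
      32 * B₁ * (y : ℝ) ^ (-(15 / 16 : ℝ)) := by
    calc _ ≤ ∑ b ∈ Ioc 0 y, (b : ℝ) ^ (-(31 / 32 : ℝ)) * (B₁ * (y : ℝ) ^ (-(31 / 32 : ℝ))) := by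
          refine (abs_sum_le_sum_abs _ _).trans (sum_le_sum fun b hb => ?_)
          have hb := mem_Ioc.mp hb
          have hb1 : (1 : ℝ) ≤ b := by exact_mod_cast hb.1
          have hyb : y ≤ y ^ 2 / b := by
            rw [Nat.le_div_iff_mul_le hb.1, sq]
            exact Nat.mul_le_mul_left y hb.2
          rw [abs_mul]
          refine mul_le_mul ?_ ?_ (abs_nonneg _) (by positivity)
          · rw [rpowTwist_apply, abs_mul, abs_of_nonneg (by positivity : 0 ≤ (b : ℝ) ^ (-β))]
            refine (mul_le_of_le_one_left (by positivity) (hc1 b)).trans ?_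
            exact Real.rpow_le_rpow_of_exponent_le hb1 (neg_le_neg hβ)
          · refine (he _ (hy.trans hyb)).trans (mul_le_mul_of_nonneg_left ?_ hB₁)
            refine (Real.rpow_le_rpow_of_nonpos (by linarith) (Nat.cast_le.mpr hyb)
              (by linarith)).trans ?_
            exact Real.rpow_le_rpow_of_exponent_le hy0 (neg_le_neg hβ)
      _ = zetaPartial y * (B₁ * (y : ℝ) ^ (-(31 / 32 : ℝ))) := by rw [← sum_mul, zetaPartial]
      _ ≤ 32 * (y : ℝ) ^ (1 / 32 : ℝ) * (B₁ * (y : ℝ) ^ (-(31 / 32 : ℝ))) := by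
          gcongr
          exact zetaPartial_le y
      _ = 32 * B₁ * ((y : ℝ) ^ (1 / 32 : ℝ) * (y : ℝ) ^ (-(31 / 32 : ℝ))) := by ring
      _ = _ := by
          rw [← Real.rpow_add (by linarith)]
          norm_num
  linarith

theorem one_le_of_zero {N₁ N₂ : ℤ} {A B₁ B₂ β : ℝ} (hβ : 31 / 32 ≤ β)
    (h₁ : ∀ M : ℕ, 1 ≤ M →
      |∑ a ∈ Ioc 0 M, jacobiArith N₁ a * (a : ℝ) ^ (-β)| ≤ B₁ * (M : ℝ) ^ (-β))
    (h₁₂ : ∀ M K, |∑ a ∈ Ioc M K, jacobiArith (N₁ * N₂) a| ≤ B₂) {y : ℕ} (hy : 1 ≤ y)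
    (hG : ∀ u : ℕ, u ≤ y ^ 2 → ∑ m ∈ Ioc 0 u, jacobiDivSum N₂ m ≤ A * (u : ℝ) ^ (15 / 16 : ℝ))
    (hA : 32 * (B₁ + B₂) * (y : ℝ) ^ (-(15 / 16 : ℝ)) ≤ A * ((y ^ 2 : ℕ) : ℝ) ^ (-(1 / 64 : ℝ))) :
    1 ≤ 7688 * A ^ 2 * ((y ^ 2 : ℕ) : ℝ) ^ (-(1 / 64 : ℝ)) := by
  have hZ := abs_sum_rpowTwist_mul_le hβ h₁₂ (abs_jacobiArith_le_one _) (abs_jacobiArith_le_one _)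
    h₁ hy
  rw [← pmul_jacobiDivSum] at hZ
  have hZ1 : 1 ≤ y ^ 2 := Nat.one_le_pow _ _ hy
  generalize y ^ 2 = Z at *
  set t := rpowTwist ((jacobiArith N₁).pmul (jacobiDivSum N₂)) β with ht
  have hA0 : 0 ≤ A := by
    have h1 := hG 1 hZ1
    simp only [Nat.cast_one, Real.one_rpow, mul_one] at h1
    exact (sum_nonneg fun _ _ => jacobiDivSum_nonneg _ _).trans h1
  have hw : ∀ (s : ℝ), 61 / 64 ≤ s → ∀ b : ℕ, jacobiDivSum N₂ b * (b : ℝ) ^ (-s) ≤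
      jacobiDivSum N₂ b * (b : ℝ) ^ (-(61 / 64 : ℝ)) := by
    intro s hs b
    rcases Nat.eq_zero_or_pos b with rfl | hb
    · simp
    refine mul_le_mul_of_nonneg_left ?_ (jacobiDivSum_nonneg _ _)
    exact Real.rpow_le_rpow_of_exponent_le (by exact_mod_cast hb) (by linarith)
  have hT : ∀ u : ℕ, 1 ≤ u → u ≤ Z → |∑ b ∈ Ioc 0 u, t b| ≤
      62 * A * (u : ℝ) ^ (-(1 / 64 : ℝ)) := by
    intro u hu huZ
    have h1 : |∑ b ∈ Ioc u Z, t b| ≤ 61 * A * (u : ℝ) ^ (-(1 / 64 : ℝ)) := by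
      refine le_trans ?_ (sum_Ioc_mul_rpow_neg_le (jacobiDivSum_nonneg N₂) hG hu huZ le_rfl)
      refine (abs_sum_le_sum_abs _ _).trans (sum_le_sum fun b hb => ?_)
      refine le_trans ?_ (hw β (by linarith) b)
      rw [ht, rpowTwist_apply, ArithmeticFunction.pmul_apply, mul_assoc, abs_mul,
        abs_of_nonneg (mul_nonneg (jacobiDivSum_nonneg N₂ b) (by positivity))]
      exact mul_le_of_le_one_left (mul_nonneg (jacobiDivSum_nonneg N₂ b) (by positivity))
        (abs_jacobiArith_le_one _ _)
    have h2 : A * (Z : ℝ) ^ (-(1 / 64 : ℝ)) ≤ A * (u : ℝ) ^ (-(1 / 64 : ℝ)) := by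
      refine mul_le_mul_of_nonneg_left ?_ hA0
      exact Real.rpow_le_rpow_of_nonpos (by positivity) (by exact_mod_cast huZ) (by norm_num)
    rw [← sum_Ioc_consecutive _ (Nat.zero_le u) huZ] at hZ
    have h3 := abs_sub (∑ b ∈ Ioc 0 u, t b + ∑ b ∈ Ioc u Z, t b) (∑ b ∈ Ioc u Z, t b)
    rw [add_sub_cancel_right] at h3
    linarith
  have hF : 1 ≤ ∑ m ∈ Ioc 0 Z, rpowTwist (biquadraticArith N₁ N₂) β m := by
    refine le_trans (le_of_eq ?_) (single_le_sum
      (fun m _ => mul_nonneg (biquadraticArith_nonneg N₁ N₂ m) (by positivity))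
      (mem_Ioc.mpr ⟨one_pos, hZ1⟩))
    rw [(isMultiplicative_biquadraticArith _ _).map_one]
    simp
  refine hF.trans ?_
  rw [biquadraticArith, rpowTwist_mul, ArithmeticFunction.sum_Ioc_mul_eq_sum_sum]
  calc _ ≤ ∑ a ∈ Ioc 0 Z, 124 * A * (Z : ℝ) ^ (-(1 / 64 : ℝ)) *
          (jacobiDivSum N₂ a * (a : ℝ) ^ (-(61 / 64 : ℝ))) := by
        refine sum_le_sum fun a ha => ?_
        have ha := mem_Ioc.mp ha
        have ha0 : (0 : ℝ) < a := by exact_mod_cast ha.1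
        have hN : 1 ≤ Z / a := by
          rw [Nat.le_div_iff_mul_le ha.1]; omega
        have hN0 : (0 : ℝ) < (Z / a : ℕ) := by exact_mod_cast hN
        have hNZ : (Z : ℝ) ≤ 2 * a * (Z / a : ℕ) := by
          have : Z ≤ 2 * a * (Z / a) := by
            have := Nat.lt_mul_div_succ Z ha.1
            nlinarith
          exact_mod_cast this
        have h1 : ((Z / a : ℕ) : ℝ) ^ (-(1 / 64 : ℝ)) ≤
            2 * (Z : ℝ) ^ (-(1 / 64 : ℝ)) * (a : ℝ) ^ (1 / 64 : ℝ) := by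
          calc ((Z / a : ℕ) : ℝ) ^ (-(1 / 64 : ℝ)) ≤ ((Z : ℝ) / (2 * a)) ^ (-(1 / 64 : ℝ)) := by
                refine Real.rpow_le_rpow_of_nonpos (by positivity) ?_ (by norm_num)
                rw [div_le_iff₀ (by positivity)]
                linarith
            _ = 2 ^ (1 / 64 : ℝ) * (Z : ℝ) ^ (-(1 / 64 : ℝ)) * (a : ℝ) ^ (1 / 64 : ℝ) := by
                rw [Real.div_rpow (by positivity) (by positivity), Real.rpow_neg (by positivity :
                  (0 : ℝ) ≤ 2 * a), Real.mul_rpow (by norm_num) ha0.le]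
                field_simp
            _ ≤ 2 ^ (1 : ℝ) * (Z : ℝ) ^ (-(1 / 64 : ℝ)) * (a : ℝ) ^ (1 / 64 : ℝ) := by
                gcongr <;> norm_num
            _ = _ := by norm_num
        have h2 : rpowTwist (jacobiDivSum N₂) β a * (a : ℝ) ^ (1 / 64 : ℝ) ≤
            jacobiDivSum N₂ a * (a : ℝ) ^ (-(61 / 64 : ℝ)) := by
          rw [rpowTwist_apply, mul_assoc, ← Real.rpow_add ha0,
            show -β + 1 / 64 = -(β - 1 / 64) by ring]
          exact hw _ (by linarith) a
        have h3 : 0 ≤ rpowTwist (jacobiDivSum N₂) β a :=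
          mul_nonneg (jacobiDivSum_nonneg _ _) (by positivity)
        calc _ ≤ rpowTwist (jacobiDivSum N₂) β a * (62 * A *
              (2 * (Z : ℝ) ^ (-(1 / 64 : ℝ)) * (a : ℝ) ^ (1 / 64 : ℝ))) := by
              refine mul_le_mul_of_nonneg_left ?_ h3
              refine (le_abs_self _).trans ((hT _ hN (Nat.div_le_self _ _)).trans ?_)
              gcongr
          _ = 124 * A * (Z : ℝ) ^ (-(1 / 64 : ℝ)) *
              (rpowTwist (jacobiDivSum N₂) β a * (a : ℝ) ^ (1 / 64 : ℝ)) := by ring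
          _ ≤ _ := by gcongr
    _ ≤ 124 * A * (Z : ℝ) ^ (-(1 / 64 : ℝ)) * (62 * A) := by
        rw [← mul_sum]
        gcongr
        exact sum_Ioc_zero_mul_rpow_neg_le (jacobiDivSum_nonneg N₂) hG hZ1
    _ = _ := by ring

end

section

open Finset

theorem NeedsUnitSquare.bounded_of_zero {n₁ : ℕ} (hn₁ : 0 < n₁) {β : ℝ} (hβ : 31 / 32 ≤ β)
    (hzero : ∀ M : ℕ, 1 ≤ M →
      |∑ a ∈ Ioc 0 M, jacobiArith (-n₁) a * (a : ℝ) ^ (-β)| ≤ 8 * n₁ * (M : ℝ) ^ (-β)) :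
    ∃ N₀, ∀ n, N₀ ≤ n → ¬ NeedsUnitSquare n := by
  obtain ⟨K, hK1, hK⟩ := exists_sum_jacobiDivSum_le
  obtain ⟨N₁, hN₁⟩ := NeedsUnitSquare.exists_not_isSquare_mul hn₁
  have ht : Filter.Tendsto (fun n : ℕ => 7688 * K ^ 2 * (n : ℝ) ^ (-(1 / 16 : ℝ)))
      Filter.atTop (nhds 0) := by
    have := ((tendsto_rpow_neg_atTop (show (0 : ℝ) < 1 / 16 by norm_num)).comp
      tendsto_natCast_atTop_atTop).const_mul (7688 * K ^ 2)
    simpa using this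
  obtain ⟨N₂, hN₂⟩ := Filter.eventually_atTop.mp (ht.eventually (gt_mem_nhds one_pos))
  refine ⟨N₁ + N₂ + 512 * n₁ + 2, fun n hn hbad => ?_⟩
  have hn0 : 0 < n := by omega
  have hnR : (1 : ℝ) ≤ n := by exact_mod_cast hn0
  have hn0R : (0 : ℝ) < n := by linarith
  have hn1R : (1 : ℝ) ≤ n₁ := by exact_mod_cast hn₁
  have hbig : 512 * (n₁ : ℝ) ≤ n := by exact_mod_cast (by omega : 512 * n₁ ≤ n)
  obtain ⟨r, hr⟩ := exists_evenJacobi_eq_neg_one (N := n₁ * n) (by positivity)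
    (hN₁ n (by omega) hbad)
  have e1 : (-(n₁ : ℤ)) * (-(n : ℤ)) = ((n₁ * n : ℕ) : ℤ) := by push_cast; ring
  have hc : ∀ M K, |∑ a ∈ Ioc M K, jacobiArith (-(n₁ : ℤ) * -(n : ℤ)) a| ≤ 8 * (n₁ * n) := by
    intro M K
    rw [e1]
    refine (abs_sum_Ioc_jacobiArith_le (by positivity) hr M K).trans_eq ?_
    push_cast
    rw [abs_of_nonneg (by positivity)]
  have hpow : (n ^ 4) ^ 2 = n ^ 8 := by ring
  have hp1 : (((n ^ 4) ^ 2 : ℕ) : ℝ) ^ (-(1 / 64 : ℝ)) = (n : ℝ) ^ (-(1 / 8 : ℝ)) := by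
    rw [hpow, Nat.cast_pow, ← Real.rpow_natCast, ← Real.rpow_mul hn0R.le]; norm_num
  have hp2 : ((n ^ 4 : ℕ) : ℝ) ^ (-(15 / 16 : ℝ)) = (n : ℝ) ^ (-(15 / 4 : ℝ)) := by
    rw [Nat.cast_pow, ← Real.rpow_natCast, ← Real.rpow_mul hn0R.le]; norm_num
  have h := one_le_of_zero (A := K * (n : ℝ) ^ (1 / 32 : ℝ)) hβ hzero hc
    (Nat.one_le_pow 4 n hn0)
    (fun u hu => hK n (by omega) hbad u (hu.trans_eq hpow)) (by
      rw [hp1, hp2]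
      calc 32 * (8 * (n₁ : ℝ) + 8 * (n₁ * n)) * (n : ℝ) ^ (-(15 / 4 : ℝ))
          ≤ (n : ℝ) ^ (2 : ℝ) * (n : ℝ) ^ (-(15 / 4 : ℝ)) := by
            gcongr
            rw [Real.rpow_two]
            nlinarith
        _ = (n : ℝ) ^ (-(7 / 4 : ℝ)) := by rw [← Real.rpow_add hn0R]; norm_num
        _ ≤ (n : ℝ) ^ (-(3 / 32 : ℝ)) := Real.rpow_le_rpow_of_exponent_le hnR (by norm_num)
        _ = (n : ℝ) ^ (1 / 32 : ℝ) * (n : ℝ) ^ (-(1 / 8 : ℝ)) := by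
            rw [← Real.rpow_add hn0R]; norm_num
        _ ≤ K * (n : ℝ) ^ (1 / 32 : ℝ) * (n : ℝ) ^ (-(1 / 8 : ℝ)) := by
            gcongr
            exact le_mul_of_one_le_left (by positivity) hK1)
  have e2 : 7688 * (K * (n : ℝ) ^ (1 / 32 : ℝ)) ^ 2 * (n : ℝ) ^ (-(1 / 8 : ℝ)) =
      7688 * K ^ 2 * (n : ℝ) ^ (-(1 / 16 : ℝ)) := by
    have : ((n : ℝ) ^ (1 / 32 : ℝ)) ^ 2 * (n : ℝ) ^ (-(1 / 8 : ℝ)) =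
        (n : ℝ) ^ (-(1 / 16 : ℝ)) := by
      rw [← Real.rpow_natCast, ← Real.rpow_mul hn0R.le, ← Real.rpow_add hn0R]; norm_num
    rw [← this]; ring
  rw [hp1, e2] at h
  exact (hN₂ n (by omega)).not_ge h

end

/-- The set of positive integers that are sums of three squares but not sums of three
nonunit squares is finite. -/
theorem stmt_7 :
    {n : ℕ | 0 < n ∧ (∃ a b c : ℤ, (n : ℤ) = a ^ 2 + b ^ 2 + c ^ 2) ∧
      ¬∃ x y z : ℤ, (n : ℤ) = x ^ 2 + y ^ 2 + z ^ 2 ∧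
        x ^ 2 ≠ 1 ∧ y ^ 2 ≠ 1 ∧ z ^ 2 ≠ 1}.Finite := by
  change {n : ℕ | NeedsUnitSquare n}.Finite
  by_contra hinf
  have hinf : {n : ℕ | NeedsUnitSquare n}.Infinite := hinf
  obtain ⟨N₁, hN₁⟩ := NeedsUnitSquare.exists_zero
  obtain ⟨n₁, hn₁, hlt₁⟩ := hinf.exists_gt N₁
  obtain ⟨β, hβ, -, hzero⟩ := hN₁ n₁ hlt₁.le hn₁
  obtain ⟨N₂, hN₂⟩ := NeedsUnitSquare.bounded_of_zero (by omega) hβ hzero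
  obtain ⟨n₂, hn₂, hlt₂⟩ := hinf.exists_gt N₂
  exact hN₂ n₂ hlt₂.le hn₂
end

section
/- Let n be a positive integer that is not square-free, is coprime to 5, and is not divisible by 4 (i.e., the 2-adic valuation of n is at most 1). If for every prime p there exist p-adic integers x, y, z ∈ ℤ_p with 3x² + 25y² + 25z² − 10xy − 10xz = n, then there exist integers a, b, c with n = 3a² + 25b² + 25c² − 10ab − 10ac, and there also exist integers a', b', c' with n = 2a'² + 25b'² + 25c'² − 10a'b'. -/
theorem exists_add_mul_le (A B : ℤ) (hA : 0 < A) :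
    ∃ t : ℤ, -A ≤ 2 * (B + t * A) ∧ 2 * (B + t * A) ≤ A := by
  refine ⟨-((2 * B + A) / (2 * A)), ?_⟩
  have h1 := Int.emod_add_mul_ediv (2 * B + A) (2 * A)
  have h2 := Int.emod_nonneg (2 * B + A) (by omega : 2 * A ≠ 0)
  have h3 := Int.emod_lt_of_pos (2 * B + A) (by omega : 0 < 2 * A)
  constructor <;> nlinarith

/-- A positive definite binary form of determinant `D` is properly equivalent to one with leading
coefficient at most `√(4D/3)`. -/
theorem exists_binary_reduction (A : ℕ) : ∀ B C : ℤ, 0 < (A : ℤ) → 0 < A * C - B ^ 2 →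
    ∃ p q r s : ℤ, p * s - q * r = 1 ∧
      3 * (A * p ^ 2 + 2 * B * p * r + C * r ^ 2) ^ 2 ≤ 4 * (A * C - B ^ 2) := by
  induction A using Nat.strong_induction_on with
  | _ A ih =>
    intro B C hA hD
    obtain ⟨t, ht1, ht2⟩ := exists_add_mul_le A B hA
    set B' := B + t * A with hB'
    set C' := C + 2 * B * t + A * t ^ 2 with hC'
    have hdet : A * C' - B' ^ 2 = A * C - B ^ 2 := by rw [hB', hC']; ring
    have hBsq : 4 * B' ^ 2 ≤ (A : ℤ) ^ 2 := by nlinarith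
    by_cases h : (A : ℤ) ≤ C'
    · refine ⟨1, 0, 0, 1, by norm_num, ?_⟩
      nlinarith
    · have hC'pos : 0 < C' := by
        by_contra hneg
        nlinarith [sq_nonneg B']
      obtain ⟨k, hk⟩ := Int.eq_ofNat_of_zero_le hC'pos.le
      obtain ⟨p, q, r, s, h1, h2⟩ := ih k (by omega) (-B') A (by omega) (by rw [← hk]; linarith)
      refine ⟨t * p - r, t * q - s, p, q, by linarith, ?_⟩
      rw [← hk] at h2
      convert h2 using 1
      · rw [hB', hC']; ring
      · rw [hB', hC']; ring

theorem reduced_bounds {a b d A : ℤ} (ha : 2 ≤ a) (hA : 0 < A) (hAa : 3 * A ^ 2 ≤ 4 * a)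
    (hab : a * b = A + d ^ 2) (hd₁ : -a ≤ 2 * d) (hd₂ : 2 * d ≤ a) : 0 < b ∧ b < a := by
  have ha0 : 0 < a := by linarith
  constructor
  · have h : 0 < a * b := by rw [hab]; positivity
    exact pos_of_mul_pos_right h ha0.le
  · by_contra! hge
    have hd : 4 * d ^ 2 ≤ a ^ 2 := by nlinarith
    have h1 : a * a ≤ a * b := by gcongr
    have h2 : 3 * a ≤ 2 * A := by nlinarith
    nlinarith

theorem ternary_det_eq_one_of_unimodular {a b c d e f p q r s : ℤ} (t : ℤ) (h : p * s - q * r = 1)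
    (hdet : a * b * c + 2 * d * e * f - a * f ^ 2 - b * e ^ 2 - c * d ^ 2 = 1) :
    (b * p ^ 2 + c * r ^ 2 + 2 * f * p * r + 2 * (d * p + e * r) * t + a * t ^ 2) * a *
        (b * q ^ 2 + c * s ^ 2 + 2 * f * q * s) +
      2 * (d * p + e * r + t * a) *
        (b * p * q + c * r * s + f * (p * s + q * r) + t * (d * q + e * s)) * (d * q + e * s) -
      (b * p ^ 2 + c * r ^ 2 + 2 * f * p * r + 2 * (d * p + e * r) * t + a * t ^ 2) *
        (d * q + e * s) ^ 2 -
      a * (b * p * q + c * r * s + f * (p * s + q * r) + t * (d * q + e * s)) ^ 2 -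
      (b * q ^ 2 + c * s ^ 2 + 2 * f * q * s) * (d * p + e * r + t * a) ^ 2 = 1 := by
  linear_combination (p * s - q * r) ^ 2 * hdet + (p * s - q * r + 1) * h

/-- A positive definite ternary form of determinant one represents only sums of three squares. -/
theorem ternary_det_one_isSumThreeSq (a : ℕ) : ∀ b c d e f : ℤ, 0 < (a : ℤ) → 0 < a * b - d ^ 2 →
    a * b * c + 2 * d * e * f - a * f ^ 2 - b * e ^ 2 - c * d ^ 2 = 1 →
    ∀ x y z : ℤ, ∃ u v w : ℤ,
      a * x ^ 2 + b * y ^ 2 + c * z ^ 2 + 2 * d * x * y + 2 * e * x * z + 2 * f * y * z =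
        u ^ 2 + v ^ 2 + w ^ 2 := by
  induction a using Nat.strong_induction_on with
  | _ a ih =>
    intro b c d e f ha hG hdet x y z
    obtain ⟨A, hA⟩ := Int.eq_ofNat_of_zero_le hG.le
    have hGdet : A * (a * c - e ^ 2) - (a * f - d * e) ^ 2 = a := by
      rw [← hA]; linear_combination a * hdet
    obtain ⟨p, q, r, s, h1, h2⟩ := exists_binary_reduction A (a * f - d * e) (a * c - e ^ 2)
      (by omega) (by omega)
    rw [hGdet] at h2
    obtain ⟨A', hA'⟩ : ∃ w,
        w = A * p ^ 2 + 2 * (a * f - d * e) * p * r + (a * c - e ^ 2) * r ^ 2 := ⟨_, rfl⟩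
    rw [← hA'] at h2
    have hA'pos : 0 < A' := by
      have h3 : A * A' = (A * p + (a * f - d * e) * r) ^ 2 + a * r ^ 2 := by
        rw [hA']; linear_combination r ^ 2 * hGdet
      have h4 : 0 < (A * p + (a * f - d * e) * r) ^ 2 + a * r ^ 2 := by
        by_cases hr : r = 0
        · subst hr
          have hp : p ≠ 0 := by rintro rfl; simp at h1
          have : (A : ℤ) * p ≠ 0 := mul_ne_zero (by omega) hp
          have := sq_pos_of_ne_zero this
          simpa using this
        · have := sq_pos_of_ne_zero hr
          positivity
      rw [← h3] at h4
      exact pos_of_mul_pos_right h4 (by omega)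
    -- coordinates of `(y, z)` in the new basis
    obtain ⟨Y, hY⟩ : ∃ w, w = s * y - q * z := ⟨_, rfl⟩
    obtain ⟨Z, hZ⟩ : ∃ w, w = -r * y + p * z := ⟨_, rfl⟩
    have hy : y = p * Y + q * Z := by rw [hY, hZ]; linear_combination (-y) * h1
    have hz : z = r * Y + s * Z := by rw [hY, hZ]; linear_combination (-z) * h1
    obtain ⟨t, ht1, ht2⟩ := exists_add_mul_le a (d * p + e * r) ha
    obtain ⟨d', hd'⟩ : ∃ w, w = d * p + e * r + t * a := ⟨_, rfl⟩
    rw [← hd'] at ht1 ht2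
    obtain ⟨b', hb'⟩ : ∃ w,
        w = b * p ^ 2 + c * r ^ 2 + 2 * f * p * r + 2 * (d * p + e * r) * t + a * t ^ 2 := ⟨_, rfl⟩
    have hab : a * b' = A' + d' ^ 2 := by
      rw [hA', hb', hd', ← hA]; ring
    by_cases ha1 : a = 1
    · subst ha1
      have hA1 : A' = 1 := by push_cast at h2; nlinarith
      obtain ⟨B', hB'⟩ : ∃ w,
          w = A * p * q + (f - d * e) * (p * s + q * r) + (c - e ^ 2) * r * s := ⟨_, rfl⟩
      refine ⟨x + d * y + e * z, Y + B' * Z, Z, ?_⟩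
      have hC : A * q ^ 2 + 2 * (f - d * e) * q * s + (c - e ^ 2) * s ^ 2 = B' ^ 2 + 1 := by
        push_cast at hGdet hA'
        have : A' * (A * q ^ 2 + 2 * (f - d * e) * q * s + (c - e ^ 2) * s ^ 2) - B' ^ 2
            = (p * s - q * r) ^ 2 := by
          rw [hA', hB']; linear_combination (p * s - q * r) ^ 2 * hGdet
        rw [hA1, h1] at this
        linarith
      have key : A * y ^ 2 + 2 * (f - d * e) * y * z + (c - e ^ 2) * z ^ 2 =
          (Y + B' * Z) ^ 2 + Z ^ 2 := by
        have h5 : A * y ^ 2 + 2 * (f - d * e) * y * z + (c - e ^ 2) * z ^ 2 =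
          A' * Y ^ 2 + 2 * B' * Y * Z +
            (A * q ^ 2 + 2 * (f - d * e) * q * s + (c - e ^ 2) * s ^ 2) * Z ^ 2 := by
          rw [hy, hz, hA', hB']; push_cast; ring
        rw [h5, hC, hA1]; ring
      push_cast at hA ⊢
      rw [← hA] at key
      linear_combination key
    · obtain ⟨hb'pos, hlt⟩ := reduced_bounds (by omega) hA'pos h2 hab ht1 ht2
      obtain ⟨k, hk⟩ := Int.eq_ofNat_of_zero_le hb'pos.le
      -- the form in the variables `(Y, X, Z)` with `x = X + t * Y`
      obtain ⟨u, v, w, huvw⟩ := ih k (by omega) a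
        (b * q ^ 2 + c * s ^ 2 + 2 * f * q * s) d'
        (b * p * q + c * r * s + f * (p * s + q * r) + t * (d * q + e * s)) (d * q + e * s)
        (by omega) (by rw [← hk]; linarith)
        (by rw [← hk, hb', hd']; exact ternary_det_eq_one_of_unimodular t h1 hdet)
        Y (x - t * Y) Z
      refine ⟨u, v, w, ?_⟩
      rw [← huvw, ← hk, hy, hz, hb', hd']
      ring

theorem exists_sum_three_sq_of_dvd {n b x : ℤ} (hb : 0 < b) (hbn : 0 < b * n - 1)
    (h : b * n - 1 ∣ x ^ 2 + b) : ∃ u v w : ℤ, n = u ^ 2 + v ^ 2 + w ^ 2 := by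
  obtain ⟨a, ha⟩ := h
  have hapos : 0 < a := by
    have : 0 < (b * n - 1) * a := by rw [← ha]; positivity
    exact pos_of_mul_pos_right this hbn.le
  obtain ⟨k, rfl⟩ := Int.eq_ofNat_of_zero_le hapos.le
  obtain ⟨u, v, w, h⟩ := ternary_det_one_isSumThreeSq k (b * n - 1) n x 1 0 hapos
    (by linarith) (by linear_combination (-n) * ha) 0 0 1
  exact ⟨u, v, w, by linear_combination h⟩

open scoped NumberTheorySymbols in
theorem exists_dvd_sq_add_of_jacobiSym_eq_one {p b : ℕ} (hp : p.Prime) (hJ : J(-b | p) = 1) :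
    ∃ x : ℤ, (p : ℤ) ∣ x ^ 2 + b := by
  have : Fact p.Prime := ⟨hp⟩
  obtain ⟨y, hy⟩ := ZMod.isSquare_of_jacobiSym_eq_one hJ
  refine ⟨y.val, ?_⟩
  rw [← ZMod.intCast_zmod_eq_zero_iff_dvd]
  push_cast at hy ⊢
  rw [ZMod.natCast_zmod_val, sq, ← hy]
  ring

theorem exists_sum_three_sq_of_mod_four_eq_two {n : ℕ} (hn : n % 4 = 2) :
    ∃ u v w : ℤ, (n : ℤ) = u ^ 2 + v ^ 2 + w ^ 2 := by
  have hcop : (n - 1).Coprime (4 * n) := by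
    refine Nat.Coprime.mul_right ?_ ?_
    · exact Nat.Coprime.pow_right 2 ((Nat.coprime_two_right).2 (Nat.odd_iff.2 (by omega)))
    · exact (Nat.coprime_self_sub_left (by omega)).2 (by simp)
  obtain ⟨p, hpn, hp, hmod⟩ := Nat.forall_exists_prime_gt_and_modEq (n - 1) (by omega) hcop
  obtain ⟨j, hj⟩ := (Nat.modEq_iff_dvd' hpn.le).1 hmod.symm
  obtain ⟨b, hb⟩ : ∃ b, b = 4 * j + 1 := ⟨_, rfl⟩
  have hbp : b * n = p + 1 := by
    rw [hb]; nlinarith [Nat.sub_add_cancel hpn.le, Nat.sub_add_cancel (by omega : 1 ≤ n)]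
  have hp4 : p % 4 = 1 := by
    have h1 : p = 4 * (n * j) + (n - 1) := by rw [← mul_assoc]; omega
    omega
  have hb4 : b % 4 = 1 := by omega
  have hJ : jacobiSym (-b) p = 1 := by
    rw [jacobiSym.neg _ (Nat.odd_iff.2 (by omega)), ZMod.χ₄_nat_one_mod_four hp4, one_mul,
      jacobiSym.quadratic_reciprocity_one_mod_four hb4 (Nat.odd_iff.2 (by omega)),
      jacobiSym.mod_left' (a₂ := -1), jacobiSym.at_neg_one (Nat.odd_iff.2 (by omega)),
      ZMod.χ₄_nat_one_mod_four hb4]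
    exact Int.ModEq.symm ((Int.modEq_iff_dvd).2 ⟨n, by push_cast [← Nat.cast_mul, hbp]; ring⟩)
  obtain ⟨x, hx⟩ := exists_dvd_sq_add_of_jacobiSym_eq_one hp hJ
  have hpz : (b : ℤ) * n - 1 = p := by rw [← Nat.cast_mul, hbp]; simp
  exact exists_sum_three_sq_of_dvd (by omega) (by rw [hpz]; exact_mod_cast hp.pos) (hpz ▸ hx)

theorem exists_sum_three_sq_of_odd {n c k : ℕ} (hn : Odd n) (hk : 2 * k + 1 = c * n)
    (h : k % 4 = 1 ∧ c % 8 = 1 ∨ k % 2 = 1 ∧ c % 8 = 3) :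
    ∃ u v w : ℤ, (n : ℤ) = u ^ 2 + v ^ 2 + w ^ 2 := by
  have hn0 := hn.pos
  have hcop : k.Coprime (4 * n) := by
    refine Nat.Coprime.mul_right ?_ ?_
    · exact Nat.Coprime.pow_right 2 ((Nat.coprime_two_right).2 (Nat.odd_iff.2 (by omega)))
    · have h1 : Nat.gcd k n ∣ 2 * k + 1 := hk ▸ (Nat.gcd_dvd_right k n).mul_left c
      exact Nat.dvd_one.1 ((Nat.dvd_add_right ((Nat.gcd_dvd_left k n).mul_left 2)).1 h1)
  obtain ⟨p, hpk, hp, hmod⟩ := Nat.forall_exists_prime_gt_and_modEq k (by omega) hcop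
  obtain ⟨j, hj⟩ := (Nat.modEq_iff_dvd' hpk.le).1 hmod.symm
  obtain ⟨b, hb⟩ : ∃ b, b = 8 * j + c := ⟨_, rfl⟩
  have hp' : p = 4 * (n * j) + k := by rw [← mul_assoc]; omega
  have hbp : b * n = 2 * p + 1 := by rw [hb, hp']; linarith
  have hp2 : Odd p := Nat.odd_iff.2 (by omega)
  have hb2 : Odd b := Nat.odd_iff.2 (by omega)
  have h2p : jacobiSym 2 b * jacobiSym p b = jacobiSym (-1) b := by
    rw [← jacobiSym.mul_left]
    refine jacobiSym.mod_left' (Int.ModEq.symm ((Int.modEq_iff_dvd).2 ⟨n, ?_⟩))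
    rw [← Nat.cast_mul, hbp]; push_cast; ring
  rw [jacobiSym.at_two hb2, jacobiSym.at_neg_one hb2, ZMod.χ₈_nat_eq_if_mod_eight] at h2p
  have hJ : jacobiSym (-b) p = 1 := by
    rw [jacobiSym.neg _ hp2]
    rcases h with ⟨hk4, hc⟩ | ⟨hk2, hc⟩
    · rw [ZMod.χ₄_nat_one_mod_four (by omega : p % 4 = 1),
        jacobiSym.quadratic_reciprocity_one_mod_four' hb2 (by omega)]
      rw [ZMod.χ₄_nat_one_mod_four (by omega : b % 4 = 1), if_neg (by omega), if_pos (by omega)]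
        at h2p
      linarith
    · rw [ZMod.χ₄_nat_three_mod_four (by omega : b % 4 = 3), if_neg (by omega), if_neg (by omega)]
        at h2p
      rcases Nat.odd_mod_four_iff.1 (Nat.odd_iff.1 hp2) with hp4 | hp4
      · rw [ZMod.χ₄_nat_one_mod_four hp4, jacobiSym.quadratic_reciprocity_one_mod_four' hb2 hp4]
        linarith
      · rw [ZMod.χ₄_nat_three_mod_four hp4,
          jacobiSym.quadratic_reciprocity_three_mod_four (by omega) hp4]
        linarith
  obtain ⟨x, hx⟩ := exists_dvd_sq_add_of_jacobiSym_eq_one hp hJ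
  have hpz : (b : ℤ) * n - 1 = 2 * p := by rw [← Nat.cast_mul, hbp]; push_cast; ring
  have hp0 := hp.pos
  -- adjust the parity of the square root of `-b`
  obtain ⟨y, hy, hy2⟩ : ∃ y : ℤ, (p : ℤ) ∣ y ^ 2 + b ∧ y % 2 = 1 := by
    rcases Int.emod_two_eq_zero_or_one x with h0 | h1
    · refine ⟨x + p, ?_, by have := Nat.odd_iff.1 hp2; omega⟩
      have : (x + p) ^ 2 + b = x ^ 2 + b + p * (2 * x + p) := by ring
      rw [this]
      exact hx.add (dvd_mul_right _ _)
    · exact ⟨x, hx, h1⟩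
  refine exists_sum_three_sq_of_dvd (b := b) (x := y) (by have := hb2.pos; omega)
    (by rw [hpz]; omega) ?_
  rw [hpz]
  refine IsCoprime.mul_dvd ?_ ?_ hy
  · rw [← Nat.cast_two, Nat.isCoprime_iff_coprime]
    exact (Nat.coprime_two_left).2 hp2
  · have h3 : Odd (y ^ 2) := (Int.odd_iff.2 hy2).pow
    have h4 : Odd (b : ℤ) := by exact_mod_cast hb2
    exact (h3.add_odd h4).two_dvd

/-- Gauss's three squares theorem, for integers not divisible by `4`. -/
theorem exists_sum_three_sq {n : ℕ} (h4 : n % 4 ≠ 0) (h7 : n % 8 ≠ 7) :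
    ∃ u v w : ℤ, (n : ℤ) = u ^ 2 + v ^ 2 + w ^ 2 := by
  have h : n % 4 = 2 ∨ n % 8 = 3 ∨ n % 4 = 1 := by omega
  rcases h with h | h | h
  · exact exists_sum_three_sq_of_mod_four_eq_two h
  · exact exists_sum_three_sq_of_odd (c := 1) (k := (n - 1) / 2) (Nat.odd_iff.2 (by omega))
      (by omega) (by omega)
  · exact exists_sum_three_sq_of_odd (c := 3) (k := (3 * n - 1) / 2) (Nat.odd_iff.2 (by omega))
      (by omega) (by omega)

/-- A condition ensuring that the rotation modulo `5` attached to the quaternion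
`a + b i + c j + d k` is not a signed permutation up to scaling. -/
def IsExoticModFive (a b c d : ZMod 5) : Prop :=
  a ^ 2 = 2 * (a ^ 2 + b ^ 2 + c ^ 2 + d ^ 2) ∧ a ≠ 0 ∨
    b ^ 2 + c ^ 2 + d ^ 2 = 0 ∧ a ≠ 0 ∧ ¬ (b = 0 ∧ c = 0 ∧ d = 0)

/-- The three coordinates of the rotated vector, up to signs of the original coordinates, can be
made to have zero or nonzero product (`i = 0` and `i = 1` respectively). -/
theorem exists_signs_ne_zero_and_eq_zero : ∀ a b c d : ZMod 5,
    IsExoticModFive a b c d →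
    ∀ x y z : ZMod 5, x ^ 2 + y ^ 2 + z ^ 2 = 2 ∨ x ^ 2 + y ^ 2 + z ^ 2 = 3 →
    ∀ i : Fin 2, ∃ e₁ e₂ : Fin 2,
      ((i = 0) ↔ (((a ^ 2 + b ^ 2 - c ^ 2 - d ^ 2) * x + 2 * (b * c - a * d) * ((-1) ^ e₁.val * y) +
          2 * (b * d + a * c) * ((-1) ^ e₂.val * z)) *
        (2 * (b * c + a * d) * x + (a ^ 2 - b ^ 2 + c ^ 2 - d ^ 2) * ((-1) ^ e₁.val * y) +
          2 * (c * d - a * b) * ((-1) ^ e₂.val * z)) *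
        (2 * (b * d - a * c) * x + 2 * (c * d + a * b) * ((-1) ^ e₁.val * y) +
          (a ^ 2 - b ^ 2 - c ^ 2 + d ^ 2) * ((-1) ^ e₂.val * z)) = 0)) := by
  unfold IsExoticModFive
  decide +kernel

theorem isExoticModFive_of_emod {k a b c d : ℤ} (hk : k = a ^ 2 + b ^ 2 + c ^ 2 + d ^ 2)
    (ha : a % 5 ≠ 0) (h : a ^ 2 % 5 = 2 * k % 5 ∨ k % 5 = a ^ 2 % 5 ∧ k % 25 ≠ a ^ 2 % 25) :
    IsExoticModFive a b c d := by
  have ha' : (a : ZMod 5) ≠ 0 := by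
    rw [Ne, ZMod.intCast_zmod_eq_zero_iff_dvd]
    omega
  rcases h with h | ⟨h, h'⟩
  · refine Or.inl ⟨?_, ha'⟩
    have := (ZMod.intCast_eq_intCast_iff' (a ^ 2) (2 * k) 5).2 h
    rw [hk] at this
    exact_mod_cast this
  · refine Or.inr ⟨?_, ha', ?_⟩
    · have := (ZMod.intCast_eq_intCast_iff' k (a ^ 2) 5).2 h
      rw [hk] at this
      push_cast at this
      linear_combination this
    · rintro ⟨hb, hc, hd⟩
      have hb := (ZMod.intCast_zmod_eq_zero_iff_dvd b 5).1 hb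
      have hc := (ZMod.intCast_zmod_eq_zero_iff_dvd c 5).1 hc
      have hd := (ZMod.intCast_zmod_eq_zero_iff_dvd d 5).1 hd
      obtain ⟨b, rfl⟩ := hb
      obtain ⟨c, rfl⟩ := hc
      obtain ⟨d, rfl⟩ := hd
      refine h' (Int.ModEq.symm ((Int.modEq_iff_dvd).2 ⟨b ^ 2 + c ^ 2 + d ^ 2, ?_⟩))
      rw [hk]; push_cast; ring

theorem exists_isExoticModFive_of_emod {k : ℕ} (a : ℕ) (hak : a ^ 2 ≤ k) (ha : a % 5 ≠ 0)
    (h4 : (k - a ^ 2) % 4 ≠ 0) (h7 : (k - a ^ 2) % 8 ≠ 7)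
    (h : a ^ 2 % 5 = 2 * k % 5 ∨ k % 5 = a ^ 2 % 5 ∧ k % 25 ≠ a ^ 2 % 25) :
    ∃ a b c d : ℤ, (k : ℤ) = a ^ 2 + b ^ 2 + c ^ 2 + d ^ 2 ∧ IsExoticModFive a b c d := by
  obtain ⟨u, v, w, huvw⟩ := exists_sum_three_sq h4 h7
  have hk : (k : ℤ) = (a : ℤ) ^ 2 + u ^ 2 + v ^ 2 + w ^ 2 := by
    rw [Nat.cast_sub hak] at huvw
    push_cast at huvw
    linarith
  exact ⟨a, u, v, w, hk, isExoticModFive_of_emod hk (by omega) (by exact_mod_cast h)⟩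

theorem exists_isExoticModFive {k : ℕ} (hk1 : k ≠ 1) (hk2 : k % 2 = 1) (hk5 : k % 5 ≠ 0) :
    ∃ a b c d : ℤ, (k : ℤ) = a ^ 2 + b ^ 2 + c ^ 2 + d ^ 2 ∧ IsExoticModFive a b c d := by
  have key := fun a : ℕ => exists_isExoticModFive_of_emod (k := k) a
  by_cases h13 : k = 13
  · subst h13
    exact ⟨1, 2, 2, 2, by norm_num, isExoticModFive_of_emod rfl (by norm_num) (by norm_num)⟩
  by_cases h29 : k = 29
  · subst h29
    exact ⟨2, 3, 4, 0, by norm_num, Or.inr (by decide)⟩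
  by_cases h51 : k = 51
  · subst h51
    exact ⟨1, 3, 4, 5, by norm_num, Or.inr (by decide)⟩
  by_cases h2 : k % 5 = 2
  · by_cases h3 : k % 8 = 3
    · exact key 3 (by omega) (by omega) (by omega) (by omega) (by omega)
    · exact key 2 (by omega) (by omega) (by omega) (by omega) (by omega)
  by_cases h3 : k % 5 = 3
  · by_cases h3 : k % 4 = 3
    · exact key 1 (by omega) (by omega) (by omega) (by omega) (by omega)
    · exact key 4 (by omega) (by omega) (by omega) (by omega) (by omega)
  by_cases h1 : k % 5 = 1
  · by_cases h3 : k % 4 = 3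
    · by_cases h25 : k % 25 = 1
      · exact key 9 (by omega) (by omega) (by omega) (by omega) (by omega)
      · exact key 1 (by omega) (by omega) (by omega) (by omega) (by omega)
    · by_cases h25 : k % 25 = 16
      · exact key 6 (by omega) (by omega) (by omega) (by omega) (by omega)
      · exact key 4 (by omega) (by omega) (by omega) (by omega) (by omega)
  · by_cases h3 : k % 4 = 3
    · by_cases h25 : k % 25 = 9
      · exact key 7 (by omega) (by omega) (by omega) (by omega) (by omega)
      · exact key 3 (by omega) (by omega) (by omega) (by omega) (by omega)
    · by_cases h25 : k % 25 = 4
      · exact key 8 (by omega) (by omega) (by omega) (by omega) (by omega)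
      · exact key 2 (by omega) (by omega) (by omega) (by omega) (by omega)

/-- Both kinds of representations of `k² m` as a sum of three squares, obtained by rotating
representations of `m`. -/
theorem exists_sum_three_sq_sq_mul {k m : ℤ} {a b c d x y z : ℤ}
    (hk : k = a ^ 2 + b ^ 2 + c ^ 2 + d ^ 2) (hex : IsExoticModFive a b c d)
    (hm : m = x ^ 2 + y ^ 2 + z ^ 2) (hm5 : m % 5 = 2 ∨ m % 5 = 3) (P : Prop) :
    ∃ X Y Z : ℤ, k ^ 2 * m = X ^ 2 + Y ^ 2 + Z ^ 2 ∧ (P ↔ (5 : ℤ) ∣ X * Y * Z) := by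
  have hmod : (x : ZMod 5) ^ 2 + y ^ 2 + z ^ 2 = 2 ∨ (x : ZMod 5) ^ 2 + y ^ 2 + z ^ 2 = 3 := by
    refine hm5.imp (fun h => ?_) (fun h => ?_)
    · exact_mod_cast hm ▸ (ZMod.intCast_eq_intCast_iff' m 2 5).2 h
    · exact_mod_cast hm ▸ (ZMod.intCast_eq_intCast_iff' m 3 5).2 h
  classical
  obtain ⟨e₁, e₂, h⟩ := exists_signs_ne_zero_and_eq_zero a b c d hex x y z hmod (if P then 0 else 1)
  have hsq : ∀ e : ℕ, ((-1 : ℤ) ^ e) ^ 2 = 1 := fun e => by rw [← pow_mul, mul_comm, pow_mul]; simp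
  obtain ⟨y', hy'⟩ : ∃ y' : ℤ, y' = (-1) ^ e₁.val * y := ⟨_, rfl⟩
  obtain ⟨z', hz'⟩ : ∃ z' : ℤ, z' = (-1) ^ e₂.val * z := ⟨_, rfl⟩
  refine ⟨(a ^ 2 + b ^ 2 - c ^ 2 - d ^ 2) * x + 2 * (b * c - a * d) * y' + 2 * (b * d + a * c) * z',
    2 * (b * c + a * d) * x + (a ^ 2 - b ^ 2 + c ^ 2 - d ^ 2) * y' + 2 * (c * d - a * b) * z',
    2 * (b * d - a * c) * x + 2 * (c * d + a * b) * y' + (a ^ 2 - b ^ 2 - c ^ 2 + d ^ 2) * z',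
    ?_, ?_⟩
  · have hm' : m = x ^ 2 + y' ^ 2 + z' ^ 2 := by
      rw [hm, hy', hz', mul_pow, mul_pow, hsq, hsq]; ring
    rw [hk, hm']; ring
  · have hP : P ↔ ((if P then 0 else 1 : Fin 2) = 0) := by by_cases hP : P <;> simp [hP]
    rw [hP, h, hy', hz', show (5 : ℤ) = ((5 : ℕ) : ℤ) from rfl,
      ← ZMod.intCast_zmod_eq_zero_iff_dvd]
    push_cast
    rfl

theorem five_dvd_sub_or_add {X Y : ℤ} (h : (X - Y) * (X + Y) % 5 = 0) :
    ∃ b Y' : ℤ, Y' ^ 2 = Y ^ 2 ∧ 5 * b = X + Y' := by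
  rcases Int.Prime.dvd_mul' (p := 5) (by norm_num) (Int.dvd_of_emod_eq_zero h) with h | h
  · obtain ⟨b, hb⟩ := h
    exact ⟨b, -Y, by ring, by rw [← sub_eq_add_neg, hb]; rfl⟩
  · obtain ⟨b, hb⟩ := h
    exact ⟨b, Y, rfl, hb.symm⟩

theorem sq_emod_five (X : ℤ) :
    X % 5 = 0 ∧ X ^ 2 % 5 = 0 ∨ X % 5 ≠ 0 ∧ (X ^ 2 % 5 = 1 ∨ X ^ 2 % 5 = 4) := by
  have h : X % 5 = 0 ∨ X % 5 = 1 ∨ X % 5 = 2 ∨ X % 5 = 3 ∨ X % 5 = 4 := by omega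
  rcases h with h | h | h | h | h <;> simp [sq, Int.mul_emod, h]

theorem exists_eq_f_of_not_five_dvd {n X Y Z : ℤ} (h : n = X ^ 2 + Y ^ 2 + Z ^ 2)
    (hn : n % 5 = 2 ∨ n % 5 = 3) (hXYZ : ¬ (5 : ℤ) ∣ X * Y * Z) :
    ∃ a b c : ℤ, n = 3 * a ^ 2 + 25 * b ^ 2 + 25 * c ^ 2 - 10 * a * b - 10 * a * c := by
  have hX : X % 5 ≠ 0 := fun h0 => hXYZ (((Int.dvd_of_emod_eq_zero h0).mul_right Y).mul_right Z)
  have hY : Y % 5 ≠ 0 := fun h0 => hXYZ (((Int.dvd_of_emod_eq_zero h0).mul_left X).mul_right Z)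
  have hZ : Z % 5 ≠ 0 := fun h0 => hXYZ ((Int.dvd_of_emod_eq_zero h0).mul_left (X * Y))
  have hX' := sq_emod_five X
  have hY' := sq_emod_five Y
  have hZ' := sq_emod_five Z
  obtain ⟨b, Y', hYY, hb⟩ := five_dvd_sub_or_add (X := X) (Y := Y)
    (by rw [show (X - Y) * (X + Y) = X ^ 2 - Y ^ 2 by ring]; omega)
  obtain ⟨c, Z', hZZ, hc⟩ := five_dvd_sub_or_add (X := X) (Y := Z)
    (by rw [show (X - Z) * (X + Z) = X ^ 2 - Z ^ 2 by ring]; omega)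
  refine ⟨X, b, c, ?_⟩
  obtain rfl : Y' = 5 * b - X := by linarith
  obtain rfl : Z' = 5 * c - X := by linarith
  linear_combination h - hYY - hZZ

theorem exists_eq_g_of_five_dvd_right {n X Y Z : ℤ} (h : n = X ^ 2 + Y ^ 2 + Z ^ 2)
    (hn : n % 5 = 2 ∨ n % 5 = 3) (hZ : (5 : ℤ) ∣ Z) :
    ∃ a b c : ℤ, n = 2 * a ^ 2 + 25 * b ^ 2 + 25 * c ^ 2 - 10 * a * b := by
  have hX' := sq_emod_five X
  have hY' := sq_emod_five Y
  have hZ' := sq_emod_five Z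
  obtain ⟨b, Y', hYY, hb⟩ := five_dvd_sub_or_add (X := X) (Y := Y)
    (by rw [show (X - Y) * (X + Y) = X ^ 2 - Y ^ 2 by ring]; omega)
  obtain ⟨c, rfl⟩ := hZ
  refine ⟨X, b, c, ?_⟩
  obtain rfl : Y' = 5 * b - X := by linarith
  linear_combination h - hYY

theorem exists_eq_g_of_five_dvd {n X Y Z : ℤ} (h : n = X ^ 2 + Y ^ 2 + Z ^ 2)
    (hn : n % 5 = 2 ∨ n % 5 = 3) (hXYZ : (5 : ℤ) ∣ X * Y * Z) :
    ∃ a b c : ℤ, n = 2 * a ^ 2 + 25 * b ^ 2 + 25 * c ^ 2 - 10 * a * b := by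
  have h5 : Prime (5 : ℤ) := by norm_num
  rcases h5.dvd_or_dvd hXYZ with hXY | hZ
  · rcases h5.dvd_or_dvd hXY with hX | hY
    · exact exists_eq_g_of_five_dvd_right (X := Y) (Y := Z) (by linarith) hn hX
    · exact exists_eq_g_of_five_dvd_right (X := X) (Y := Z) (by linarith) hn hY
  · exact exists_eq_g_of_five_dvd_right h hn hZ

theorem emod_eight_ne_seven_of_padicInt {n : ℕ} (h : ∃ x y z : ℤ_[2],
    3 * x ^ 2 + 25 * y ^ 2 + 25 * z ^ 2 - 10 * x * y - 10 * x * z = (n : ℤ_[2])) :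
    n % 8 ≠ 7 := by
  intro h7
  obtain ⟨x, y, z, h⟩ := h
  have h := congrArg (PadicInt.toZModPow (p := 2) 3) h
  simp only [map_sub, map_add, map_mul, map_pow, map_natCast, map_ofNat] at h
  have hn : (n : ZMod (2 ^ 3)) = 7 := by
    exact_mod_cast (ZMod.natCast_eq_natCast_iff' n 7 8).2 h7
  rw [hn] at h
  revert h
  generalize PadicInt.toZModPow 3 x = x
  generalize PadicInt.toZModPow 3 y = y
  generalize PadicInt.toZModPow 3 z = z
  revert x y z
  decide +kernel

theorem eq_two_or_three_of_zmod_five : ∀ r < 5, r ≠ 0 → ∀ x y z : ZMod 5,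
    3 * x ^ 2 + 25 * y ^ 2 + 25 * z ^ 2 - 10 * x * y - 10 * x * z = (r : ℕ) → r = 2 ∨ r = 3 := by
  decide +kernel

theorem emod_five_of_padicInt {n : ℕ} [Fact (Nat.Prime 5)] (hn : n % 5 ≠ 0) (h : ∃ x y z : ℤ_[5],
    3 * x ^ 2 + 25 * y ^ 2 + 25 * z ^ 2 - 10 * x * y - 10 * x * z = (n : ℤ_[5])) :
    n % 5 = 2 ∨ n % 5 = 3 := by
  obtain ⟨x, y, z, h⟩ := h
  have h := congrArg (PadicInt.toZMod (p := 5)) h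
  simp only [map_sub, map_add, map_mul, map_pow, map_natCast, map_ofNat] at h
  rw [← ZMod.natCast_mod] at h
  have hlt : n % 5 < 5 := Nat.mod_lt _ (by norm_num)
  exact eq_two_or_three_of_zmod_five _ hlt hn _ _ _ h


/-- If `n` is positive, not square-free, coprime to `5`, with `ord₂(n) ≤ 1`, and `n` is
represented by the genus of `f` (i.e. represented by `f` over every `ℤ_p`), then `n` is
represented over `ℤ` by both `f(x,y,z) = 3x² + 25y² + 25z² − 10xy − 10xz` and
`g(x,y,z) = 2x² + 25y² + 25z² − 10xy`. -/
theorem stmt_12 (n : ℕ) (hn : 0 < n) (hnsf : ¬Squarefree n)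
    (h5 : Nat.Coprime n 5) (h4 : ¬(4 ∣ n))
    (hgen : ∀ (p : ℕ) [Fact p.Prime], ∃ x y z : ℤ_[p],
      3 * x ^ 2 + 25 * y ^ 2 + 25 * z ^ 2 - 10 * x * y - 10 * x * z = (n : ℤ_[p])) :
    (∃ a b c : ℤ,
      (n : ℤ) = 3 * a ^ 2 + 25 * b ^ 2 + 25 * c ^ 2 - 10 * a * b - 10 * a * c) ∧
    (∃ a b c : ℤ,
      (n : ℤ) = 2 * a ^ 2 + 25 * b ^ 2 + 25 * c ^ 2 - 10 * a * b) := by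
  have : Fact (Nat.Prime 5) := ⟨by norm_num⟩
  have hn5 : n % 5 ≠ 0 := fun h =>
    (Nat.Prime.coprime_iff_not_dvd (by norm_num)).1 h5.symm (Nat.dvd_of_mod_eq_zero h)
  have hn8 := emod_eight_ne_seven_of_padicInt (hgen 2)
  have hn23 := emod_five_of_padicInt hn5 (hgen 5)
  obtain ⟨k, ⟨m, rfl⟩, hk⟩ : ∃ k, k * k ∣ n ∧ ¬ IsUnit k := by
    simpa [Squarefree] using hnsf
  have hk2 : k % 2 = 1 := by
    by_contra h
    obtain ⟨l, rfl⟩ : 2 ∣ k := by omega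
    exact h4 ⟨l * l * m, by ring⟩
  have hk5 : k % 5 ≠ 0 := fun h => hn5 (by simp [Nat.mul_mod, h])
  have hkk8 : k * k % 8 = 1 := by
    have h : k % 8 = 1 ∨ k % 8 = 3 ∨ k % 8 = 5 ∨ k % 8 = 7 := by omega
    rcases h with h | h | h | h <;> simp [Nat.mul_mod, h]
  have hkm8 : k * k * m % 8 = m % 8 := by simp [Nat.mul_mod _ m, hkk8]
  have hm5 : m % 5 = 2 ∨ m % 5 = 3 := by
    have hk' : k % 5 = 1 ∨ k % 5 = 2 ∨ k % 5 = 3 ∨ k % 5 = 4 := by omega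
    have hm' : m % 5 = 0 ∨ m % 5 = 1 ∨ m % 5 = 2 ∨ m % 5 = 3 ∨ m % 5 = 4 := by omega
    rcases hk' with h | h | h | h <;> rcases hm' with h' | h' | h' | h' | h' <;>
      simp [Nat.mul_mod, h, h'] at hn23 ⊢
  obtain ⟨a, b, c, d, habcd, hex⟩ :=
    exists_isExoticModFive (k := k) (fun h => hk (by simp [h])) hk2 hk5
  obtain ⟨x, y, z, hxyz⟩ := exists_sum_three_sq (n := m) (by omega) (by omega)
  have hcast : ((k * k * m : ℕ) : ℤ) = (k : ℤ) ^ 2 * m := by push_cast; ring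
  have key := exists_sum_three_sq_sq_mul habcd hex hxyz (by omega)
  simp only [← hcast] at key
  have hn23' : ((k * k * m : ℕ) : ℤ) % 5 = 2 ∨ ((k * k * m : ℕ) : ℤ) % 5 = 3 := by
    exact_mod_cast hn23
  constructor
  · obtain ⟨X, Y, Z, h, hP⟩ := key False
    exact exists_eq_f_of_not_five_dvd h hn23' hP.2
  · obtain ⟨X, Y, Z, h, hP⟩ := key True
    exact exists_eq_g_of_five_dvd h hn23' (hP.1 trivial)
end
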